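/- arXiv:1711.03513 — 2 statements merged into one kernel-verified Lean document; each statement's English description precedes it below -/
import Mathlib

section
/- For d = 5, b = 1 (the pushforward of O_{ℙ²}(1) under the 5-uple embedding): dim K_{p,0}(ℙ²,1;5) for p = 0, 1, 2 equals 3, 35, 120 respectively; dim K_{p,1}(ℙ²,1;5) for p = 2,…,16 equals 405, 5865, 29988, 97920, 231540, 417690, 590070, 661232, 590070, 417690, 231540, 97920, 29988, 5865, 405 respectively; dim K_{p,2}(ℙ²,1;5) for p = 16, 17, 18 equals 120, 35, 3 respectively; and K_{p,q}(ℙ²,1;5) = 0 for all other pairs (p,q) with p ≥ 0 and q ∈ ℤ. -/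
open scoped TensorProduct

set_option maxHeartbeats 2000000
set_option synthInstance.maxHeartbeats 1000000

noncomputable section

/-- The dimension (over `ℂ`) of a complex vector space, as a natural number. -/
def cdim (M : Type*) [AddCommMonoid M] [Module ℂ M] : ℕ := (Module.rank ℂ M).toNat

/-- The polynomial ring `S = ℂ[x₀,…,x_{N-1}]`. -/
abbrev PolyC (N : ℕ) : Type := MvPolynomial (Fin N) ℂ

/-- The space `S_e` of homogeneous polynomials of degree `e` (zero for `e < 0`). -/
def Sdeg (N : ℕ) (e : ℤ) : Submodule ℂ (PolyC N) :=
  if 0 ≤ e then MvPolynomial.homogeneousSubmodule (Fin N) ℂ e.toNat else ⊥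

/-- The monomial `x^σ`. -/
def monoC (N : ℕ) (σ : Fin N →₀ ℕ) : PolyC N := MvPolynomial.monomial σ (1 : ℂ)

/-- The wedge product `m₁ ∧ ⋯ ∧ mₙ` as an element of the `n`-th exterior power. -/
def wedgeE (R : Type*) [CommRing R] (M : Type*) [AddCommGroup M] [Module R M]
    (n : ℕ) (m : Fin n → M) : ↥(⋀[R]^n M) :=
  ⟨ExteriorAlgebra.ιMulti R n m, ExteriorAlgebra.ιMulti_range R n ⟨m, rfl⟩⟩

/-- The module `⋀^p S_d ⊗ S_e`. -/
abbrev KosModule (N : ℕ) (d : ℤ) (p : ℕ) (e : ℤ) : Type :=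
  (↥(⋀[ℂ]^p ↥(Sdeg N d))) ⊗[ℂ] ↥(Sdeg N e)

/-- `D` satisfies the defining formula of the Koszul differential
`∂_{p+1} : ⋀^{p+1} S_d ⊗ S_e → ⋀^p S_d ⊗ S_{e'}` (for `e' = e + d`), namely
`∂(m₁∧⋯∧m_{p+1} ⊗ f) = ∑ₖ (−1)ᵏ m₁∧⋯∧m̂ₖ∧⋯∧m_{p+1} ⊗ (mₖ·f)`; the equality is
stated after applying the (injective) inclusion `⋀^p S_d ⊗ S_{e'} → ⋀^p S_d ⊗ S`. -/
def IsKoszulDiff (N : ℕ) (d e e' : ℤ) (p : ℕ)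
    (D : KosModule N d (p + 1) e →ₗ[ℂ] KosModule N d p e') : Prop :=
  ∀ (m : Fin (p + 1) → ↥(Sdeg N d)) (f : ↥(Sdeg N e)),
    TensorProduct.map (LinearMap.id (R := ℂ) (M := ↥(⋀[ℂ]^p ↥(Sdeg N d)))) (Sdeg N e').subtype
        (D (wedgeE ℂ ↥(Sdeg N d) (p + 1) m ⊗ₜ[ℂ] f)) =
      ∑ k : Fin (p + 1), ((-1 : ℂ) ^ ((k : ℕ) + 1)) •
        (wedgeE ℂ ↥(Sdeg N d) p (fun i => m (Fin.succAbove k i)) ⊗ₜ[ℂ]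
          ((m k : PolyC N) * (f : PolyC N)))

/-- A family of maps of the shape of the Koszul differentials. -/
def KFam (N : ℕ) (d : ℤ) : Type :=
  ∀ (p : ℕ) (e e' : ℤ), KosModule N d (p + 1) e →ₗ[ℂ] KosModule N d p e'

/-- The family `D` consists of the Koszul differentials (at all meaningful degrees). -/
def IsKoszulFam (N : ℕ) (d : ℤ) (D : KFam N d) : Prop :=
  ∀ (p : ℕ) (e e' : ℤ), e' = e + d → IsKoszulDiff N d e e' p (D p e e')

/-- `dim K_{p,q}(ℙ^{N-1}, b; d)`: the dimension of the homology `ker ∂_p / im ∂_{p+1}` at the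
middle term of `⋀^{p+1} S_d ⊗ S_{b+(q-1)d} → ⋀^p S_d ⊗ S_{b+qd} → ⋀^{p-1} S_d ⊗ S_{b+(q+1)d}`,
where for `p = 0` the right-hand map is the zero map (the dimension of the quotient is expressed
as `dim ker − dim (im ⊓ ker)`, which agrees with it since all spaces here are
finite-dimensional). -/
def Kdim (N : ℕ) (d : ℤ) (D : KFam N d) (b : ℤ) : ℕ → ℤ → ℕ
  | 0, q =>
      cdim (KosModule N d 0 (b + q * d)) -
        cdim ↥(LinearMap.range (D 0 (b + (q - 1) * d) (b + q * d)))
  | p + 1, q =>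
      cdim ↥(LinearMap.ker (D p (b + q * d) (b + (q + 1) * d))) -
        cdim
          ↥(LinearMap.range (D (p + 1) (b + (q - 1) * d) (b + q * d)) ⊓
            LinearMap.ker (D p (b + q * d) (b + (q + 1) * d)))

/-- The multidegree-`a` component of `⋀^p S_d ⊗ S_e`: the span of the pure tensors
`m₁∧⋯∧m_p ⊗ f` with the `mᵢ` and `f` monomials of total multidegree `a`. -/
def KComp (N : ℕ) (d : ℤ) (p : ℕ) (e : ℤ) (a : Fin N →₀ ℕ) :
    Submodule ℂ (KosModule N d p e) :=
  Submodule.span ℂ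
    { x | ∃ (σ : Fin p → (Fin N →₀ ℕ)) (τ : Fin N →₀ ℕ)
        (hσ : ∀ i, monoC N (σ i) ∈ Sdeg N d) (hτ : monoC N τ ∈ Sdeg N e),
        (∑ i, σ i) + τ = a ∧
        x = wedgeE ℂ ↥(Sdeg N d) p (fun i => (⟨monoC N (σ i), hσ i⟩ : ↥(Sdeg N d))) ⊗ₜ[ℂ]
            (⟨monoC N τ, hτ⟩ : ↥(Sdeg N e)) }

/-- `dim K_{p,q}(ℙ^{N-1}, b; d)_a`: the dimension of the multidegree-`a` component of the
homology, i.e. of `(ker ∂_p ∩ (⋀^p S_d ⊗ S_{b+qd})_a) / (im ∂_{p+1} ∩ (⋀^p S_d ⊗ S_{b+qd})_a)`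
(again expressed as a difference of dimensions). -/
def KdimA (N : ℕ) (d : ℤ) (D : KFam N d) (b : ℤ) : ℕ → ℤ → (Fin N →₀ ℕ) → ℕ
  | 0, q, a =>
      cdim ↥(KComp N d 0 (b + q * d) a) -
        cdim
          ↥(LinearMap.range (D 0 (b + (q - 1) * d) (b + q * d)) ⊓ KComp N d 0 (b + q * d) a)
  | p + 1, q, a =>
      cdim
        ↥(LinearMap.ker (D p (b + q * d) (b + (q + 1) * d)) ⊓ KComp N d (p + 1) (b + q * d) a) -
        cdim
          ↥(LinearMap.range (D (p + 1) (b + (q - 1) * d) (b + q * d)) ⊓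
            (LinearMap.ker (D p (b + q * d) (b + (q + 1) * d)) ⊓
              KComp N d (p + 1) (b + q * d) a))

/-- Build a multidegree in `Fin 3 →₀ ℕ` from three exponents. -/
def mdeg3 (i j k : ℕ) : Fin 3 →₀ ℕ := Finsupp.equivFunOnFinite.symm ![i, j, k]

end


set_option linter.style.haveILetI false
set_option linter.unusedSectionVars false


namespace Kz

set_option linter.unusedSectionVars false

section model
variable {ι : Type} [LinearOrder ι] {A : Type} [AddCommGroup A] [Module ℂ A]

/-- Koszul sign: parity of the number of elements of `J` below `i`. -/
def eps (i : ι) (J : Finset ι) : ℂ := (-1) ^ ((J.filter (· < i)).card)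

/-- Koszul differential on functions on finite subsets. -/
noncomputable def kd (T : Finset ι) (μ : ι → A →ₗ[ℂ] A) :
    (Finset ι → A) →ₗ[ℂ] (Finset ι → A) :=
  LinearMap.pi fun J => ∑ i ∈ T \ J, eps i J • (μ i ∘ₗ LinearMap.proj (insert i J))

lemma kd_apply (T : Finset ι) (μ : ι → A →ₗ[ℂ] A) (α : Finset ι → A) (J : Finset ι) :
    kd T μ α J = ∑ i ∈ T \ J, eps i J • μ i (α (insert i J)) := by
  simp [kd]

/-- Chains: functions with values in `W` supported on `p`-subsets of `T`. -/
def CC (T : Finset ι) (p : ℤ) (W : Submodule ℂ A) : Submodule ℂ (Finset ι → A) where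
  carrier := {α | ∀ J, α J ∈ W ∧ (¬(J ⊆ T ∧ (J.card : ℤ) = p) → α J = 0)}
  add_mem' := by
    intro a b ha hb J
    refine ⟨W.add_mem (ha J).1 (hb J).1, fun h => ?_⟩
    simp [(ha J).2 h, (hb J).2 h]
  zero_mem' := by intro J; simp
  smul_mem' := by
    intro c a ha J
    refine ⟨W.smul_mem c (ha J).1, fun h => ?_⟩
    simp [(ha J).2 h]

lemma mem_CC {T : Finset ι} {p : ℤ} {W : Submodule ℂ A} {α : Finset ι → A} :
    α ∈ CC T p W ↔ ∀ J, α J ∈ W ∧ (¬(J ⊆ T ∧ (J.card : ℤ) = p) → α J = 0) := Iff.rfl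

lemma eps_mul_self (i : ι) (J : Finset ι) : eps i J * eps i J = 1 := by
  simp only [eps, ← pow_add, ← two_mul]
  rw [pow_mul]; simp

lemma eps_ne_zero (i : ι) (J : Finset ι) : eps i J ≠ 0 := by
  intro h
  have := eps_mul_self i J
  rw [h] at this; simp at this

lemma eps_insert (i j : ι) (J : Finset ι) (hj : j ∉ J) :
    eps i (insert j J) = (if j < i then -1 else 1) * eps i J := by
  unfold eps
  rw [Finset.filter_insert]
  split_ifs with h
  · rw [Finset.card_insert_of_notMem (by simp [hj]), pow_succ]; ring
  · simp

lemma eps_anti (i j : ι) (J : Finset ι) (hij : i ≠ j) (hi : i ∉ J) (hj : j ∉ J) :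
    eps i J * eps j (insert i J) = - (eps j J * eps i (insert j J)) := by
  rw [eps_insert j i J hi, eps_insert i j J hj]
  rcases lt_or_gt_of_ne hij with h | h
  · rw [if_pos h, if_neg (not_lt.2 h.le)]; ring
  · rw [if_pos h, if_neg (not_lt.2 h.le)]; ring

lemma kd_kd (T : Finset ι) (μ : ι → A →ₗ[ℂ] A)
    (hμ : ∀ i j a, μ i (μ j a) = μ j (μ i a)) (α : Finset ι → A) :
    kd T μ (kd T μ α) = 0 := by
  funext J
  rw [kd_apply]
  simp only [kd_apply, map_sum, map_smul, Finset.smul_sum, smul_smul, Pi.zero_apply]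
  rw [Finset.sum_sigma']
  refine Finset.sum_involution (fun x _ => ⟨x.2, x.1⟩) ?_ ?_ ?_ ?_
  · rintro ⟨i, j⟩ h
    simp only [Finset.mem_sigma, Finset.mem_sdiff, Finset.mem_insert, not_or] at h
    obtain ⟨⟨hi, hiJ⟩, hj, hji, hjJ⟩ := h
    simp only
    rw [eps_anti i j J (Ne.symm hji) hiJ hjJ, hμ i j, Finset.insert_comm j i J, neg_smul]
    simp
  · rintro ⟨i, j⟩ h _ h2
    simp only [Finset.mem_sigma, Finset.mem_sdiff, Finset.mem_insert, not_or] at h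
    simp only [Sigma.mk.injEq, heq_eq_eq] at h2
    exact h.2.2.1 h2.1
  · rintro ⟨i, j⟩ h
    simp only [Finset.mem_sigma, Finset.mem_sdiff, Finset.mem_insert, not_or] at h ⊢
    tauto
  · rintro ⟨i, j⟩ h
    rfl

lemma kd_mem {T : Finset ι} {μ : ι → A →ₗ[ℂ] A} {p : ℤ} {W W' : Submodule ℂ A}
    (h : ∀ i, ∀ w ∈ W, μ i w ∈ W') {α : Finset ι → A} (hα : α ∈ CC T p W) :
    kd T μ α ∈ CC T (p - 1) W' := by
  intro J
  rw [kd_apply]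
  refine ⟨Submodule.sum_mem _ fun i _ => W'.smul_mem _ (h i _ (hα _).1), fun hJ => ?_⟩
  refine Finset.sum_eq_zero fun i hi => ?_
  rw [Finset.mem_sdiff] at hi
  rw [(hα (insert i J)).2, map_zero, smul_zero]
  rintro ⟨h1, h2⟩
  apply hJ
  rw [Finset.card_insert_of_notMem hi.2] at h2
  refine ⟨(Finset.subset_insert _ _).trans h1, by push_cast at h2; omega⟩

/-- Cycles. -/
noncomputable def ZZ (T : Finset ι) (μ : ι → A →ₗ[ℂ] A) (p : ℤ) (W : Submodule ℂ A) :
    Submodule ℂ (Finset ι → A) := CC T p W ⊓ LinearMap.ker (kd T μ)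

/-- Boundaries. -/
noncomputable def BB (T : Finset ι) (μ : ι → A →ₗ[ℂ] A) (p : ℤ) (W : Submodule ℂ A) :
    Submodule ℂ (Finset ι → A) := (CC T p W).map (kd T μ)

/-- Reduction map. -/
noncomputable def redMap (ℓ : ι) (π : A →ₗ[ℂ] A) : (Finset ι → A) →ₗ[ℂ] (Finset ι → A) :=
  LinearMap.pi fun J => if ℓ ∈ J then 0 else π ∘ₗ LinearMap.proj J

lemma redMap_apply (ℓ : ι) (π : A →ₗ[ℂ] A) (α : Finset ι → A) (J : Finset ι) :
    redMap ℓ π α J = if ℓ ∈ J then 0 else π (α J) := by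
  simp only [redMap, LinearMap.pi_apply]
  split_ifs <;> simp

/-- Hypotheses for the reduction modulo a nonzerodivisor. -/
structure RedHyp (T' : Finset ι) (ℓ : ι) (μ μ' : ι → A →ₗ[ℂ] A) (π : A →ₗ[ℂ] A)
    (W W' : ℤ → Submodule ℂ A) : Prop where
  hℓ : ℓ ∉ T'
  hμ : ∀ i j a, μ i (μ j a) = μ j (μ i a)
  hW : ∀ q i, ∀ w ∈ W q, μ i w ∈ W (q + 1)
  hW' : ∀ q, W' q = (W q).map π
  hinj : ∀ q, ∀ w ∈ W q, μ ℓ w = 0 → w = 0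
  hker : ∀ q, ∀ w ∈ W q, π w = 0 → ∃ v ∈ W (q - 1), μ ℓ v = w
  hπℓ : ∀ w, π (μ ℓ w) = 0
  hcomm : ∀ i w, μ' i (π w) = π (μ i w)

section red
variable {T' : Finset ι} {ℓ : ι} {μ μ' : ι → A →ₗ[ℂ] A} {π : A →ₗ[ℂ] A}
  {W W' : ℤ → Submodule ℂ A}

lemma red_kd (H : RedHyp T' ℓ μ μ' π W W') (α : Finset ι → A) :
    redMap ℓ π (kd (insert ℓ T') μ α) = kd T' μ' (redMap ℓ π α) := by
  obtain ⟨hℓ, hμ, hW, hW', hinj, hker, hπℓ, hcomm⟩ := id H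
  funext J
  rw [redMap_apply, kd_apply, kd_apply]
  split_ifs with hJ
  · symm
    refine Finset.sum_eq_zero fun i hi => ?_
    rw [redMap_apply, if_pos (Finset.mem_insert_of_mem hJ)]; simp
  · have : insert ℓ T' \ J = insert ℓ (T' \ J) := Finset.insert_sdiff_of_notMem _ hJ
    rw [this, Finset.sum_insert (by simp [hℓ]), map_add, map_smul, hπℓ, smul_zero, zero_add,
      map_sum]
    refine Finset.sum_congr rfl fun i hi => ?_
    rw [Finset.mem_sdiff] at hi
    have hne : ℓ ≠ i := by rintro rfl; exact hℓ hi.1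
    rw [redMap_apply, if_neg (by simp [hne, hJ]), map_smul, hcomm]

lemma red_acyclic (H : RedHyp T' ℓ μ μ' π W W') (p q : ℤ) (α : Finset ι → A) (hα : α ∈ CC (insert ℓ T') p (W q))
    (hd : kd (insert ℓ T') μ α = 0) (hr : redMap ℓ π α = 0) :
    ∃ γ ∈ CC (insert ℓ T') (p + 1) (W (q - 1)), redMap ℓ π γ = 0 ∧
      kd (insert ℓ T') μ γ = α := by
  obtain ⟨hℓ, hμ, hW, hW', hinj, hker, hπℓ, hcomm⟩ := id H
  classical
  have key : ∀ J, ∃ v ∈ W (q - 1), ℓ ∉ J → μ ℓ v = α J := by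
    intro J
    by_cases hJ : ℓ ∈ J
    · exact ⟨0, zero_mem _, fun h => absurd hJ h⟩
    · have := congrFun hr J
      rw [redMap_apply, if_neg hJ] at this
      obtain ⟨v, hv, hv'⟩ := hker q _ (hα J).1 this
      exact ⟨v, hv, fun _ => hv'⟩
  choose v hv hv' using key
  let γ : Finset ι → A := fun J =>
    if ℓ ∈ J ∧ (J ⊆ insert ℓ T' ∧ (J.card : ℤ) = p + 1) then
      eps ℓ (J.erase ℓ) • v (J.erase ℓ) else 0
  have hγ : γ ∈ CC (insert ℓ T') (p + 1) (W (q - 1)) := by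
    intro J
    simp only [γ]
    split_ifs with h
    · exact ⟨Submodule.smul_mem _ _ (hv _), fun h' => absurd h.2 h'⟩
    · exact ⟨zero_mem _, fun _ => rfl⟩
  have hγr : redMap ℓ π γ = 0 := by
    funext J
    rw [redMap_apply]
    split_ifs with h
    · rfl
    · simp [γ, h]
  refine ⟨γ, hγ, hγr, ?_⟩
  have hdγ : ∀ J, ℓ ∉ J → kd (insert ℓ T') μ γ J = α J := by
    intro J hJ
    rw [kd_apply, Finset.sum_eq_single ℓ]
    · by_cases hc : J ⊆ insert ℓ T' ∧ (J.card : ℤ) = p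
      · have : γ (insert ℓ J) = eps ℓ J • v J := by
          simp only [γ]
          rw [if_pos, Finset.erase_insert hJ]
          refine ⟨Finset.mem_insert_self _ _, Finset.insert_subset (Finset.mem_insert_self _ _) hc.1, ?_⟩
          rw [Finset.card_insert_of_notMem hJ]; push_cast; omega
        rw [this, map_smul, smul_smul, eps_mul_self, one_smul, hv' J hJ]
      · have : γ (insert ℓ J) = 0 := by
          simp only [γ]
          rw [if_neg]
          rintro ⟨_, h2, h3⟩
          apply hc
          rw [Finset.card_insert_of_notMem hJ] at h3
          exact ⟨(Finset.subset_insert _ _).trans h2, by push_cast at h3; omega⟩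
        rw [this, (hα J).2 hc]; simp
    · intro i _ hi
      have : γ (insert i J) = 0 := by
        simp only [γ]
        rw [if_neg]
        rintro ⟨h1, _⟩
        rw [Finset.mem_insert] at h1
        rcases h1 with h1 | h1
        · exact hi h1.symm
        · exact hJ h1
      rw [this]; simp
    · intro h
      exact absurd (Finset.mem_sdiff.2 ⟨Finset.mem_insert_self _ _, hJ⟩) h
  set δ := α - kd (insert ℓ T') μ γ with hδ
  have hδC : δ ∈ CC (insert ℓ T') p (W q) := by
    refine Submodule.sub_mem _ hα ?_
    have := kd_mem (T := insert ℓ T') (μ := μ) (W' := W q) (fun i w hw => by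
      have := hW (q - 1) i w hw
      rwa [sub_add_cancel] at this) hγ
    rwa [add_sub_cancel_right] at this
  have hδd : kd (insert ℓ T') μ δ = 0 := by
    rw [hδ, map_sub, hd, kd_kd _ _ hμ, sub_zero]
  have hδ0 : ∀ J, ℓ ∉ J → δ J = 0 := by
    intro J hJ
    rw [hδ, Pi.sub_apply, hdγ J hJ, sub_self]
  have hδ1 : ∀ J, ℓ ∉ J → δ (insert ℓ J) = 0 := by
    intro J hJ
    have h := congrFun hδd J
    rw [kd_apply, Finset.sum_eq_single ℓ] at h
    · simp only [Pi.zero_apply, smul_eq_zero, eps_ne_zero, false_or] at h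
      exact hinj q _ (hδC _).1 h
    · intro i _ hi
      rw [hδ0]; · simp
      rw [Finset.mem_insert, not_or]; exact ⟨Ne.symm hi, hJ⟩
    · intro h
      exact absurd (Finset.mem_sdiff.2 ⟨Finset.mem_insert_self _ _, hJ⟩) h
  have : δ = 0 := by
    funext J
    by_cases hJ : ℓ ∈ J
    · have := hδ1 (J.erase ℓ) (Finset.notMem_erase _ _)
      rwa [Finset.insert_erase hJ] at this
    · exact hδ0 J hJ
  rw [hδ, sub_eq_zero] at this
  exact this.symm

lemma red_lift (H : RedHyp T' ℓ μ μ' π W W') (p q : ℤ) (β : Finset ι → A) (hβ : β ∈ CC T' p (W' q)) :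
    ∃ α ∈ CC (insert ℓ T') p (W q), redMap ℓ π α = β := by
  obtain ⟨hℓ, hμ, hW, hW', hinj, hker, hπℓ, hcomm⟩ := id H
  classical
  have key : ∀ J, ∃ w ∈ W q, π w = β J := by
    intro J
    have := (hβ J).1
    rw [hW'] at this
    exact this
  choose w hw hw' using key
  refine ⟨fun J => if J ⊆ T' ∧ (J.card : ℤ) = p then w J else 0, ?_, ?_⟩
  · intro J
    simp only
    split_ifs with h
    · exact ⟨hw J, fun h' => absurd ⟨h.1.trans (Finset.subset_insert _ _), h.2⟩ h'⟩
    · exact ⟨zero_mem _, fun _ => rfl⟩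
  · funext J
    rw [redMap_apply]
    split_ifs with h1 h2
    · symm; apply (hβ J).2; rintro ⟨h, _⟩; exact hℓ (h h1)
    · exact hw' J
    · rw [(hβ J).2 h2, map_zero]

lemma red_mem (H : RedHyp T' ℓ μ μ' π W W') (p q : ℤ) (α : Finset ι → A) (hα : α ∈ CC (insert ℓ T') p (W q)) :
    redMap ℓ π α ∈ CC T' p (W' q) := by
  obtain ⟨hℓ, hμ, hW, hW', hinj, hker, hπℓ, hcomm⟩ := id H
  intro J
  rw [redMap_apply]
  split_ifs with h
  · exact ⟨zero_mem _, fun _ => rfl⟩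
  · refine ⟨by rw [hW']; exact ⟨_, (hα J).1, rfl⟩, fun h' => ?_⟩
    rw [(hα J).2, map_zero]
    rintro ⟨h1, h2⟩
    exact h' ⟨(Finset.subset_insert_iff_of_notMem h).1 h1, h2⟩

lemma finrank_map_add {E : Type*} [AddCommGroup E] [Module ℂ E] (Φ : E →ₗ[ℂ] E)
    (Z : Submodule ℂ E) [FiniteDimensional ℂ Z] :
    Module.finrank ℂ (Z.map Φ) + Module.finrank ℂ (Z ⊓ LinearMap.ker Φ : Submodule ℂ E)
      = Module.finrank ℂ Z := by
  have h := LinearMap.finrank_range_add_finrank_ker (Φ.domRestrict Z)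
  rw [LinearMap.range_domRestrict] at h
  rw [← h, LinearMap.ker_domRestrict]
  congr 1
  rw [← Submodule.finrank_map_subtype_eq Z, Submodule.map_comap_subtype]

lemma red_main (H : RedHyp T' ℓ μ μ' π W W') (p q : ℤ) [FiniteDimensional ℂ (CC (insert ℓ T') p (W q))] :
    Module.finrank ℂ (ZZ (insert ℓ T') μ p (W q)) + Module.finrank ℂ (BB T' μ' (p + 1) (W' (q - 1)))
    = Module.finrank ℂ (ZZ T' μ' p (W' q)) +
      Module.finrank ℂ (BB (insert ℓ T') μ (p + 1) (W (q - 1))) := by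
  obtain ⟨hℓ, hμ, hW, hW', hinj, hker, hπℓ, hcomm⟩ := id H
  have hrk := red_kd H
  have hBZ : BB (insert ℓ T') μ (p + 1) (W (q - 1)) ≤ ZZ (insert ℓ T') μ p (W q) := by
    rintro _ ⟨γ, hγ, rfl⟩
    refine ⟨?_, kd_kd _ _ hμ _⟩
    have := kd_mem (T := insert ℓ T') (μ := μ) (W' := W q) (fun i w hw => by
      have := hW (q - 1) i w hw
      rwa [sub_add_cancel] at this) hγ
    rwa [add_sub_cancel_right] at this
  have hZ : (ZZ (insert ℓ T') μ p (W q)).map (redMap ℓ π) = ZZ T' μ' p (W' q) := by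
    apply le_antisymm
    · rintro _ ⟨α, hα, rfl⟩
      refine ⟨red_mem H p q α hα.1, ?_⟩
      have h2 : kd (insert ℓ T') μ α = 0 := hα.2
      rw [SetLike.mem_coe, LinearMap.mem_ker, ← hrk, h2, map_zero]
    · rintro β ⟨hβ, hβd⟩
      obtain ⟨α, hα, rfl⟩ := red_lift H p q β hβ
      have hm := kd_mem (T := insert ℓ T') (μ := μ) (W' := W (q + 1)) (fun i w hw => hW q i w hw) hα
      obtain ⟨γ, hγ, hγr, hγd⟩ := red_acyclic H (p - 1) (q + 1) _ hm
        (kd_kd _ _ hμ _) (by rw [hrk]; exact hβd)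
      rw [sub_add_cancel, add_sub_cancel_right] at hγ
      refine ⟨α - γ, ⟨Submodule.sub_mem _ hα hγ, ?_⟩, ?_⟩
      · rw [SetLike.mem_coe, LinearMap.mem_ker, map_sub, hγd, sub_self]
      · rw [map_sub, hγr, sub_zero]
  have hB : (BB (insert ℓ T') μ (p + 1) (W (q - 1))).map (redMap ℓ π) =
      BB T' μ' (p + 1) (W' (q - 1)) := by
    apply le_antisymm
    · rintro _ ⟨_, ⟨α, hα, rfl⟩, rfl⟩
      exact ⟨redMap ℓ π α, red_mem H _ _ α hα, (hrk α).symm⟩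
    · rintro _ ⟨β, hβ, rfl⟩
      obtain ⟨α, hα, rfl⟩ := red_lift H _ _ β hβ
      exact ⟨_, ⟨α, hα, rfl⟩, hrk α⟩
  have hK : ZZ (insert ℓ T') μ p (W q) ⊓ LinearMap.ker (redMap ℓ π) =
      BB (insert ℓ T') μ (p + 1) (W (q - 1)) ⊓ LinearMap.ker (redMap ℓ π) := by
    apply le_antisymm
    · rintro α ⟨⟨hα, hd⟩, hr⟩
      obtain ⟨γ, hγ, hγr, hγd⟩ := red_acyclic H p q _ hα hd hr
      exact ⟨⟨γ, hγ, hγd⟩, hr⟩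
    · exact inf_le_inf_right _ hBZ
  have f1 : FiniteDimensional ℂ (ZZ (insert ℓ T') μ p (W q)) :=
    Submodule.finiteDimensional_of_le (inf_le_left : _ ≤ CC (insert ℓ T') p (W q))
  have f2 : FiniteDimensional ℂ (BB (insert ℓ T') μ (p + 1) (W (q - 1))) :=
    Submodule.finiteDimensional_of_le hBZ
  have e1 := finrank_map_add (redMap ℓ π) (ZZ (insert ℓ T') μ p (W q))
  have e2 := finrank_map_add (redMap ℓ π) (BB (insert ℓ T') μ (p + 1) (W (q - 1)))
  rw [hZ] at e1
  rw [hB] at e2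
  rw [hK] at e1
  omega
end red

end model

end Kz



namespace Kz

set_option linter.unusedSectionVars false

section model2
variable {ι : Type} [LinearOrder ι] {A : Type} [AddCommGroup A] [Module ℂ A]

lemma single_mem_CC {T : Finset ι} {p : ℤ} {W : Submodule ℂ A} {J : Finset ι} {a : A}
    (hJ : J ⊆ T) (hp : (J.card : ℤ) = p) (ha : a ∈ W) :
    (Pi.single J a : Finset ι → A) ∈ CC T p W := by
  classical
  intro I
  by_cases h : I = J
  · subst h
    simp [ha, hJ, hp]
  · rw [Pi.single_eq_of_ne h]; simp

/-- Chains as functions on a finite type. -/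
noncomputable def ccEquiv (T : Finset ι) (p : ℕ) (W : Submodule ℂ A) :
    CC T (p : ℤ) W ≃ₗ[ℂ] ({J // J ∈ T.powersetCard p} → W) where
  toFun α := fun J => ⟨α.1 J.1, (α.2 J.1).1⟩
  map_add' a b := by ext; simp
  map_smul' a b := by ext; simp
  invFun f := ⟨fun J => if h : J ∈ T.powersetCard p then (f ⟨J, h⟩ : A) else 0, by
    intro J
    by_cases h : J ∈ T.powersetCard p
    · simp only [h, dif_pos]
      refine ⟨(f ⟨J, h⟩).2, fun h' => ?_⟩
      rw [Finset.mem_powersetCard] at h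
      exact absurd ⟨h.1, by exact_mod_cast h.2⟩ h'
    · simp [h]⟩
  left_inv α := by
    ext J
    by_cases h : J ∈ T.powersetCard p
    · simp [h]
    · simp only [h, dif_neg, not_false_eq_true]
      symm
      apply (α.2 J).2
      rintro ⟨h1, h2⟩
      exact h (Finset.mem_powersetCard.2 ⟨h1, by exact_mod_cast h2⟩)
  right_inv f := by
    ext ⟨J, hJ⟩
    simp [hJ]

instance ccFinite (T : Finset ι) (p : ℕ) (W : Submodule ℂ A) [FiniteDimensional ℂ W] :
    FiniteDimensional ℂ (CC T (p : ℤ) W) :=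
  Module.Finite.equiv (ccEquiv T p W).symm

lemma finrank_CC (T : Finset ι) (p : ℕ) (W : Submodule ℂ A) [FiniteDimensional ℂ W] :
    Module.finrank ℂ (CC T (p : ℤ) W) = T.card.choose p * Module.finrank ℂ W := by
  rw [(ccEquiv T p W).finrank_eq, Module.finrank_pi_fintype]
  simp

lemma rank_null (T : Finset ι) (μ : ι → A →ₗ[ℂ] A) (p : ℕ) (W : Submodule ℂ A)
    [FiniteDimensional ℂ W] :
    Module.finrank ℂ (BB T μ p W) + Module.finrank ℂ (ZZ T μ p W) =
      T.card.choose p * Module.finrank ℂ W := by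
  rw [← finrank_CC]
  exact finrank_map_add (kd T μ) (CC T (p : ℤ) W)

lemma finrank_range_flip {X Y : Type*} [AddCommGroup X] [Module ℂ X] [AddCommGroup Y] [Module ℂ Y]
    [FiniteDimensional ℂ X] [FiniteDimensional ℂ Y] (F : X →ₗ[ℂ] Y →ₗ[ℂ] ℂ) :
    Module.finrank ℂ (LinearMap.range F) = Module.finrank ℂ (LinearMap.range F.flip) := by
  have h1 := LinearMap.finrank_range_dualMap_eq_finrank_range (f := (F : X →ₗ[ℂ] Module.Dual ℂ Y))
  have h2 : F.flip = (F : X →ₗ[ℂ] Module.Dual ℂ Y).dualMap ∘ₗ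
      (Module.evalEquiv ℂ Y).toLinearMap := by
    ext y x; simp
  rw [h2, LinearMap.range_comp_of_range_eq_top _ (LinearEquiv.range _)]
  exact h1.symm

lemma finrank_range_of_ker {X Y Z : Type*} [AddCommGroup X] [Module ℂ X] [AddCommGroup Y]
    [Module ℂ Y] [AddCommGroup Z] [Module ℂ Z] [FiniteDimensional ℂ X]
    (f : X →ₗ[ℂ] Y) (g : X →ₗ[ℂ] Z) (h : LinearMap.ker f = LinearMap.ker g) :
    Module.finrank ℂ (LinearMap.range f) = Module.finrank ℂ (LinearMap.range g) := by
  have h1 := LinearMap.finrank_range_add_finrank_ker f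
  have h2 := LinearMap.finrank_range_add_finrank_ker g
  rw [h] at h1
  omega

lemma rank_adj {E : Type*} [AddCommGroup E] [Module ℂ E] (d : E →ₗ[ℂ] E) (B : E →ₗ[ℂ] E →ₗ[ℂ] ℂ)
    (X Y : Submodule ℂ E) [FiniteDimensional ℂ X] [FiniteDimensional ℂ Y]
    (h : ∀ x y, B (d x) y = B x (d y))
    (hY : ∀ x ∈ X, (∀ y ∈ Y, B (d x) y = 0) → d x = 0)
    (hX : ∀ y ∈ Y, (∀ x ∈ X, B x (d y) = 0) → d y = 0) :
    Module.finrank ℂ (X.map d) = Module.finrank ℂ (Y.map d) := by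
  let F : X →ₗ[ℂ] Y →ₗ[ℂ] ℂ := (B ∘ₗ d).domRestrict₁₂ X Y
  have hF : ∀ x y, F x y = B (d x) y := fun x y => rfl
  have e1 : Module.finrank ℂ (X.map d) = Module.finrank ℂ (LinearMap.range F) := by
    rw [← LinearMap.range_domRestrict]
    apply finrank_range_of_ker
    ext x
    simp only [LinearMap.mem_ker, LinearMap.domRestrict_apply]
    constructor
    · intro hx; ext y; rw [hF, hx]; simp
    · intro hx
      apply hY x x.2
      intro y hy
      have := LinearMap.congr_fun hx ⟨y, hy⟩
      rwa [hF] at this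
  have e2 : Module.finrank ℂ (Y.map d) = Module.finrank ℂ (LinearMap.range F.flip) := by
    rw [← LinearMap.range_domRestrict]
    apply finrank_range_of_ker
    ext y
    simp only [LinearMap.mem_ker, LinearMap.domRestrict_apply]
    constructor
    · intro hy; ext x; rw [LinearMap.flip_apply, hF, h, hy]; simp
    · intro hy
      apply hX y y.2
      intro x hx
      have := LinearMap.congr_fun hy ⟨x, hx⟩
      rw [LinearMap.flip_apply, hF, h] at this
      exact this
  rw [e1, e2, finrank_range_flip]

/-- Sign for the star operator. -/
noncomputable def sgT (T J : Finset ι) : ℂ := ∏ j ∈ J, eps j T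

lemma sgT_ne_zero (T J : Finset ι) : sgT T J ≠ 0 :=
  Finset.prod_ne_zero_iff.2 fun j _ => eps_ne_zero j T

lemma eps_split (T J : Finset ι) (i : ι) (hJ : J ⊆ T) :
    eps i J * eps i (T \ insert i J) = eps i T := by
  unfold eps
  rw [← pow_add, ← Finset.card_union_of_disjoint]
  · congr 2
    ext k
    simp only [Finset.mem_union, Finset.mem_filter, Finset.mem_sdiff, Finset.mem_insert, not_or]
    constructor
    · rintro (⟨h1, h2⟩ | ⟨⟨h1, h3⟩, h2⟩)
      · exact ⟨hJ h1, h2⟩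
      · exact ⟨h1, h2⟩
    · rintro ⟨h1, h2⟩
      by_cases hk : k ∈ J
      · exact Or.inl ⟨hk, h2⟩
      · exact Or.inr ⟨⟨h1, ne_of_lt h2, hk⟩, h2⟩
  · rw [Finset.disjoint_left]
    intro k hk hk'
    simp only [Finset.mem_filter, Finset.mem_sdiff, Finset.mem_insert, not_or] at hk hk'
    exact hk'.1.2.2 hk.1

/-- The duality pairing. -/
noncomputable def pairT (T : Finset ι) (κ : A →ₗ[ℂ] A →ₗ[ℂ] ℂ) :
    (Finset ι → A) →ₗ[ℂ] (Finset ι → A) →ₗ[ℂ] ℂ :=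
  ∑ J ∈ T.powerset, sgT T J • κ.compl₁₂ (LinearMap.proj J) (LinearMap.proj (T \ J))

lemma pairT_apply (T : Finset ι) (κ : A →ₗ[ℂ] A →ₗ[ℂ] ℂ) (α β : Finset ι → A) :
    pairT T κ α β = ∑ J ∈ T.powerset, sgT T J * κ (α J) (β (T \ J)) := by
  simp [pairT, LinearMap.sum_apply]

lemma pairT_adj (T : Finset ι) (κ : A →ₗ[ℂ] A →ₗ[ℂ] ℂ) (μ : ι → A →ₗ[ℂ] A)
    (hκ : ∀ i a b, κ (μ i a) b = κ a (μ i b)) (α β : Finset ι → A) :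
    pairT T κ (kd T μ α) β = pairT T κ α (kd T μ β) := by
  rw [pairT_apply, pairT_apply]
  simp only [kd_apply, map_sum, map_smul, LinearMap.sum_apply, LinearMap.smul_apply,
    Finset.mul_sum, smul_eq_mul]
  rw [Finset.sum_sigma', Finset.sum_sigma']
  refine Finset.sum_bij' (fun x _ => ⟨insert x.2 x.1, x.2⟩) (fun x _ => ⟨x.1.erase x.2, x.2⟩)
    ?_ ?_ ?_ ?_ ?_
  · rintro ⟨J, i⟩ h
    simp only [Finset.mem_sigma, Finset.mem_powerset, Finset.mem_sdiff] at h ⊢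
    exact ⟨Finset.insert_subset h.2.1 h.1, h.2.1, fun h' => h'.2 (Finset.mem_insert_self _ _)⟩
  · rintro ⟨J, i⟩ h
    simp only [Finset.mem_sigma, Finset.mem_powerset, Finset.mem_sdiff] at h ⊢
    exact ⟨(Finset.erase_subset _ _).trans h.1, h.2.1, Finset.notMem_erase _ _⟩
  · rintro ⟨J, i⟩ h
    simp only [Finset.mem_sigma, Finset.mem_powerset, Finset.mem_sdiff] at h
    simp only [Finset.erase_insert h.2.2]
  · rintro ⟨J, i⟩ h
    simp only [Finset.mem_sigma, Finset.mem_powerset, Finset.mem_sdiff] at h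
    have : i ∈ J := by by_contra h'; exact h.2.2 ⟨h.2.1, h'⟩
    simp only [Finset.insert_erase this]
  · rintro ⟨J, i⟩ h
    simp only [Finset.mem_sigma, Finset.mem_powerset, Finset.mem_sdiff] at h
    obtain ⟨hJ, hi, hiJ⟩ := h
    simp only
    have e1 : insert i (T \ insert i J) = T \ J := by
      ext k
      simp only [Finset.mem_insert, Finset.mem_sdiff, not_or]
      constructor
      · rintro (rfl | h)
        · exact ⟨hi, hiJ⟩
        · exact ⟨h.1, h.2.2⟩
      · rintro ⟨h1, h2⟩
        by_cases hk : k = i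
        · exact Or.inl hk
        · exact Or.inr ⟨h1, hk, h2⟩
    have e2 : sgT T (insert i J) = eps i T * sgT T J := by
      unfold sgT; rw [Finset.prod_insert hiJ]
    rw [e1, e2, hκ, ← eps_split T J i hJ]
    have := eps_mul_self i (T \ insert i J)
    linear_combination (- sgT T J * eps i J * κ (α (insert i J)) (μ i (β (T \ J)))) * this

lemma pairT_nondeg_left (T : Finset ι) (κ : A →ₗ[ℂ] A →ₗ[ℂ] ℂ) (W V : Submodule ℂ A)
    (hWV : ∀ a ∈ W, (∀ b ∈ V, κ a b = 0) → a = 0) (p q : ℤ) (hpq : p + q = T.card)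
    (α : Finset ι → A) (hα : α ∈ CC T p W) (h : ∀ β ∈ CC T q V, pairT T κ α β = 0) : α = 0 := by
  classical
  funext J
  by_cases hJ : J ⊆ T ∧ (J.card : ℤ) = p
  · apply hWV _ (hα J).1
    intro b hb
    have hc : ((T \ J).card : ℤ) = q := by
      rw [Finset.card_sdiff_of_subset hJ.1, Nat.cast_sub (Finset.card_le_card hJ.1)]
      omega
    have := h _ (single_mem_CC (J := T \ J) Finset.sdiff_subset hc hb)
    rw [pairT_apply, Finset.sum_eq_single J] at this
    · simpa [sgT_ne_zero] using this
    · intro I hI hIJ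
      rw [Pi.single_eq_of_ne, map_zero, mul_zero]
      intro h'
      apply hIJ
      rw [Finset.mem_powerset] at hI
      rw [← Finset.sdiff_sdiff_eq_self hI, h', Finset.sdiff_sdiff_eq_self hJ.1]
    · intro h'
      exact absurd (Finset.mem_powerset.2 hJ.1) h'
  · exact (hα J).2 hJ

lemma pairT_nondeg_right (T : Finset ι) (κ : A →ₗ[ℂ] A →ₗ[ℂ] ℂ) (W V : Submodule ℂ A)
    (hWV : ∀ a ∈ W, (∀ b ∈ V, κ b a = 0) → a = 0) (p q : ℤ) (hpq : p + q = T.card)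
    (α : Finset ι → A) (hα : α ∈ CC T p W) (h : ∀ β ∈ CC T q V, pairT T κ β α = 0) : α = 0 := by
  classical
  funext J
  by_cases hJ : J ⊆ T ∧ (J.card : ℤ) = p
  · apply hWV _ (hα J).1
    intro b hb
    have hc : ((T \ J).card : ℤ) = q := by
      rw [Finset.card_sdiff_of_subset hJ.1, Nat.cast_sub (Finset.card_le_card hJ.1)]
      omega
    have := h _ (single_mem_CC (J := T \ J) Finset.sdiff_subset hc hb)
    rw [pairT_apply, Finset.sum_eq_single (T \ J)] at this
    · simpa [sgT_ne_zero, Finset.sdiff_sdiff_eq_self hJ.1] using this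
    · intro I hI hIJ
      rw [Pi.single_eq_of_ne hIJ, map_zero, LinearMap.zero_apply, mul_zero]
    · intro h'
      exact absurd (Finset.mem_powerset.2 Finset.sdiff_subset) h'
  · exact (hα J).2 hJ

/-- Duality of ranks. -/
lemma rank_dual (T : Finset ι) (κ : A →ₗ[ℂ] A →ₗ[ℂ] ℂ) (μ : ι → A →ₗ[ℂ] A)
    (hκ : ∀ i a b, κ (μ i a) b = κ a (μ i b)) (hsym : ∀ a b, κ a b = κ b a)
    (W1 W2 W3 : Submodule ℂ A) [FiniteDimensional ℂ W1] [FiniteDimensional ℂ W2]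
    (h12 : ∀ i, ∀ w ∈ W1, μ i w ∈ W2) (h23 : ∀ i, ∀ w ∈ W2, μ i w ∈ W3)
    (hnd2 : ∀ a ∈ W2, (∀ b ∈ W2, κ a b = 0) → a = 0)
    (hnd3 : ∀ a ∈ W3, (∀ b ∈ W1, κ a b = 0) → a = 0)
    (p q : ℕ) (hpq : p + q = T.card + 1) :
    Module.finrank ℂ (BB T μ p W2) = Module.finrank ℂ (BB T μ q W1) := by
  refine rank_adj (kd T μ) (pairT T κ) (CC T (p : ℤ) W2) (CC T (q : ℤ) W1)
    (pairT_adj T κ μ hκ) ?_ ?_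
  · intro x hx h
    exact pairT_nondeg_left T κ W3 W1 hnd3 (p - 1) q (by omega) _ (kd_mem h23 hx) h
  · intro y hy h
    exact pairT_nondeg_right T κ W2 W2 (fun a ha hb => hnd2 a ha fun b hb' => by
      rw [hsym]; exact hb b hb') (q - 1) p (by omega) _ (kd_mem h12 hy) h

end model2

end Kz



namespace Kz

open MvPolynomial

/-- Exponent vectors. -/
abbrev Ex : Type := Fin 3 →₀ ℕ

/-- Polynomials supported on `s`. -/
def PS (s : Set Ex) : Submodule ℂ (PolyC 3) where
  carrier := {f | ∀ σ, σ ∉ s → coeff σ f = 0}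
  add_mem' := by intro a b ha hb σ h; rw [coeff_add, ha σ h, hb σ h, add_zero]
  zero_mem' := by intro σ _; simp
  smul_mem' := by intro c a ha σ h; rw [coeff_smul, ha σ h, smul_zero]

lemma mem_PS {s : Set Ex} {f : PolyC 3} : f ∈ PS s ↔ ∀ σ, σ ∉ s → coeff σ f = 0 := Iff.rfl

lemma monomial_mem_PS {s : Set Ex} {σ : Ex} (h : σ ∈ s) (c : ℂ) : monomial σ c ∈ PS s := by
  classical
  intro τ hτ
  rw [coeff_monomial, if_neg]
  rintro rfl; exact hτ h

/-- Polynomials supported on a finite set as functions. -/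
noncomputable def psEquiv (s : Finset Ex) : PS (s : Set Ex) ≃ₗ[ℂ] (s → ℂ) where
  toFun f := fun σ => coeff σ.1 f.1
  map_add' a b := by ext; simp
  map_smul' a b := by ext; simp
  invFun g := ⟨∑ σ : s, monomial σ.1 (g σ),
    Submodule.sum_mem _ fun σ _ => monomial_mem_PS σ.2 _⟩
  left_inv f := by
    classical
    ext τ
    simp only [coeff_sum, coeff_monomial]
    by_cases h : τ ∈ s
    · rw [Finset.sum_eq_single (⟨τ, h⟩ : s)]
      · simp
      · intro b _ hb
        rw [if_neg]
        rintro rfl; exact hb rfl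
      · simp
    · rw [f.2 τ h]
      apply Finset.sum_eq_zero
      intro b _
      rw [if_neg]
      rintro rfl; exact h b.2
  right_inv g := by
    classical
    ext τ
    simp only [coeff_sum, coeff_monomial]
    rw [Finset.sum_eq_single τ]
    · simp
    · intro b _ hb
      rw [if_neg]
      intro h; exact hb (Subtype.ext h)
    · simp

lemma finrank_PS {s : Set Ex} (t : Finset Ex) (h : s = (t : Set Ex)) :
    Module.finrank ℂ (PS s) = t.card := by
  subst h
  rw [(psEquiv t).finrank_eq]; simp

lemma finite_PS {s : Set Ex} (t : Finset Ex) (h : s = (t : Set Ex)) :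
    FiniteDimensional ℂ (PS s) := by
  subst h
  exact Module.Finite.equiv (psEquiv t).symm

/-- Truncation to the exponents in `s`. -/
noncomputable def tr (s : Set Ex) : PolyC 3 →ₗ[ℂ] PolyC 3 := by
  classical
  exact (basisMonomials (Fin 3) ℂ).constr ℂ fun σ => if σ ∈ s then monomial σ 1 else 0

open Classical in
lemma coeff_tr (s : Set Ex) (τ : Ex) (f : PolyC 3) :
    coeff τ (tr s f) = if τ ∈ s then coeff τ f else 0 := by
  induction f using MvPolynomial.induction_on' with
  | monomial σ a =>
    have : (monomial σ a : PolyC 3) = a • (basisMonomials (Fin 3) ℂ) σ := by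
      rw [coe_basisMonomials, smul_monomial]; simp
    rw [this, map_smul, tr, Module.Basis.constr_basis]
    simp only [coe_basisMonomials, coeff_smul]
    split_ifs with h1 h2 h2
    · rfl
    · rw [coeff_monomial, if_neg]; · simp
      rintro rfl; exact h2 h1
    · rw [coeff_zero]
      rw [coeff_monomial, if_neg]
      rintro rfl; exact h1 h2
    · simp
  | add p q h1 h2 =>
    rw [map_add, coeff_add, h1, h2, coeff_add]
    split_ifs <;> simp

/-- Exponent bound at level `k`. -/
def okS (k : ℕ) : Set Ex := {σ | ∀ i : Fin 3, (i : ℕ) < k → σ i < 5}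

lemma okS_down {k : ℕ} {σ τ : Ex} (h : σ ≤ τ) (hτ : τ ∈ okS k) : σ ∈ okS k :=
  fun i hi => lt_of_le_of_lt (h i) (hτ i hi)

lemma tr_mul_tr (k : ℕ) (ρ : Ex) (f : PolyC 3) :
    tr (okS k) (monomial ρ 1 * tr (okS k) f) = tr (okS k) (monomial ρ 1 * f) := by
  classical
  ext σ
  rw [coeff_tr, coeff_tr, coeff_monomial_mul', coeff_monomial_mul', coeff_tr]
  split_ifs with h1 h2 h3
  · rfl
  · exact absurd (okS_down tsub_le_self h1) h3
  · rfl
  · rfl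

lemma tr_tr_succ (k : ℕ) (f : PolyC 3) :
    tr (okS (k + 1)) (tr (okS k) f) = tr (okS (k + 1)) f := by
  classical
  ext σ
  rw [coeff_tr, coeff_tr, coeff_tr]
  split_ifs with h1 h2
  · rfl
  · exact absurd (fun i hi => h1 i (by omega)) h2
  · rfl

/-- Degree pieces at level `k`. -/
def WW (k : ℕ) (q : ℤ) : Submodule ℂ (PolyC 3) :=
  PS {σ | (σ.degree : ℤ) = 1 + q * 5 ∧ σ ∈ okS k}

lemma mem_WW {k : ℕ} {q : ℤ} {f : PolyC 3} :
    f ∈ WW k q ↔ ∀ σ : Ex, ¬ ((σ.degree : ℤ) = 1 + q * 5 ∧ σ ∈ okS k) → coeff σ f = 0 := Iff.rfl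

/-- Multiplication at level `k` by the monomials `x^(ex i)`. -/
noncomputable def mu (ex : Fin 21 → Ex) (k : ℕ) (i : Fin 21) : PolyC 3 →ₗ[ℂ] PolyC 3 :=
  tr (okS k) ∘ₗ LinearMap.mulLeft ℂ (monomial (ex i) 1)

lemma mu_apply (ex : Fin 21 → Ex) (k : ℕ) (i : Fin 21) (f : PolyC 3) :
    mu ex k i f = tr (okS k) (monomial (ex i) 1 * f) := rfl

open Classical in
lemma coeff_mu (ex : Fin 21 → Ex) (k : ℕ) (i : Fin 21) (f : PolyC 3) (σ : Ex) :
    coeff σ (mu ex k i f) = if σ ∈ okS k ∧ ex i ≤ σ then coeff (σ - ex i) f else 0 := by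
  rw [mu_apply, coeff_tr, coeff_monomial_mul', one_mul, ite_and]

lemma mu_comm (ex : Fin 21 → Ex) (k : ℕ) (i j : Fin 21) (a : PolyC 3) :
    mu ex k i (mu ex k j a) = mu ex k j (mu ex k i a) := by
  simp only [mu_apply]
  rw [tr_mul_tr, tr_mul_tr, mul_left_comm]

lemma degree_sub_of_le {σ τ : Ex} (h : σ ≤ τ) : (τ - σ).degree + σ.degree = τ.degree := by
  rw [← map_add, tsub_add_cancel_of_le h]

lemma mu_mem (ex : Fin 21 → Ex) (hex : ∀ i, (ex i).degree = 5) (k : ℕ) (q : ℤ) (i : Fin 21)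
    (w : PolyC 3) (hw : w ∈ WW k q) : mu ex k i w ∈ WW k (q + 1) := by
  classical
  intro σ hσ
  rw [coeff_mu]
  split_ifs with h
  · apply hw
    rintro ⟨h1, h2⟩
    apply hσ
    refine ⟨?_, h.1⟩
    have := degree_sub_of_le h.2
    rw [hex] at this
    omega
  · rfl

lemma redHyp (ex : Fin 21 → Ex) (hex : ∀ i, (ex i).degree = 5) (k : Fin 3) (ℓ : Fin 21)
    (hℓ : ex ℓ = Finsupp.single k 5) (T' : Finset (Fin 21)) (hT : ℓ ∉ T') :
    RedHyp T' ℓ (mu ex k) (mu ex (k + 1)) (tr (okS (k + 1))) (WW k) (WW (k + 1)) where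
  hℓ := hT
  hμ := mu_comm ex k
  hW := fun q i w hw => mu_mem ex hex k q i w hw
  hW' := by
    classical
    intro q
    apply le_antisymm
    · intro f hf
      refine ⟨f, ?_, ?_⟩
      · intro σ hσ
        apply hf
        rintro ⟨h1, h2⟩
        exact hσ ⟨h1, fun i hi => h2 i (by omega)⟩
      · ext σ
        rw [coeff_tr]
        split_ifs with h
        · rfl
        · symm; exact hf σ (fun h' => h h'.2)
    · rintro _ ⟨f, hf, rfl⟩ σ hσ
      rw [coeff_tr]
      split_ifs with h
      · apply hf
        rintro ⟨h1, _⟩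
        exact hσ ⟨h1, h⟩
      · rfl
  hinj := by
    classical
    intro q w hw h0
    ext σ
    rw [coeff_zero]
    by_cases h : σ ∈ okS k
    · have := congrArg (coeff (σ + ex ℓ)) h0
      rw [coeff_mu, if_pos, add_tsub_cancel_right, coeff_zero] at this
      · exact this
      · refine ⟨fun i hi => ?_, le_add_self⟩
        have hne : k ≠ i := by rintro rfl; omega
        rw [Finsupp.add_apply, hℓ, Finsupp.single_eq_of_ne (Ne.symm hne), add_zero]
        exact h i hi
    · exact hw σ fun h' => h h'.2
  hker := by
    classical
    intro q w hw h0
    refine ⟨w.divMonomial (ex ℓ), ?_, ?_⟩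
    · intro σ hσ
      rw [coeff_divMonomial]
      apply hw
      rintro ⟨h1, h2⟩
      apply hσ
      refine ⟨?_, okS_down le_add_self h2⟩
      rw [map_add, hex] at h1
      push_cast at h1
      omega
    · ext σ
      rw [coeff_mu]
      split_ifs with h
      · rw [coeff_divMonomial, add_tsub_cancel_of_le h.2]
      · symm
        by_cases h1 : σ ∈ okS k
        · have h2 : ¬ ex ℓ ≤ σ := fun h2 => h ⟨h1, h2⟩
          rw [hℓ, Finsupp.single_le_iff, not_le] at h2
          have := congrArg (coeff σ) h0
          rw [coeff_tr, if_pos, coeff_zero] at this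
          · exact this
          · intro i hi
            by_cases hik : i = k
            · rw [hik]; exact h2
            · apply h1
              have : (i : ℕ) ≠ k := fun h => hik (Fin.ext h)
              omega
        · exact hw σ fun h' => h1 h'.2
  hπℓ := by
    classical
    intro w
    ext σ
    rw [coeff_tr, coeff_mu, coeff_zero]
    split_ifs with h1 h2
    · exfalso
      have := h2.2
      rw [hℓ, Finsupp.single_le_iff] at this
      have := h1 k (by omega)
      omega
    · rfl
    · rfl
  hcomm := by
    intro i w
    simp only [mu_apply]
    rw [tr_mul_tr, tr_tr_succ]

/-- The set of exponents as a finset. -/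
noncomputable def fset (n k : ℕ) : Finset Ex :=
  ((Finset.Nat.antidiagonalTuple 3 n).filter (fun f => ∀ i : Fin 3, (i : ℕ) < k → f i < 5)).map
    Finsupp.equivFunOnFinite.symm.toEmbedding

lemma mem_fset {n k : ℕ} {σ : Ex} : σ ∈ fset n k ↔ σ.degree = n ∧ σ ∈ okS k := by
  unfold fset
  rw [Finset.mem_map_equiv, Finset.mem_filter, Finset.Nat.mem_antidiagonalTuple,
    Finsupp.degree_eq_sum]
  rfl

lemma WW_set (k n : ℕ) (q : ℤ) (h : 1 + q * 5 = n) :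
    {σ : Ex | (σ.degree : ℤ) = 1 + q * 5 ∧ σ ∈ okS k} = (fset n k : Set Ex) := by
  ext σ
  rw [Set.mem_ofPred_eq, Finset.mem_coe, mem_fset, h, Nat.cast_inj]

lemma WW_neg (k : ℕ) (q : ℤ) (h : q < 0) : WW k q = ⊥ := by
  rw [eq_bot_iff]
  intro f hf
  rw [Submodule.mem_bot]
  ext σ
  rw [coeff_zero]
  apply hf
  rintro ⟨h1, _⟩
  omega

instance WW_finite (k : ℕ) (q : ℤ) : FiniteDimensional ℂ (WW k q) := by
  by_cases h : q < 0
  · rw [WW_neg k q h]; infer_instance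
  · exact finite_PS (fset (1 + q * 5).toNat k) (WW_set k _ q (by omega))

lemma WW_big (q : ℤ) (h : 3 ≤ q) : WW 3 q = ⊥ := by
  rw [eq_bot_iff]
  intro f hf
  rw [Submodule.mem_bot]
  ext σ
  rw [coeff_zero]
  apply hf
  rintro ⟨h1, h2⟩
  rw [Finsupp.degree_eq_sum, Fin.sum_univ_three] at h1
  have h3 := h2 0 (by decide)
  have h4 := h2 1 (by decide)
  have h5 := h2 2 (by decide)
  push_cast at h1
  omega

lemma finrank_WW0 : Module.finrank ℂ (WW 3 0) = 3 := by
  unfold WW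
  rw [finrank_PS (fset 1 3) (WW_set 3 1 0 (by norm_num)), fset, Finset.card_map]
  decide +kernel

lemma finrank_WW1 : Module.finrank ℂ (WW 3 1) = 19 := by
  unfold WW
  rw [finrank_PS (fset 6 3) (WW_set 3 6 1 (by norm_num)), fset, Finset.card_map]
  decide +kernel

lemma finrank_WW2 : Module.finrank ℂ (WW 3 2) = 3 := by
  unfold WW
  rw [finrank_PS (fset 11 3) (WW_set 3 11 2 (by norm_num)), fset, Finset.card_map]
  decide +kernel

lemma card_fset5 : (fset 5 0).card = 21 := by
  rw [fset, Finset.card_map]; decide +kernel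

lemma weight_one_eq (σ : Ex) : Finsupp.weight 1 σ = σ.degree := by
  rw [Finsupp.degree_eq_weight_one (R := ℕ)]
  rfl

lemma Sdeg_eq (e : ℤ) : Sdeg 3 e = PS {σ | (σ.degree : ℤ) = e} := by
  ext f
  rw [mem_PS, Sdeg]
  split_ifs with h
  · rw [mem_homogeneousSubmodule]
    constructor
    · intro hf σ hσ
      by_contra h'
      have h2 : Finsupp.degree σ = e.toNat := by
        have := hf h'
        rwa [weight_one_eq] at this
      apply hσ
      change ((Finsupp.degree σ : ℕ) : ℤ) = e
      omega
    · intro hf σ hσ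
      by_contra h'
      apply hσ
      apply hf
      intro h2
      apply h'
      rw [weight_one_eq]
      have h3 : ((Finsupp.degree σ : ℕ) : ℤ) = e := h2
      change Finsupp.degree σ = _
      omega
  · rw [Submodule.mem_bot]
    constructor
    · rintro rfl; simp
    · intro hf
      ext σ
      rw [coeff_zero]
      apply hf
      intro h2
      have h3 : ((Finsupp.degree σ : ℕ) : ℤ) = e := h2
      omega

lemma Sdeg_eq_WW (q : ℤ) : Sdeg 3 (1 + q * 5) = WW 0 q := by
  rw [Sdeg_eq, WW]
  congr 1
  ext σ
  simp [okS]

end Kz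



namespace Kz

section bridge
open Set.powersetCard

/-- Transport of `⋀^p V ⊗ A` to functions on finite subsets. -/
noncomputable def GG {ι : Type} [LinearOrder ι] {V A : Type} [AddCommGroup V] [Module ℂ V]
    [AddCommGroup A] [Module ℂ A] (b : Module.Basis ι ℂ V) (p : ℕ) :
    ((↥(⋀[ℂ]^p V)) ⊗[ℂ] A) →ₗ[ℂ] (Finset ι → A) :=
  LinearMap.pi fun J => if h : J.card = p then
    (TensorProduct.lid ℂ A).toLinearMap ∘ₗ
      LinearMap.rTensor A ((b.exteriorPower p).coord ⟨J, h⟩) else 0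

variable {ι : Type} [LinearOrder ι] {V A : Type} [AddCommGroup V] [Module ℂ V]
    [AddCommGroup A] [Module ℂ A]

lemma GG_tmul (b : Module.Basis ι ℂ V) (p : ℕ) (w : ↥(⋀[ℂ]^p V)) (f : A) (J : Finset ι)
    (h : J.card = p) : GG b p (w ⊗ₜ f) J = (b.exteriorPower p).repr w ⟨J, h⟩ • f := by
  simp [GG, h]

lemma GG_tmul_ne (b : Module.Basis ι ℂ V) (p : ℕ) (x : (↥(⋀[ℂ]^p V)) ⊗[ℂ] A) (J : Finset ι)
    (h : J.card ≠ p) : GG b p x J = 0 := by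
  simp [GG, h]

lemma GG_basis (b : Module.Basis ι ℂ V) (p : ℕ) (s : Set.powersetCard ι p) (f : A) :
    GG b p ((b.exteriorPower p s) ⊗ₜ f) = Pi.single s.1 f := by
  classical
  funext J
  by_cases h : J.card = p
  · rw [GG_tmul b p _ f J h, Module.Basis.repr_self]
    by_cases hJ : s.1 = J
    · subst hJ
      have : (⟨s.1, h⟩ : Set.powersetCard ι p) = s := rfl
      rw [this]; simp
    · rw [Pi.single_eq_of_ne (Ne.symm hJ), Finsupp.single_eq_of_ne, zero_smul]
      intro h'; exact hJ (congrArg Subtype.val h').symm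
  · rw [GG_tmul_ne b p _ J h, Pi.single_eq_of_ne]
    rintro rfl; exact h s.2

lemma GG_emb (b : Module.Basis ι ℂ V) (p : ℕ) (g : Fin p ↪o ι) (f : A) :
    GG b p ((wedgeE ℂ V p (fun i => b (g i))) ⊗ₜ f) =
      Pi.single (Finset.univ.map g.toEmbedding) f := by
  have h1 : wedgeE ℂ V p (fun i => b (g i)) = b.exteriorPower p (ofFinEmbEquiv g) := by
    rw [exteriorPower.basis_apply, exteriorPower.ιMulti_family, Equiv.symm_apply_apply]
    rfl
  rw [h1, GG_basis, ofFinEmbEquiv_apply, val_ofFinEmb]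

variable [Fintype ι]

lemma GG_inj (b : Module.Basis ι ℂ V) (p : ℕ) : Function.Injective (GG (A := A) b p) := by
  classical
  haveI : Fintype (Set.powersetCard ι p) := Fintype.ofFinite _
  have key : (∑ s : Set.powersetCard ι p,
      (TensorProduct.mk ℂ (↥(⋀[ℂ]^p V)) A (b.exteriorPower p s)) ∘ₗ LinearMap.proj s.1) ∘ₗ
        GG b p = LinearMap.id := by
    apply TensorProduct.ext'
    intro w f
    simp only [LinearMap.comp_apply, LinearMap.sum_apply, LinearMap.proj_apply,
      TensorProduct.mk_apply, LinearMap.id_apply]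
    conv_rhs => rw [← (b.exteriorPower p).sum_repr w, TensorProduct.sum_tmul]
    refine Finset.sum_congr rfl fun s _ => ?_
    rw [GG_tmul b p w f s.1 s.2, TensorProduct.tmul_smul, TensorProduct.smul_tmul']
  intro x y h
  have h2 := congrArg (fun φ => φ x) key
  have h3 := congrArg (fun φ => φ y) key
  simp only [LinearMap.comp_apply, LinearMap.id_apply] at h2 h3
  rw [← h2, ← h3, h]

lemma kd_single (μ : ι → A →ₗ[ℂ] A) (s : Finset ι) (f : A) :
    kd Finset.univ μ (Pi.single s f) =
      ∑ i ∈ s, eps i s • Pi.single (s.erase i) (μ i f) := by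
  classical
  funext J
  rw [kd_apply, Finset.sum_apply]
  by_cases hJ : ∃ i ∈ s, s.erase i = J
  · obtain ⟨i, hi, rfl⟩ := hJ
    rw [Finset.sum_eq_single i, Finset.sum_eq_single i]
    · rw [Finset.insert_erase hi]
      simp only [Pi.single_eq_same, Pi.smul_apply]
      congr 1
      unfold eps
      congr 2
      ext j
      simp only [Finset.mem_filter, Finset.mem_erase]
      constructor
      · rintro ⟨⟨_, h⟩, h'⟩; exact ⟨h, h'⟩
      · rintro ⟨h, h'⟩; exact ⟨⟨h'.ne, h⟩, h'⟩
    · intro j hj hji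
      rw [Pi.smul_apply, Pi.single_eq_of_ne, smul_zero]
      intro h
      have : j ∈ s.erase i := Finset.mem_erase.2 ⟨hji, hj⟩
      rw [h] at this
      simp at this
    · intro h; exact absurd hi h
    · intro j hj hji
      rw [Pi.single_eq_of_ne, map_zero, smul_zero]
      intro h
      have h1 : j ∈ s := by rw [← h]; exact Finset.mem_insert_self _ _
      simp only [Finset.mem_sdiff, Finset.mem_univ, true_and] at hj
      exact hj (Finset.mem_erase.2 ⟨hji, h1⟩)
    · intro h
      simp at h
  · rw [Finset.sum_eq_zero, Finset.sum_eq_zero]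
    · intro i hi
      rw [Pi.smul_apply, Pi.single_eq_of_ne, smul_zero]
      intro h; exact hJ ⟨i, hi, h.symm⟩
    · intro i hi
      rw [Pi.single_eq_of_ne, map_zero, smul_zero]
      intro h
      simp only [Finset.mem_sdiff, Finset.mem_univ, true_and] at hi
      refine hJ ⟨i, ?_, ?_⟩
      · rw [← h]; exact Finset.mem_insert_self _ _
      · rw [← h]; exact Finset.erase_insert hi

lemma eps_emb {p : ℕ} (g : Fin p ↪o ι) (k : Fin p) :
    eps (g k) (Finset.univ.map g.toEmbedding) = (-1) ^ (k : ℕ) := by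
  unfold eps
  congr 1
  have : (Finset.univ.map g.toEmbedding).filter (· < g k) =
      (Finset.Iio k).map g.toEmbedding := by
    ext j
    simp only [Finset.mem_filter, Finset.mem_map, Finset.mem_univ, true_and, Finset.mem_Iio]
    constructor
    · rintro ⟨⟨a, rfl⟩, h⟩
      exact ⟨a, by simpa using h, rfl⟩
    · rintro ⟨a, h, rfl⟩
      exact ⟨⟨a, rfl⟩, by simpa using h⟩
  rw [this, Finset.card_map, Fin.card_Iio]

end bridge

/-- Multiplication operators by the members of a family. -/
noncomputable def mulB (v : Fin 21 → PolyC 3) (i : Fin 21) : PolyC 3 →ₗ[ℂ] PolyC 3 :=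
  LinearMap.mulLeft ℂ (v i)

lemma mulB_comm (v : Fin 21 → PolyC 3) (i j : Fin 21) (a : PolyC 3) :
    mulB v i (mulB v j a) = mulB v j (mulB v i a) := by
  simp only [mulB, LinearMap.mulLeft_apply]; ring

/-- The embedding of the Koszul modules. -/
noncomputable def BM (b : Module.Basis (Fin 21) ℂ (Sdeg 3 5)) (p : ℕ) (e : ℤ) :
    KosModule 3 5 p e →ₗ[ℂ] (Finset (Fin 21) → PolyC 3) :=
  GG b p ∘ₗ TensorProduct.map LinearMap.id (Sdeg 3 e).subtype

lemma BM_inj (b : Module.Basis (Fin 21) ℂ (Sdeg 3 5)) (p : ℕ) (e : ℤ) :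
    Function.Injective (BM b p e) := by
  have h := Module.Flat.lTensor_preserves_injective_linearMap (M := ↥(⋀[ℂ]^p ↥(Sdeg 3 5)))
    (Sdeg 3 e).subtype (Submodule.subtype_injective _)
  exact (GG_inj b p).comp h

lemma BM_range (b : Module.Basis (Fin 21) ℂ (Sdeg 3 5)) (p : ℕ) (e : ℤ) :
    LinearMap.range (BM b p e) = CC Finset.univ p (Sdeg 3 e) := by
  classical
  apply le_antisymm
  · rintro _ ⟨x, rfl⟩
    induction x using TensorProduct.induction_on with
    | zero => rw [map_zero]; exact Submodule.zero_mem _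
    | add x y hx hy => rw [map_add]; exact Submodule.add_mem _ hx hy
    | tmul w f =>
      intro J
      have hB : BM b p e (w ⊗ₜ f) = GG b p (w ⊗ₜ (f : PolyC 3)) := rfl
      rw [hB]
      by_cases h : J.card = p
      · rw [GG_tmul b p _ _ J h]
        exact ⟨Submodule.smul_mem _ _ f.2, fun h' => absurd ⟨Finset.subset_univ _, by simp [h]⟩ h'⟩
      · rw [GG_tmul_ne b p _ J h]
        exact ⟨Submodule.zero_mem _, fun _ => rfl⟩
  · intro α hα
    haveI : Fintype (Set.powersetCard (Fin 21) p) := Fintype.ofFinite _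
    refine ⟨∑ s : Set.powersetCard (Fin 21) p,
      (b.exteriorPower p s) ⊗ₜ (⟨α s.1, (hα s.1).1⟩ : Sdeg 3 e), ?_⟩
    have hB : ∀ (w) (f : Sdeg 3 e), BM b p e (w ⊗ₜ f) = GG b p (w ⊗ₜ (f : PolyC 3)) :=
      fun _ _ => rfl
    simp only [map_sum, hB, GG_basis]
    funext J
    rw [Finset.sum_apply]
    by_cases h : J.card = p
    · rw [Finset.sum_eq_single ⟨J, h⟩]
      · simp
      · intro s _ hs
        rw [Pi.single_eq_of_ne]
        intro h'; exact hs (Subtype.ext h'.symm)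
      · intro h'; exact absurd (Finset.mem_univ _) h'
    · rw [Finset.sum_eq_zero, (hα J).2]
      · rintro ⟨_, h'⟩; exact h (by exact_mod_cast h')
      · intro s _
        rw [Pi.single_eq_of_ne]
        rintro rfl; exact h s.2

lemma BM_diff (b : Module.Basis (Fin 21) ℂ (Sdeg 3 5)) (p : ℕ) (e e' : ℤ)
    (D : KosModule 3 5 (p + 1) e →ₗ[ℂ] KosModule 3 5 p e') (hD : IsKoszulDiff 3 5 e e' p D)
    (x : KosModule 3 5 (p + 1) e) :
    BM b p e' (D x) = - kd Finset.univ (mulB fun i => (b i : PolyC 3)) (BM b (p + 1) e x) := by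
  classical
  suffices h : BM b p e' ∘ₗ D =
      - (kd Finset.univ (mulB fun i => (b i : PolyC 3)) ∘ₗ BM b (p + 1) e) by
    exact congrArg (fun φ => φ x) h
  apply TensorProduct.ext
  apply (b.exteriorPower (p + 1)).ext
  intro s
  ext1 f
  obtain ⟨g, rfl⟩ := (Set.powersetCard.ofFinEmbEquiv (n := p + 1) (I := Fin 21)).surjective s
  have h1 : (b.exteriorPower (p + 1)) (Set.powersetCard.ofFinEmbEquiv g) =
      wedgeE ℂ (Sdeg 3 5) (p + 1) (fun i => b (g i)) := by
    rw [exteriorPower.basis_apply, exteriorPower.ιMulti_family, Equiv.symm_apply_apply]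
    rfl
  rw [h1]
  have hL : BM b p e' (D (wedgeE ℂ (Sdeg 3 5) (p + 1) (fun i => b (g i)) ⊗ₜ f)) =
      ∑ k : Fin (p + 1), ((-1 : ℂ) ^ ((k : ℕ) + 1)) •
        Pi.single ((Finset.univ.map g.toEmbedding).erase (g k)) ((b (g k) : PolyC 3) * f) := by
    unfold BM
    rw [LinearMap.comp_apply, hD, map_sum]
    refine Finset.sum_congr rfl fun k _ => ?_
    rw [map_smul]
    congr 1
    refine (GG_emb b p ((Fin.succAboveOrderEmb k).trans g) _).trans ?_
    congr 1
    ext j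
    simp only [Finset.mem_map, Finset.mem_univ, true_and, Finset.mem_erase]
    constructor
    · rintro ⟨a, rfl⟩
      refine ⟨?_, k.succAbove a, rfl⟩
      intro h
      exact Fin.succAbove_ne k a (g.injective h)
    · rintro ⟨h, a, rfl⟩
      have : a ≠ k := by rintro rfl; exact h rfl
      obtain ⟨c, rfl⟩ := Fin.exists_succAbove_eq this
      exact ⟨c, rfl⟩
  have hR : BM b (p + 1) e (wedgeE ℂ (Sdeg 3 5) (p + 1) (fun i => b (g i)) ⊗ₜ f) =
      Pi.single (Finset.univ.map g.toEmbedding) (f : PolyC 3) :=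
    GG_emb b (p + 1) g (f : PolyC 3)
  change BM b p e' (D (wedgeE ℂ (Sdeg 3 5) (p + 1) (fun i => b (g i)) ⊗ₜ f)) =
    - kd Finset.univ (mulB fun i => (b i : PolyC 3))
      (BM b (p + 1) e (wedgeE ℂ (Sdeg 3 5) (p + 1) (fun i => b (g i)) ⊗ₜ f))
  rw [hL, hR, kd_single, Finset.sum_map, ← Finset.sum_neg_distrib]
  refine Finset.sum_congr rfl fun k _ => ?_
  have := eps_emb g k
  rw [show g.toEmbedding k = g k from rfl, this, pow_succ, mul_neg, mul_one, neg_smul]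
  rfl

end Kz



namespace Kz

lemma finrank_map_inj {M N : Type} [AddCommMonoid M] [Module ℂ M] [AddCommMonoid N] [Module ℂ N]
    (f : M →ₗ[ℂ] N) (hf : Function.Injective f) (P : Submodule ℂ M) :
    Module.finrank ℂ (P.map f) = Module.finrank ℂ P :=
  (LinearEquiv.finrank_eq (Submodule.equivMapOfInjective f hf P)).symm

lemma Kdim_bridge_aux
    (D : ∀ (p : ℕ) (e e' : ℤ), KosModule 3 5 (p + 1) e →ₗ[ℂ] KosModule 3 5 p e')
    (hD : ∀ (p : ℕ) (e e' : ℤ), e' = e + 5 → IsKoszulDiff 3 5 e e' p (D p e e'))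
    (b : Module.Basis (Fin 21) ℂ (Sdeg 3 5)) (p : ℕ) (q : ℤ) :
    Kdim 3 5 D 1 p q =
      Module.finrank ℂ (ZZ Finset.univ (mulB fun i => (b i : PolyC 3)) (p : ℤ)
        (Sdeg 3 (1 + q * 5))) -
      Module.finrank ℂ (BB Finset.univ (mulB fun i => (b i : PolyC 3)) ((p : ℤ) + 1)
        (Sdeg 3 (1 + (q - 1) * 5))) := by
  have hrange : ∀ p : ℕ, ∀ q : ℤ, (LinearMap.range (D p (1 + (q - 1) * 5) (1 + q * 5))).map
      (BM b p (1 + q * 5)) = BB Finset.univ (mulB fun i => (b i : PolyC 3)) ((p : ℤ) + 1)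
        (Sdeg 3 (1 + (q - 1) * 5)) := by
    intro p q
    have hK := hD p (1 + (q - 1) * 5) (1 + q * 5) (by ring)
    unfold BB
    have h1 := BM_range b (p + 1) (1 + (q - 1) * 5)
    push_cast at h1
    rw [← h1, ← LinearMap.range_comp, ← LinearMap.range_comp]
    have : BM b p (1 + q * 5) ∘ₗ D p (1 + (q - 1) * 5) (1 + q * 5) =
      - (kd Finset.univ (mulB fun i => (b i : PolyC 3)) ∘ₗ BM b (p + 1) (1 + (q - 1) * 5)) := by
      exact LinearMap.ext fun y => BM_diff b p _ _ _ hK _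
    rw [this, LinearMap.range_neg]
  cases p with
  | zero =>
    unfold Kdim cdim
    change Module.finrank ℂ _ - Module.finrank ℂ _ = _
    congr 1
    · rw [← finrank_top, ← finrank_map_inj (BM b 0 (1 + q * 5)) (BM_inj b 0 _),
        Submodule.map_top, BM_range]
      unfold ZZ
      rw [inf_eq_left.2]
      intro α hα
      rw [LinearMap.mem_ker]
      funext J
      rw [kd_apply]
      refine Finset.sum_eq_zero fun i hi => ?_
      rw [(hα (insert i J)).2, map_zero, smul_zero]
      simp
    · rw [← hrange, finrank_map_inj _ (BM_inj b _ _)]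
  | succ p =>
    unfold Kdim cdim
    change Module.finrank ℂ _ - Module.finrank ℂ _ = _
    have hK := hD p (1 + q * 5) (1 + (q + 1) * 5) (by ring)
    have hker : (LinearMap.ker (D p (1 + q * 5) (1 + (q + 1) * 5))).map (BM b (p + 1) (1 + q * 5))
        = ZZ Finset.univ (mulB fun i => (b i : PolyC 3)) ((p + 1 : ℕ) : ℤ)
        (Sdeg 3 (1 + q * 5)) := by
      unfold ZZ
      rw [← BM_range b]
      ext α
      simp only [Submodule.mem_map, LinearMap.mem_ker, Submodule.mem_inf, LinearMap.mem_range]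
      constructor
      · rintro ⟨x, hx, rfl⟩
        refine ⟨⟨x, rfl⟩, ?_⟩
        have := BM_diff b p _ _ _ hK x
        rw [hx, map_zero] at this
        exact neg_eq_zero.1 this.symm
      · rintro ⟨⟨x, rfl⟩, hx⟩
        refine ⟨x, ?_, rfl⟩
        apply BM_inj b p
        rw [BM_diff b p _ _ _ hK x, hx, map_zero, neg_zero]
    have hle : LinearMap.range (D (p + 1) (1 + (q - 1) * 5) (1 + q * 5)) ≤
        LinearMap.ker (D p (1 + q * 5) (1 + (q + 1) * 5)) := by
      rintro _ ⟨x, rfl⟩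
      rw [LinearMap.mem_ker]
      apply BM_inj b p
      rw [BM_diff b p _ _ _ hK, BM_diff b (p + 1) _ _ _ (hD (p + 1) _ _ (by ring)), map_neg,
        kd_kd _ _ (mulB_comm _), map_zero, neg_zero, neg_zero]
    rw [inf_eq_left.2 hle]
    congr 1
    · rw [← hker, finrank_map_inj _ (BM_inj b _ _)]
    · rw [← hrange, finrank_map_inj _ (BM_inj b _ _)]

lemma Kdim_bridge (D : KFam 3 5) (hD : IsKoszulFam 3 5 D)
    (b : Module.Basis (Fin 21) ℂ (Sdeg 3 5)) (p : ℕ) (q : ℤ) :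
    Kdim 3 5 D 1 p q =
      Module.finrank ℂ (ZZ Finset.univ (mulB fun i => (b i : PolyC 3)) (p : ℤ)
        (Sdeg 3 (1 + q * 5))) -
      Module.finrank ℂ (BB Finset.univ (mulB fun i => (b i : PolyC 3)) ((p : ℤ) + 1)
        (Sdeg 3 (1 + (q - 1) * 5))) :=
  Kdim_bridge_aux D hD b p q

end Kz



namespace Kz

open MvPolynomial

/-- Enumeration of degree five exponents. -/
noncomputable def e5 : Fin 21 ≃ (fset 5 0) := (Finset.equivFinOfCardEq card_fset5).symm

/-- The `i`-th degree five exponent. -/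
noncomputable def ex (i : Fin 21) : Ex := (e5 i).1

lemma ex_inj : Function.Injective ex := fun _ _ h => e5.injective (Subtype.ext h)

lemma ex_deg (i : Fin 21) : (ex i).degree = 5 := (mem_fset.1 (e5 i).2).1

lemma ex_surj (σ : Ex) (h : σ.degree = 5) : ∃ i, ex i = σ := by
  obtain ⟨i, hi⟩ := e5.surjective ⟨σ, mem_fset.2 ⟨h, by simp [okS]⟩⟩
  exact ⟨i, by rw [ex, hi]⟩

lemma Sdeg5_eq : Sdeg 3 5 = PS (fset 5 0 : Set Ex) := by
  rw [Sdeg_eq]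
  congr 1
  ext σ
  rw [Set.mem_ofPred_eq, Finset.mem_coe, mem_fset]
  simp only [okS]
  constructor
  · intro h; exact ⟨by exact_mod_cast h, by simp⟩
  · intro h; exact_mod_cast h.1

/-- Coordinates on degree five polynomials. -/
noncomputable def s5 : Sdeg 3 5 ≃ₗ[ℂ] (Fin 21 → ℂ) :=
  (LinearEquiv.ofEq _ _ Sdeg5_eq).trans
    ((psEquiv (fset 5 0)).trans (LinearEquiv.funCongrLeft ℂ ℂ e5))

lemma s5_apply (f : Sdeg 3 5) (i : Fin 21) : s5 f i = coeff (ex i) (f : PolyC 3) := rfl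

/-- The monomial basis. -/
noncomputable def mb : Module.Basis (Fin 21) ℂ (Sdeg 3 5) := Module.Basis.ofEquivFun s5

lemma mb_apply (i : Fin 21) : (mb i : PolyC 3) = monomial (ex i) 1 := by
  classical
  have h : (monomial (ex i) 1 : PolyC 3) ∈ Sdeg 3 5 := by
    rw [Sdeg_eq]
    apply monomial_mem_PS
    rw [Set.mem_ofPred_eq, ex_deg]; rfl
  have : mb i = ⟨monomial (ex i) 1, h⟩ := by
    apply s5.injective
    rw [mb, Module.Basis.coe_ofEquivFun, LinearEquiv.apply_symm_apply]
    funext j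
    rw [s5_apply, coeff_monomial, Pi.single_apply]
    congr 1
    rw [eq_iff_iff]
    exact ⟨fun h => by rw [h], fun h => ex_inj h.symm⟩
  rw [this]

/-- Test points. -/
noncomputable def pt (j : ℕ) : Fin 3 → ℂ := ![1, 2 ^ j, 2 ^ (6 * j)]

/-- Weight of an exponent on the test curve. -/
def wt (σ : Ex) : ℕ := σ 1 + 6 * σ 2

lemma eval_monomial_pt (j : ℕ) (σ : Ex) :
    eval (pt j) (monomial σ (1 : ℂ)) = ((2 : ℂ) ^ wt σ) ^ j := by
  rw [eval_monomial, Finsupp.prod_fintype _ _ (by simp), Fin.prod_univ_three]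
  simp only [pt, wt, Matrix.cons_val_zero, Matrix.cons_val_one, Matrix.cons_val]
  rw [one_pow, one_mul, one_mul, ← pow_mul, ← pow_mul, ← pow_mul, ← pow_add]
  congr 1; ring

lemma degree3 (σ : Ex) : σ.degree = σ 0 + σ 1 + σ 2 := by
  rw [Finsupp.degree_eq_sum, Fin.sum_univ_three]

lemma wt_inj (i j : Fin 21) (h : wt (ex i) = wt (ex j)) : i = j := by
  apply ex_inj
  have h1 := ex_deg i
  have h2 := ex_deg j
  rw [degree3] at h1 h2
  unfold wt at h
  ext k
  fin_cases k
  · change ex i 0 = ex j 0; omega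
  · change ex i 1 = ex j 1; omega
  · change ex i 2 = ex j 2; omega

/-- Evaluation at the test points. -/
noncomputable def ev5 : Sdeg 3 5 →ₗ[ℂ] (Fin 21 → ℂ) :=
  LinearMap.pi fun j => (aeval (pt j)).toLinearMap ∘ₗ (Sdeg 3 5).subtype

lemma ev5_apply (f : Sdeg 3 5) (j : Fin 21) : ev5 f j = eval (pt j) (f : PolyC 3) := by
  simp [ev5, aeval_eq_eval]

lemma ev5_inj : Function.Injective ev5 := by
  rw [injective_iff_map_eq_zero]
  intro f hf
  have h0 : (fun i => s5 f i) = 0 := by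
    apply Matrix.eq_zero_of_forall_pow_sum_mul_pow_eq_zero (f := fun i => (2 : ℂ) ^ wt (ex i))
    · intro i j hij
      apply wt_inj
      have : ((2 ^ wt (ex i) : ℕ) : ℂ) = ((2 ^ wt (ex j) : ℕ) : ℂ) := by
        push_cast; exact hij
      exact Nat.pow_right_injective le_rfl (Nat.cast_injective this)
    · intro j
      have h1 := congrFun hf j
      rw [ev5_apply] at h1
      have h2 : (f : PolyC 3) = ∑ i, s5 f i • (monomial (ex i) 1 : PolyC 3) := by
        conv_lhs => rw [← mb.sum_equivFun f]
        rw [AddSubmonoidClass.coe_finsetSum]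
        refine Finset.sum_congr rfl fun i _ => ?_
        rw [Submodule.coe_smul, mb_apply]
        simp [mb]
      rw [h2, map_sum] at h1
      simp only [smul_eval, eval_monomial_pt] at h1
      exact h1
  apply s5.injective
  rw [map_zero]; exact h0

lemma finrank_S5 : Module.finrank ℂ (Sdeg 3 5) = 21 := by
  rw [s5.finrank_eq]; simp

/-- The basis dual to the test points. -/
noncomputable def gb : Module.Basis (Fin 21) ℂ (Sdeg 3 5) :=
  haveI : FiniteDimensional ℂ (Sdeg 3 5) := Module.Finite.equiv s5.symm
  Module.Basis.ofEquivFun (LinearMap.linearEquivOfInjective ev5 ev5_inj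
    (by rw [finrank_S5]; simp))

lemma gb_eval (i j : Fin 21) : eval (pt j) (gb i : PolyC 3) = if i = j then 1 else 0 := by
  classical
  haveI : FiniteDimensional ℂ (Sdeg 3 5) := Module.Finite.equiv s5.symm
  have h : ev5 (gb i) = Pi.single i 1 := by
    rw [gb, Module.Basis.coe_ofEquivFun]
    exact (LinearMap.linearEquivOfInjective ev5 ev5_inj
      (by rw [finrank_S5]; simp)).apply_symm_apply _
  rw [← ev5_apply, h, Pi.single_apply]
  simp [eq_comm]

lemma deg_one (σ : Ex) (h : σ.degree = 1) : ∃ l, σ = Finsupp.single l 1 := by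
  rw [degree3] at h
  have h' : (σ 0 = 1 ∧ σ 1 = 0 ∧ σ 2 = 0) ∨ (σ 0 = 0 ∧ σ 1 = 1 ∧ σ 2 = 0) ∨
    (σ 0 = 0 ∧ σ 1 = 0 ∧ σ 2 = 1) := by omega
  rcases h' with h | h | h
  · refine ⟨0, ?_⟩; ext k; fin_cases k <;> simp [h]
  · refine ⟨1, ?_⟩; ext k; fin_cases k <;> simp [h]
  · refine ⟨2, ?_⟩; ext k; fin_cases k <;> simp [h]

lemma lin_form (f : PolyC 3) (hf : f ∈ Sdeg 3 1) :
    f = ∑ l : Fin 3, coeff (Finsupp.single l 1) f • (monomial (Finsupp.single l 1) 1 : PolyC 3) := by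
  classical
  rw [Sdeg_eq, mem_PS] at hf
  ext σ
  simp only [coeff_sum, coeff_smul, coeff_monomial, smul_eq_mul, mul_ite, mul_one, mul_zero]
  by_cases h : σ.degree = 1
  · obtain ⟨l, rfl⟩ := deg_one σ h
    rw [Finset.sum_eq_single l]
    · simp
    · intro k _ hk
      rw [if_neg]
      intro h'
      exact hk (Finsupp.single_left_injective one_ne_zero h')
    · simp
  · rw [hf σ (by rw [Set.mem_ofPred_eq]; exact_mod_cast h), Finset.sum_eq_zero]
    intro l _
    rw [if_neg]
    rintro rfl
    simp at h

lemma hpos (a b c : ℕ) (ha : 0 < a) (h : b < c) :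
    a^5 + a^4*b + a^3*b^2 + a^2*b^3 + a*b^4 + b^5 <
    a^5 + a^4*c + a^3*c^2 + a^2*c^3 + a*c^4 + c^5 := by
  gcongr

lemma lin_zero (i j k : ℕ) (hij : i ≠ j) (hik : i ≠ k) (hjk : j ≠ k) (f : PolyC 3)
    (hf : f ∈ Sdeg 3 1) (hi : eval (pt i) f = 0) (hj : eval (pt j) f = 0)
    (hk : eval (pt k) f = 0) : f = 0 := by
  rw [lin_form f hf] at hi hj hk ⊢
  simp only [Fin.sum_univ_three, map_add, smul_eval, eval_monomial_pt] at hi hj hk ⊢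
  set c0 := coeff (Finsupp.single 0 1) f
  set c1 := coeff (Finsupp.single 1 1) f
  set c2 := coeff (Finsupp.single 2 1) f
  have w0 : wt (Finsupp.single 0 1) = 0 := by simp [wt]
  have w1 : wt (Finsupp.single 1 1) = 1 := by simp [wt]
  have w2 : wt (Finsupp.single 2 1) = 6 := by simp [wt]
  rw [w0, w1, w2] at hi hj hk
  have tr' : ∀ i : ℕ, ((2 : ℂ) ^ 6) ^ i = ((2 ^ i : ℕ) : ℂ) ^ 6 := by
    intro i; push_cast; rw [← pow_mul, ← pow_mul, mul_comm]
  have tr1 : ∀ i : ℕ, ((2 : ℂ) ^ 1) ^ i = ((2 ^ i : ℕ) : ℂ) := by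
    intro i; push_cast; rw [pow_one]
  rw [tr', tr1, pow_zero, one_pow] at hi hj hk
  have inj : ∀ i j : ℕ, i ≠ j → (2 ^ i : ℕ) ≠ 2 ^ j :=
    fun i j h h' => h (Nat.pow_right_injective le_rfl h')
  have n1 := inj i j hij
  have n2 := inj i k hik
  have n3 := inj j k hjk
  have p1 : 0 < 2 ^ i := by positivity
  generalize 2 ^ i = a at *
  generalize 2 ^ j = b at *
  generalize 2 ^ k = c at *
  have m1 : (a : ℂ) - b ≠ 0 := sub_ne_zero.2 (Nat.cast_injective.ne n1)
  have m2 : (a : ℂ) - c ≠ 0 := sub_ne_zero.2 (Nat.cast_injective.ne n2)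
  have q1 : c1 + c2 * ((a^5 + a^4*b + a^3*b^2 + a^2*b^3 + a*b^4 + b^5 : ℕ) : ℂ) = 0 := by
    apply mul_left_cancel₀ m1
    push_cast
    linear_combination hi - hj
  have q2 : c1 + c2 * ((a^5 + a^4*c + a^3*c^2 + a^2*c^3 + a*c^4 + c^5 : ℕ) : ℂ) = 0 := by
    apply mul_left_cancel₀ m2
    push_cast
    linear_combination hi - hk
  have hne : (a^5 + a^4*b + a^3*b^2 + a^2*b^3 + a*b^4 + b^5 : ℕ) ≠
      a^5 + a^4*c + a^3*c^2 + a^2*c^3 + a*c^4 + c^5 := by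
    rcases lt_or_gt_of_ne n3 with h | h
    · exact (hpos a b c p1 h).ne
    · exact (hpos a c b p1 h).ne'
  have hc2 : c2 = 0 := by
    have h := sub_ne_zero.2 (Nat.cast_injective (R := ℂ) |>.ne hne)
    have h' : c2 * (((a^5 + a^4*b + a^3*b^2 + a^2*b^3 + a*b^4 + b^5 : ℕ) : ℂ) -
        ((a^5 + a^4*c + a^3*c^2 + a^2*c^3 + a*c^4 + c^5 : ℕ) : ℂ)) = 0 := by linear_combination q1 - q2
    exact (mul_eq_zero.1 h').resolve_right h
  have hc1 : c1 = 0 := by rw [hc2] at q1; simpa using q1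
  have hc0 : c0 = 0 := by rw [hc2, hc1] at hi; simpa using hi
  rw [hc0, hc1, hc2]; simp

lemma green (p : ℕ) (hp : 3 ≤ p) :
    ZZ Finset.univ (mulB fun i => (gb i : PolyC 3)) (p : ℤ) (Sdeg 3 1) = ⊥ := by
  classical
  rw [eq_bot_iff]
  rintro α ⟨hα, hk⟩
  replace hk : kd Finset.univ (mulB fun i => (gb i : PolyC 3)) α = 0 := hk
  rw [Submodule.mem_bot]
  funext J
  by_cases hJ : J.card = p
  · have key : ∀ i ∈ J, eval (pt i) (α J) = 0 := by
      intro i hi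
      have h := congrFun hk (J.erase i)
      rw [kd_apply] at h
      have h2 := congrArg (eval (pt i)) h
      rw [map_sum, Finset.sum_eq_single i] at h2
      · rw [Finset.insert_erase hi, smul_eval] at h2
        simp only [mulB, LinearMap.mulLeft_apply, map_mul, gb_eval, if_true, one_mul,
          Pi.zero_apply, map_zero] at h2
        exact (mul_eq_zero.1 h2).resolve_left (eps_ne_zero _ _)
      · intro j _ hj
        rw [smul_eval]
        simp only [mulB, LinearMap.mulLeft_apply, map_mul, gb_eval, if_neg hj, zero_mul, mul_zero]
      · intro h'; simp at h'
    obtain ⟨a, ha, b, hb, c, hc, hab, hac, hbc⟩ := Finset.two_lt_card.1 (by omega : 2 < J.card)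
    exact lin_zero a b c (Fin.val_ne_of_ne hab) (Fin.val_ne_of_ne hac) (Fin.val_ne_of_ne hbc) _
      (hα J).1 (key a ha) (key b hb) (key c hc)
  · exact (hα J).2 (fun h => hJ (by exact_mod_cast h.2))

end Kz



namespace Kz

open MvPolynomial

/-- Multiplication by the monomials of degree five. -/
noncomputable abbrev mm : Fin 21 → PolyC 3 →ₗ[ℂ] PolyC 3 := mulB fun i => (mb i : PolyC 3)

lemma mm_apply (i : Fin 21) (f : PolyC 3) : mm i f = monomial (ex i) 1 * f := by
  simp only [mm, mulB, LinearMap.mulLeft_apply, mb_apply]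

lemma mm_monomial (i : Fin 21) (τ : Ex) (c : ℂ) : mm i (monomial τ c) = monomial (ex i + τ) c := by
  rw [mm_apply, monomial_mul, one_mul]

lemma monomial_mem_Sdeg {σ : Ex} {e : ℤ} (h : (σ.degree : ℤ) = e) (c : ℂ) :
    (monomial σ c : PolyC 3) ∈ Sdeg 3 e := by
  rw [Sdeg_eq]; exact monomial_mem_PS h c

/-- Induction over homogeneous polynomials. -/
lemma Sdeg_induct {e : ℤ} {P : PolyC 3 → Prop} (h0 : P 0)
    (hadd : ∀ f g, P f → P g → P (f + g))
    (hm : ∀ (σ : Ex) (c : ℂ), (σ.degree : ℤ) = e → P (monomial σ c))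
    (f : PolyC 3) (hf : f ∈ Sdeg 3 e) : P f := by
  classical
  rw [Sdeg_eq, mem_PS] at hf
  rw [← support_sum_monomial_coeff f]
  apply Finset.sum_induction _ P hadd h0
  intro σ hσ
  apply hm
  by_contra h
  exact (mem_support_iff.1 hσ) (hf σ h)

lemma exists_sub (σ : Ex) (h : 0 < σ.degree) : ∃ (l : Fin 3) (ρ : Ex), σ = ρ + Finsupp.single l 1 := by
  have : ∃ l, 1 ≤ σ l := by
    by_contra h'
    push Not at h'
    rw [degree3] at h
    have := h' 0; have := h' 1; have := h' 2
    omega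
  obtain ⟨l, hl⟩ := this
  refine ⟨l, σ - Finsupp.single l 1, ?_⟩
  rw [tsub_add_cancel_of_le]
  rw [Finsupp.single_le_iff]; exact hl

lemma deg_add_single (ρ : Ex) (l : Fin 3) : (ρ + Finsupp.single l 1).degree = ρ.degree + 1 := by
  rw [map_add, Finsupp.degree_single]

lemma K01_aux (f : PolyC 3) (hf : f ∈ Sdeg 3 6) :
    (Pi.single ∅ f : Finset (Fin 21) → PolyC 3) ∈ BB Finset.univ mm 1 (Sdeg 3 1) := by
  classical
  refine Sdeg_induct (P := fun f => (Pi.single ∅ f : Finset (Fin 21) → PolyC 3) ∈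
    BB Finset.univ mm 1 (Sdeg 3 1)) ?_ ?_ ?_ f hf
  · rw [Pi.single_zero]; exact Submodule.zero_mem _
  · intro f g hf hg
    rw [Pi.single_add]; exact Submodule.add_mem _ hf hg
  · intro σ c hσ
    have hσ' : σ.degree = 6 := by exact_mod_cast hσ
    obtain ⟨l, ρ, rfl⟩ := exists_sub σ (by omega)
    rw [deg_add_single] at hσ'
    obtain ⟨i, rfl⟩ := ex_surj ρ (by omega)
    refine ⟨Pi.single {i} (monomial (Finsupp.single l 1) c),
      single_mem_CC (Finset.subset_univ _) (by simp) (monomial_mem_Sdeg (by simp) c), ?_⟩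
    rw [kd_single, Finset.sum_singleton, mm_monomial]
    simp [eps, Finset.filter_singleton]

lemma K01 : CC Finset.univ 0 (Sdeg 3 6) ≤ BB Finset.univ mm 1 (Sdeg 3 1) := by
  classical
  intro α hα
  have : α = Pi.single ∅ (α ∅) := by
    funext J
    by_cases h : J = ∅
    · subst h; simp
    · rw [Pi.single_eq_of_ne h, (hα J).2]
      rintro ⟨_, h'⟩
      exact h (Finset.card_eq_zero.1 (by exact_mod_cast h'))
  rw [this]
  exact K01_aux _ (hα ∅).1

/-- Boundaries in homological degree one. -/
noncomputable abbrev NN : Submodule ℂ (Finset (Fin 21) → PolyC 3) :=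
  BB Finset.univ mm 2 (Sdeg 3 1)

/-- Class of a monomial chain. -/
noncomputable def UU (i : Fin 21) (τ : Ex) : (Finset (Fin 21) → PolyC 3) ⧸ NN :=
  NN.mkQ (Pi.single {i} (monomial τ 1))

lemma UU_rel (i j : Fin 21) (l : Fin 3) :
    UU j (ex i + Finsupp.single l 1) = UU i (ex j + Finsupp.single l 1) := by
  classical
  have main : ∀ i j : Fin 21, i < j →
      UU j (ex i + Finsupp.single l 1) = UU i (ex j + Finsupp.single l 1) := by
    intro i j h
    have hij : i ≠ j := h.ne
    unfold UU
    rw [← sub_eq_zero, ← map_sub, Submodule.mkQ_apply, Submodule.Quotient.mk_eq_zero]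
    refine ⟨Pi.single {i, j} (monomial (Finsupp.single l 1) 1),
      single_mem_CC (Finset.subset_univ _) (by rw [Finset.card_pair hij]; rfl)
        (monomial_mem_Sdeg (by simp) 1), ?_⟩
    rw [kd_single, Finset.sum_pair hij, mm_monomial, mm_monomial]
    have e1 : ({i, j} : Finset (Fin 21)).erase i = {j} := by
      ext k; simp only [Finset.mem_erase, Finset.mem_insert, Finset.mem_singleton]
      constructor
      · rintro ⟨h1, h2⟩; exact h2.resolve_left h1
      · rintro rfl; exact ⟨hij.symm, Or.inr rfl⟩
    have e2 : ({i, j} : Finset (Fin 21)).erase j = {i} := by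
      ext k; simp only [Finset.mem_erase, Finset.mem_insert, Finset.mem_singleton]
      constructor
      · rintro ⟨h1, h2⟩; exact h2.resolve_right h1
      · rintro rfl; exact ⟨hij, Or.inl rfl⟩
    have s1 : eps i ({i, j} : Finset (Fin 21)) = 1 := by
      simp [eps, Finset.filter_insert, Finset.filter_singleton, not_lt.2 h.le]
    have s2 : eps j ({i, j} : Finset (Fin 21)) = -1 := by
      simp [eps, Finset.filter_insert, Finset.filter_singleton, h]
    rw [e1, e2, s1, s2, one_smul, neg_smul, one_smul, sub_eq_add_neg]
  rcases lt_trichotomy i j with h | h | h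
  · exact main i j h
  · rw [h]
  · exact (main j i h).symm

lemma UU_swap (i i' : Fin 21) (κ ρ : Ex) (a b : Fin 3) (hi : ex i = κ + Finsupp.single a 1)
    (hi' : ex i' = κ + Finsupp.single b 1) (hρ : ρ.degree = 5) :
    UU i (ρ + Finsupp.single b 1) = UU i' (ρ + Finsupp.single a 1) := by
  obtain ⟨j, rfl⟩ := ex_surj ρ hρ
  rw [UU_rel j i b, UU_rel j i' a, hi, hi', add_right_comm]

lemma UU_eq (n : ℕ) : ∀ (i i' : Fin 21) (τ τ' : Ex), τ.degree = 6 → ex i + τ = ex i' + τ' →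
    (ex i - ex i').degree = n → UU i τ = UU i' τ' := by
  induction n with
  | zero =>
    intro i i' τ τ' hτ h hn
    have h1 := ex_deg i
    have h2 := ex_deg i'
    rw [degree3] at h1 h2 hn
    simp only [Finsupp.tsub_apply] at hn
    have : i = i' := by
      apply ex_inj
      ext k
      fin_cases k
      · change ex i 0 = ex i' 0; omega
      · change ex i 1 = ex i' 1; omega
      · change ex i 2 = ex i' 2; omega
    subst this
    rw [add_left_cancel h]
  | succ n ih =>
    intro i i' τ τ' hτ h hn
    have h1 := ex_deg i
    have h2 := ex_deg i'
    have ha : ∃ a, ex i' a < ex i a := by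
      by_contra h'
      push Not at h'
      rw [degree3] at hn
      simp only [Finsupp.tsub_apply] at hn
      have := h' 0; have := h' 1; have := h' 2
      omega
    obtain ⟨a, ha⟩ := ha
    have hb : ∃ b, ex i b < ex i' b := by
      by_contra h'
      push Not at h'
      rw [degree3] at h1 h2
      have := h' 0; have := h' 1; have := h' 2
      fin_cases a <;> simp only [Fin.zero_eta, Fin.mk_one, Fin.reduceFinMk] at ha <;> omega
    obtain ⟨b, hb⟩ := hb
    have hab : a ≠ b := by rintro rfl; omega
    have hτb : 1 ≤ τ b := by
      have := DFunLike.congr_fun h b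
      simp only [Finsupp.add_apply] at this
      omega
    obtain ⟨κ, hκ⟩ : ∃ κ, ex i = κ + Finsupp.single a 1 :=
      ⟨ex i - Finsupp.single a 1, (tsub_add_cancel_of_le (by
        rw [Finsupp.single_le_iff]; omega)).symm⟩
    obtain ⟨ρ, rfl⟩ : ∃ ρ, τ = ρ + Finsupp.single b 1 :=
      ⟨τ - Finsupp.single b 1, (tsub_add_cancel_of_le (by
        rw [Finsupp.single_le_iff]; omega)).symm⟩
    rw [deg_add_single] at hτ
    obtain ⟨i'', hi''⟩ := ex_surj (κ + Finsupp.single b 1) (by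
      rw [hκ, deg_add_single] at h1; rw [deg_add_single, h1])
    rw [UU_swap i i'' κ ρ a b hκ hi'' (by omega)]
    apply ih
    · rw [deg_add_single]; omega
    · rw [← h, hi'', hκ]; abel
    · have e : ex i - ex i' = (ex i'' - ex i') + Finsupp.single a 1 := by
        ext k
        rw [hκ] at ha hb
        simp only [hi'', hκ, Finsupp.tsub_apply, Finsupp.add_apply] at ha hb ⊢
        rw [Finsupp.single_eq_same] at ha
        rw [Finsupp.single_eq_of_ne (Ne.symm hab)] at hb
        by_cases h1 : k = a
        · subst h1
          rw [Finsupp.single_eq_same, Finsupp.single_eq_of_ne hab]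
          omega
        · rw [Finsupp.single_eq_of_ne h1]
          by_cases h2 : k = b
          · subst h2
            rw [Finsupp.single_eq_same]
            omega
          · rw [Finsupp.single_eq_of_ne h2]; omega
      rw [e, deg_add_single] at hn
      omega

open Classical in
/-- The section from degree eleven polynomials to chains modulo boundaries. -/
noncomputable def Psi : PolyC 3 →ₗ[ℂ] ((Finset (Fin 21) → PolyC 3) ⧸ NN) :=
  (basisMonomials (Fin 3) ℂ).constr ℂ fun γ =>
    if h : ∃ x : Fin 21 × Ex, x.2.degree = 6 ∧ ex x.1 + x.2 = γ then UU h.choose.1 h.choose.2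
    else 0

lemma Psi_monomial (i : Fin 21) (τ : Ex) (hτ : τ.degree = 6) (c : ℂ) :
    Psi (monomial (ex i + τ) c) = c • UU i τ := by
  classical
  have h1 : (monomial (ex i + τ) c : PolyC 3) = c • basisMonomials (Fin 3) ℂ (ex i + τ) := by
    rw [coe_basisMonomials, smul_monomial, smul_eq_mul, mul_one]
  rw [h1, map_smul]
  congr 1
  unfold Psi
  rw [Module.Basis.constr_basis]
  have h : ∃ x : Fin 21 × Ex, x.2.degree = 6 ∧ ex x.1 + x.2 = ex i + τ := ⟨(i, τ), hτ, rfl⟩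
  rw [dif_pos h]
  exact UU_eq _ _ _ _ _ h.choose_spec.1 h.choose_spec.2 rfl

lemma Psi_mm (i : Fin 21) (f : PolyC 3) (hf : f ∈ Sdeg 3 6) :
    NN.mkQ (Pi.single {i} f) = Psi (mm i f) := by
  classical
  refine Sdeg_induct (P := fun f => NN.mkQ (Pi.single {i} f) = Psi (mm i f)) ?_ ?_ ?_ f hf
  · rw [Pi.single_zero, map_zero, map_zero, map_zero]
  · intro f g hf hg
    rw [Pi.single_add, map_add, hf, hg, map_add, map_add]
  · intro σ c hσ
    rw [mm_monomial, Psi_monomial i σ (by exact_mod_cast hσ), UU, ← map_smul]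
    congr 1
    rw [← Pi.single_smul, smul_monomial, smul_eq_mul, mul_one]

lemma K11 : ZZ Finset.univ mm 1 (Sdeg 3 6) ≤ BB Finset.univ mm 2 (Sdeg 3 1) := by
  classical
  rintro α ⟨hα, hk⟩
  replace hk : kd Finset.univ mm α = 0 := hk
  have h1 : α = ∑ i : Fin 21, Pi.single {i} (α {i}) := by
    funext J
    rw [Finset.sum_apply]
    by_cases hJ : J.card = 1
    · obtain ⟨i, rfl⟩ := Finset.card_eq_one.1 hJ
      rw [Finset.sum_eq_single i]
      · simp
      · intro j _ hj
        rw [Pi.single_eq_of_ne]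
        intro h; exact hj (Finset.singleton_injective h).symm
      · simp
    · rw [(hα J).2 (fun h => hJ (by exact_mod_cast h.2)), Finset.sum_eq_zero]
      intro i _
      rw [Pi.single_eq_of_ne]
      rintro rfl; simp at hJ
  have h2 : NN.mkQ α = Psi (kd Finset.univ mm α ∅) := by
    conv_lhs => rw [h1]
    rw [map_sum, kd_apply, Finset.sdiff_empty, map_sum]
    refine Finset.sum_congr rfl fun i _ => ?_
    rw [Psi_mm i _ (hα {i}).1, insert_empty_eq]
    simp [eps]
  rw [hk, Pi.zero_apply, map_zero, Submodule.mkQ_apply, Submodule.Quotient.mk_eq_zero] at h2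
  exact h2

end Kz



namespace Kz

open MvPolynomial

lemma mm_eq : mm = mu ex 0 := by
  classical
  funext i
  ext1 f
  refine LinearMap.ext fun g => ?_
  rw [LinearMap.comp_apply, LinearMap.comp_apply, mm_apply, mu_apply]
  ext τ
  rw [coeff_tr, if_pos]
  simp [okS]

lemma ell_exists (k : Fin 3) : ∃ i, ex i = Finsupp.single k 5 := ex_surj _ (by simp)

/-- Index of the pure power of the `k`-th variable. -/
noncomputable def ell (k : Fin 3) : Fin 21 := (ell_exists k).choose

lemma ex_ell (k : Fin 3) : ex (ell k) = Finsupp.single k 5 := (ell_exists k).choose_spec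

lemma ell_inj : Function.Injective ell := by
  intro a b h
  have := ex_ell a
  rw [h, ex_ell b] at this
  exact (Finsupp.single_left_injective (by norm_num : (5 : ℕ) ≠ 0) this).symm

/-- Index sets with pure powers removed. -/
noncomputable def T1 : Finset (Fin 21) := Finset.univ.erase (ell 0)
/-- Index sets with pure powers removed. -/
noncomputable def T2 : Finset (Fin 21) := T1.erase (ell 1)
/-- Index sets with pure powers removed. -/
noncomputable def T3 : Finset (Fin 21) := T2.erase (ell 2)

lemma h0mem : ell 0 ∈ (Finset.univ : Finset (Fin 21)) := Finset.mem_univ _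
lemma h1mem : ell 1 ∈ T1 := Finset.mem_erase.2 ⟨ell_inj.ne (by decide), Finset.mem_univ _⟩
lemma h2mem : ell 2 ∈ T2 := Finset.mem_erase.2 ⟨ell_inj.ne (by decide),
  Finset.mem_erase.2 ⟨ell_inj.ne (by decide), Finset.mem_univ _⟩⟩

lemma card_T3 : T3.card = 18 := by
  rw [T3, Finset.card_erase_of_mem h2mem, T2, Finset.card_erase_of_mem h1mem, T1,
    Finset.card_erase_of_mem h0mem]
  simp

/-- Ranks of the reduced differentials. -/
noncomputable def FF (p : ℤ) (q : ℤ) : ℕ := Module.finrank ℂ (BB T3 (mu ex 3) p (WW 3 q))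

lemma red_step (k : Fin 3) (T : Finset (Fin 21)) (h : ell k ∈ T) (p : ℕ) (q : ℤ) :
    Module.finrank ℂ (ZZ T (mu ex k) (p : ℤ) (WW k q)) +
      Module.finrank ℂ (BB (T.erase (ell k)) (mu ex (k + 1)) ((p : ℤ) + 1) (WW (k + 1) (q - 1)))
    = Module.finrank ℂ (ZZ (T.erase (ell k)) (mu ex (k + 1)) (p : ℤ) (WW (k + 1) q)) +
      Module.finrank ℂ (BB T (mu ex k) ((p : ℤ) + 1) (WW k (q - 1))) := by
  have H := redHyp ex ex_deg k (ell k) (ex_ell k) (T.erase (ell k)) (Finset.notMem_erase _ _)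
  have := red_main H (p : ℤ) q
  rwa [Finset.insert_erase h] at this

lemma Kdim_formula (D : KFam 3 5) (hD : IsKoszulFam 3 5 D) (p : ℕ) (q : ℤ) :
    Kdim 3 5 D 1 p q =
      Module.finrank ℂ (ZZ T3 (mu ex 3) (p : ℤ) (WW 3 q)) - FF (p + 1) (q - 1) := by
  rw [Kdim_bridge D hD mb p q]
  change Module.finrank ℂ (ZZ Finset.univ mm (p : ℤ) (Sdeg 3 (1 + q * 5))) -
    Module.finrank ℂ (BB Finset.univ mm ((p : ℤ) + 1) (Sdeg 3 (1 + (q - 1) * 5))) = _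
  rw [mm_eq, Sdeg_eq_WW, Sdeg_eq_WW]
  have a := red_step 0 Finset.univ h0mem p q
  have b := red_step 1 T1 h1mem p q
  have c := red_step 2 T2 h2mem p q
  simp only [Fin.val_zero, Fin.val_one, Fin.val_two, zero_add, Nat.reduceAdd] at a b c
  rw [← T1] at a
  rw [← T2] at b
  rw [← T3] at c
  unfold FF
  omega

lemma Kdim_FF (D : KFam 3 5) (hD : IsKoszulFam 3 5 D) (p : ℕ) (q : ℤ) :
    Kdim 3 5 D 1 p q =
      Nat.choose 18 p * Module.finrank ℂ (WW 3 q) - FF p q - FF (p + 1) (q - 1) := by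
  rw [Kdim_formula D hD]
  have := rank_null T3 (mu ex 3) p (WW 3 q)
  rw [card_T3] at this
  unfold FF
  omega

lemma FF_le (p : ℕ) (q : ℤ) : FF p q ≤ Nat.choose 18 p * Module.finrank ℂ (WW 3 q) := by
  have := rank_null T3 (mu ex 3) p (WW 3 q)
  rw [card_T3] at this
  unfold FF
  omega

lemma FF_add_le (p : ℕ) (q : ℤ) :
    FF p q + FF (p + 1) (q - 1) ≤ Nat.choose 18 p * Module.finrank ℂ (WW 3 q) := by
  have h := rank_null T3 (mu ex 3) p (WW 3 q)
  rw [card_T3] at h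
  have hle : BB T3 (mu ex 3) ((p : ℤ) + 1) (WW 3 (q - 1)) ≤ ZZ T3 (mu ex 3) p (WW 3 q) := by
    rintro _ ⟨γ, hγ, rfl⟩
    refine ⟨?_, kd_kd _ _ (mu_comm ex 3) _⟩
    have := kd_mem (T := T3) (μ := mu ex 3) (W := WW 3 (q - 1)) (W' := WW 3 q) (fun i w hw => by
      have := mu_mem ex ex_deg 3 (q - 1) i w hw
      rwa [sub_add_cancel] at this) hγ
    rwa [add_sub_cancel_right] at this
  haveI : FiniteDimensional ℂ (ZZ T3 (mu ex 3) (p : ℤ) (WW 3 q)) :=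
    Submodule.finiteDimensional_of_le (inf_le_left : ZZ T3 (mu ex 3) (p : ℤ) (WW 3 q) ≤
      CC T3 (p : ℤ) (WW 3 q))
  have := Submodule.finrank_mono hle
  unfold FF
  omega

lemma FF_zero_left (q : ℤ) : FF 0 q = 0 := by
  have : BB T3 (mu ex 3) 0 (WW 3 q) = ⊥ := by
    rw [eq_bot_iff]
    rintro _ ⟨γ, hγ, rfl⟩
    rw [Submodule.mem_bot]
    have h := kd_mem (T := T3) (μ := mu ex 3) (W' := WW 3 (q + 1))
      (fun i w hw => mu_mem ex ex_deg 3 q i w hw) hγ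
    funext J
    apply (h J).2
    rintro ⟨_, h'⟩
    omega
  rw [FF, this, finrank_bot]

lemma FF_two (p : ℤ) : FF p 2 = 0 := by
  have : BB T3 (mu ex 3) p (WW 3 2) = ⊥ := by
    rw [eq_bot_iff]
    rintro _ ⟨γ, hγ, rfl⟩
    rw [Submodule.mem_bot]
    have h := kd_mem (T := T3) (μ := mu ex 3) (W' := WW 3 (2 + 1))
      (fun i w hw => mu_mem ex ex_deg 3 2 i w hw) hγ
    rw [WW_big (2 + 1) (by norm_num)] at h
    funext J
    exact (h J).1
  rw [FF, this, finrank_bot]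

lemma FF_neg (p : ℕ) (q : ℤ) (h : q < 0) : FF p q = 0 := by
  have := FF_le p q
  rw [WW_neg 3 q h, finrank_bot] at this
  omega

/-- The socle exponent. -/
noncomputable def top4 : Ex := Finsupp.equivFunOnFinite.symm fun _ => 4

lemma top4_apply (i : Fin 3) : top4 i = 4 := rfl

lemma le_top4 (σ : Ex) : σ ≤ top4 ↔ σ ∈ okS 3 := by
  constructor
  · intro h i _
    have := h i
    rw [top4_apply] at this
    omega
  · intro h i
    have := h i i.2
    rw [top4_apply]
    omega

/-- The socle pairing. -/
noncomputable def kap : PolyC 3 →ₗ[ℂ] PolyC 3 →ₗ[ℂ] ℂ :=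
  (LinearMap.mul ℂ (PolyC 3)).compr₂ (lcoeff ℂ top4)

lemma kap_apply (a b : PolyC 3) : kap a b = coeff top4 (a * b) := rfl

lemma kap_symm (a b : PolyC 3) : kap a b = kap b a := by
  rw [kap_apply, kap_apply, mul_comm]

lemma kap_tr (a b : PolyC 3) : kap (tr (okS 3) a) b = kap a b := by
  classical
  rw [kap_apply, kap_apply, coeff_mul, coeff_mul]
  refine Finset.sum_congr rfl fun x hx => ?_
  rw [coeff_tr, if_pos]
  rw [← le_top4]
  rw [Finset.HasAntidiagonal.mem_antidiagonal] at hx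
  rw [← hx]
  exact le_self_add

lemma kap_mu (i : Fin 21) (a b : PolyC 3) : kap (mu ex 3 i a) b = kap a (mu ex 3 i b) := by
  rw [mu_apply, mu_apply, kap_tr, kap_symm a, kap_tr, kap_apply, kap_apply]
  congr 1; ring

lemma kap_nondeg (q q' : ℤ) (hq : q + q' = 2) (a : PolyC 3) (ha : a ∈ WW 3 q)
    (h : ∀ b ∈ WW 3 q', kap a b = 0) : a = 0 := by
  classical
  ext σ
  rw [coeff_zero]
  by_cases hσ : (σ.degree : ℤ) = 1 + q * 5 ∧ σ ∈ okS 3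
  · have hle := (le_top4 σ).2 hσ.2
    have hdeg : (top4 - σ).degree + σ.degree = 12 := by
      rw [← map_add, tsub_add_cancel_of_le hle, degree3]
      simp [top4_apply]
    have hm : (monomial (top4 - σ) 1 : PolyC 3) ∈ WW 3 q' := by
      apply monomial_mem_PS
      refine ⟨by omega, ?_⟩
      rw [← le_top4]
      exact tsub_le_self
    have := h _ hm
    rw [kap_apply, coeff_mul_monomial', if_pos tsub_le_self, mul_one,
      tsub_tsub_cancel_of_le hle] at this
    exact this
  · exact ha σ hσ

lemma FF_dual (p q : ℕ) (h : p + q = 19) : FF p 1 = FF q 0 := by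
  refine rank_dual T3 kap (mu ex 3) kap_mu kap_symm (WW 3 0) (WW 3 1) (WW 3 2) ?_ ?_ ?_ ?_ p q
    (by rw [card_T3]; exact h)
  · intro i w hw; exact mu_mem ex ex_deg 3 0 i w hw
  · intro i w hw; exact mu_mem ex ex_deg 3 1 i w hw
  · intro a ha hb; exact kap_nondeg 1 1 (by norm_num) a ha hb
  · intro a ha hb; exact kap_nondeg 2 0 (by norm_num) a ha hb

lemma Sdeg_finite (q : ℤ) : FiniteDimensional ℂ (Sdeg 3 (1 + q * 5)) := by
  rw [Sdeg_eq_WW]; infer_instance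

lemma Kdim_green (D : KFam 3 5) (hD : IsKoszulFam 3 5 D) (p : ℕ) (hp : 3 ≤ p) :
    Kdim 3 5 D 1 p 0 = 0 := by
  rw [Kdim_bridge D hD gb p 0, show (1 + 0 * 5 : ℤ) = 1 by norm_num, green p hp, finrank_bot,
    Nat.zero_sub]

lemma Kdim_01 (D : KFam 3 5) (hD : IsKoszulFam 3 5 D) : Kdim 3 5 D 1 0 1 = 0 := by
  rw [Kdim_bridge D hD mb 0 1]
  haveI := Sdeg_finite 0
  rw [show (1 + (1 - 1) * 5 : ℤ) = 1 + 0 * 5 by norm_num]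
  haveI : FiniteDimensional ℂ (CC (Finset.univ : Finset (Fin 21)) ((1 : ℕ) : ℤ)
    (Sdeg 3 (1 + 0 * 5))) := inferInstance
  haveI : FiniteDimensional ℂ (BB Finset.univ mm ((1 : ℕ) : ℤ) (Sdeg 3 (1 + 0 * 5))) := by
    unfold BB; infer_instance
  apply Nat.sub_eq_zero_of_le
  refine Submodule.finrank_mono (t := BB Finset.univ mm ((1 : ℕ) : ℤ) (Sdeg 3 (1 + 0 * 5))) ?_
  exact le_trans inf_le_left K01

lemma Kdim_11 (D : KFam 3 5) (hD : IsKoszulFam 3 5 D) : Kdim 3 5 D 1 1 1 = 0 := by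
  rw [Kdim_bridge D hD mb 1 1]
  haveI := Sdeg_finite 0
  rw [show (1 + (1 - 1) * 5 : ℤ) = 1 + 0 * 5 by norm_num]
  haveI : FiniteDimensional ℂ (CC (Finset.univ : Finset (Fin 21)) ((2 : ℕ) : ℤ)
    (Sdeg 3 (1 + 0 * 5))) := inferInstance
  haveI : FiniteDimensional ℂ (BB Finset.univ mm ((2 : ℕ) : ℤ) (Sdeg 3 (1 + 0 * 5))) := by
    unfold BB; infer_instance
  apply Nat.sub_eq_zero_of_le
  refine Submodule.finrank_mono (t := BB Finset.univ mm ((2 : ℕ) : ℤ) (Sdeg 3 (1 + 0 * 5))) ?_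
  exact K11

/-- Values of the ranks. -/
def rho (n : ℕ) : ℕ := if n = 0 then 0 else if n = 1 then 19 else if n = 2 then 339
  else 3 * Nat.choose 18 n

lemma FF_ge3 (D : KFam 3 5) (hD : IsKoszulFam 3 5 D) (p : ℕ) (hp : 3 ≤ p) :
    FF p 0 = 3 * Nat.choose 18 p := by
  have h := Kdim_green D hD p hp
  rw [Kdim_FF D hD, finrank_WW0] at h
  have h2 := FF_le p 0
  rw [finrank_WW0] at h2
  have h3 : FF ((p : ℤ) + 1) (0 - 1) = 0 := by
    have := FF_neg (p + 1) (0 - 1) (by norm_num)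
    first
      | exact this
      | (rw [Nat.cast_add, Nat.cast_one] at this; exact this)
  omega

lemma FF_rho (D : KFam 3 5) (hD : IsKoszulFam 3 5 D) (n : ℕ) : FF n 0 = rho n := by
  unfold rho
  split_ifs with h0 h1 h2
  · subst h0; exact FF_zero_left 0
  · subst h1
    have h := Kdim_01 D hD
    rw [Kdim_FF D hD, finrank_WW1] at h
    have h2 := FF_add_le 0 1
    rw [finrank_WW1] at h2
    have h3 := FF_zero_left 1
    norm_num at h h2 ⊢
    omega
  · subst h2
    have h := Kdim_11 D hD
    rw [Kdim_FF D hD, finrank_WW1] at h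
    have h2 := FF_add_le 1 1
    rw [finrank_WW1] at h2
    have h3 := FF_dual 1 18 (by norm_num)
    have h4 := FF_ge3 D hD 18 (by norm_num)
    norm_num at h h2 h3 h4 ⊢
    omega
  · rw [FF_ge3 D hD n (by omega)]

lemma Kdim_q0 (D : KFam 3 5) (hD : IsKoszulFam 3 5 D) (p : ℕ) :
    Kdim 3 5 D 1 p 0 = 3 * Nat.choose 18 p - rho p := by
  have h3 : FF ((p : ℤ) + 1) (0 - 1) = 0 := by
    have := FF_neg (p + 1) (0 - 1) (by norm_num)
    first
      | exact this
      | (rw [Nat.cast_add, Nat.cast_one] at this; exact this)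
  rw [Kdim_FF D hD, finrank_WW0, FF_rho D hD, h3, mul_comm, Nat.sub_zero]

lemma Kdim_q1 (D : KFam 3 5) (hD : IsKoszulFam 3 5 D) (p : ℕ) (hp : p ≤ 18) :
    Kdim 3 5 D 1 p 1 = 19 * Nat.choose 18 p - rho (19 - p) - rho (p + 1) := by
  have h1 := FF_rho D hD (p + 1)
  push_cast at h1
  rw [Kdim_FF D hD, finrank_WW1, FF_dual p (19 - p) (by omega), FF_rho D hD,
    show (1 - 1 : ℤ) = 0 by norm_num, h1, mul_comm]

lemma Kdim_q2 (D : KFam 3 5) (hD : IsKoszulFam 3 5 D) (p : ℕ) (hp : p ≤ 18) :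
    Kdim 3 5 D 1 p 2 = 3 * Nat.choose 18 p - rho (18 - p) := by
  have h1 := FF_dual (p + 1) (18 - p) (by omega)
  rw [FF_rho D hD] at h1
  push_cast at h1
  rw [Kdim_FF D hD, finrank_WW2, FF_two, show (2 - 1 : ℤ) = 1 by norm_num, h1, mul_comm,
    Nat.sub_zero]

lemma Kdim_big_p (D : KFam 3 5) (hD : IsKoszulFam 3 5 D) (p : ℕ) (hp : 18 < p) (q : ℤ) :
    Kdim 3 5 D 1 p q = 0 := by
  rw [Kdim_FF D hD, Nat.choose_eq_zero_of_lt hp, zero_mul, Nat.zero_sub, Nat.zero_sub]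

lemma Kdim_neg_q (D : KFam 3 5) (hD : IsKoszulFam 3 5 D) (p : ℕ) (q : ℤ) (hq : q < 0) :
    Kdim 3 5 D 1 p q = 0 := by
  rw [Kdim_FF D hD, WW_neg 3 q hq, finrank_bot, mul_zero, Nat.zero_sub, Nat.zero_sub]

lemma Kdim_big_q (D : KFam 3 5) (hD : IsKoszulFam 3 5 D) (p : ℕ) (q : ℤ) (hq : 3 ≤ q) :
    Kdim 3 5 D 1 p q = 0 := by
  rw [Kdim_FF D hD, WW_big q hq, finrank_bot, mul_zero, Nat.zero_sub, Nat.zero_sub]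

lemma Kdim_vanish (D : KFam 3 5) (hD : IsKoszulFam 3 5 D) (p : ℕ) (q : ℤ)
    (h : ¬((p ≤ 2 ∧ q = 0) ∨ (2 ≤ p ∧ p ≤ 16 ∧ q = 1) ∨ (16 ≤ p ∧ p ≤ 18 ∧ q = 2))) :
    Kdim 3 5 D 1 p q = 0 := by
  rcases lt_or_ge 18 p with hp | hp
  · exact Kdim_big_p D hD p hp q
  rcases lt_or_ge q 0 with hq | hq
  · exact Kdim_neg_q D hD p q hq
  rcases le_or_gt 3 q with hq' | hq'
  · exact Kdim_big_q D hD p q hq'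
  interval_cases q
  · rw [Kdim_q0 D hD]
    have : 2 < p := by omega
    unfold rho
    rw [if_neg (by omega), if_neg (by omega), if_neg (by omega), Nat.sub_self]
  · rw [Kdim_q1 D hD p hp]
    have : p = 0 ∨ p = 1 ∨ p = 17 ∨ p = 18 := by omega
    rcases this with rfl | rfl | rfl | rfl <;> decide +kernel
  · rw [Kdim_q2 D hD p hp]
    have : p ≤ 15 := by omega
    unfold rho
    rw [if_neg (by omega), if_neg (by omega), if_neg (by omega), Nat.choose_symm hp, Nat.sub_self]

end Kz


/-- Betti table of the pushforward of O(b=1) under the 5-uple Veronese embedding of P^2. -/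
theorem veronese_betti_P2_b1_d5 (D : KFam 3 5) (hD : IsKoszulFam 3 5 D) :
    Kdim 3 5 D 1 0 0 = 3 ∧
    Kdim 3 5 D 1 1 0 = 35 ∧
    Kdim 3 5 D 1 2 0 = 120 ∧
    Kdim 3 5 D 1 2 1 = 405 ∧
    Kdim 3 5 D 1 3 1 = 5865 ∧
    Kdim 3 5 D 1 4 1 = 29988 ∧
    Kdim 3 5 D 1 5 1 = 97920 ∧
    Kdim 3 5 D 1 6 1 = 231540 ∧
    Kdim 3 5 D 1 7 1 = 417690 ∧
    Kdim 3 5 D 1 8 1 = 590070 ∧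
    Kdim 3 5 D 1 9 1 = 661232 ∧
    Kdim 3 5 D 1 10 1 = 590070 ∧
    Kdim 3 5 D 1 11 1 = 417690 ∧
    Kdim 3 5 D 1 12 1 = 231540 ∧
    Kdim 3 5 D 1 13 1 = 97920 ∧
    Kdim 3 5 D 1 14 1 = 29988 ∧
    Kdim 3 5 D 1 15 1 = 5865 ∧
    Kdim 3 5 D 1 16 1 = 405 ∧
    Kdim 3 5 D 1 16 2 = 120 ∧
    Kdim 3 5 D 1 17 2 = 35 ∧
    Kdim 3 5 D 1 18 2 = 3 ∧
    (∀ (p : ℕ) (q : ℤ), ¬((p ≤ 2 ∧ q = 0) ∨ (2 ≤ p ∧ p ≤ 16 ∧ q = 1) ∨ (16 ≤ p ∧ p ≤ 18 ∧ q = 2)) →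
      Kdim 3 5 D 1 p q = 0) := by
  refine ⟨?_, ?_, ?_, ?_, ?_, ?_, ?_, ?_, ?_, ?_, ?_, ?_, ?_, ?_, ?_, ?_, ?_, ?_, ?_, ?_, ?_, fun p q h => Kz.Kdim_vanish D hD p q h⟩
  · rw [Kz.Kdim_q0 D hD]; decide +kernel
  · rw [Kz.Kdim_q0 D hD]; decide +kernel
  · rw [Kz.Kdim_q0 D hD]; decide +kernel
  · rw [Kz.Kdim_q1 D hD _ (by norm_num)]; decide +kernel
  · rw [Kz.Kdim_q1 D hD _ (by norm_num)]; decide +kernel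
  · rw [Kz.Kdim_q1 D hD _ (by norm_num)]; decide +kernel
  · rw [Kz.Kdim_q1 D hD _ (by norm_num)]; decide +kernel
  · rw [Kz.Kdim_q1 D hD _ (by norm_num)]; decide +kernel
  · rw [Kz.Kdim_q1 D hD _ (by norm_num)]; decide +kernel
  · rw [Kz.Kdim_q1 D hD _ (by norm_num)]; decide +kernel
  · rw [Kz.Kdim_q1 D hD _ (by norm_num)]; decide +kernel
  · rw [Kz.Kdim_q1 D hD _ (by norm_num)]; decide +kernel
  · rw [Kz.Kdim_q1 D hD _ (by norm_num)]; decide +kernel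
  · rw [Kz.Kdim_q1 D hD _ (by norm_num)]; decide +kernel
  · rw [Kz.Kdim_q1 D hD _ (by norm_num)]; decide +kernel
  · rw [Kz.Kdim_q1 D hD _ (by norm_num)]; decide +kernel
  · rw [Kz.Kdim_q1 D hD _ (by norm_num)]; decide +kernel
  · rw [Kz.Kdim_q1 D hD _ (by norm_num)]; decide +kernel
  · rw [Kz.Kdim_q2 D hD _ (by norm_num)]; decide +kernel
  · rw [Kz.Kdim_q2 D hD _ (by norm_num)]; decide +kernel
  · rw [Kz.Kdim_q2 D hD _ (by norm_num)]; decide +kernel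
end

section
/- (Empty relevant range in small cases) For every pair (d,b) with either 1 ≤ d ≤ 3 and 0 ≤ b ≤ d, or (d,b) ∈ {(4,0), (4,1)}: there is no pair of integers (p,q) with p ≥ 0 such that both K_{p,q}(ℙ²,b;d) ≠ 0 and K_{p+1,q−1}(ℙ²,b;d) ≠ 0; that is, all Betti numbers of S(b;d) are determined by its Hilbert series. -/
open scoped TensorProduct

set_option maxHeartbeats 2000000
set_option synthInstance.maxHeartbeats 1000000

noncomputable section

namespace VerK

/-- exponent vectors -/
abbrev X := Fin 3 →₀ ℕ

/-- Koszul sign -/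
def sgn (m : X) (A : Finset X) : ℂ := (-1) ^ (A.filter (fun a => toLex a < toLex m)).card

lemma sgn_sq (m : X) (A : Finset X) : sgn m A * sgn m A = 1 := by
  unfold sgn
  rw [← pow_add, ← two_mul, pow_mul]; simp

lemma sgn_ne (m : X) (A : Finset X) : sgn m A ≠ 0 := by
  intro h
  have := sgn_sq m A
  simp [h] at this

lemma sgn_insert {m n : X} {A : Finset X} (hn : n ∉ A) :
    sgn m (insert n A) = (if toLex n < toLex m then -1 else 1) * sgn m A := by
  unfold sgn
  rw [Finset.filter_insert]
  split_ifs with h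
  · rw [Finset.card_insert_of_notMem (by simp [hn]), pow_succ]; ring
  · simp

lemma sgn_anti {m n : X} {A : Finset X} (hm : m ∉ A) (hn : n ∉ A) (hmn : m ≠ n) :
    sgn m A * sgn n (insert m A) = - (sgn n A * sgn m (insert n A)) := by
  rw [sgn_insert hm, sgn_insert hn]
  rcases lt_trichotomy (toLex m) (toLex n) with h | h | h
  · rw [if_pos h, if_neg (not_lt.mpr h.le)]; ring
  · exact absurd (toLex.injective h) hmn
  · rw [if_pos h, if_neg (not_lt.mpr h.le)]; ring

/-- contraction -/
def ct (m : X) : (Finset X → ℂ) →ₗ[ℂ] (Finset X → ℂ) where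
  toFun f A := if m ∈ A then 0 else sgn m A * f (insert m A)
  map_add' f g := by ext A; simp only [Pi.add_apply]; split_ifs <;> simp [mul_add]
  map_smul' c f := by
    ext A; simp only [Pi.smul_apply, smul_eq_mul, RingHom.id_apply]; split_ifs <;> ring

lemma ct_apply (m : X) (f : Finset X → ℂ) (A : Finset X) :
    ct m f A = if m ∈ A then 0 else sgn m A * f (insert m A) := rfl

lemma ct_mem {m : X} {A : Finset X} (h : m ∈ A) (f : Finset X → ℂ) : ct m f A = 0 := by
  rw [ct_apply, if_pos h]

lemma ct_notMem {m : X} {A : Finset X} (h : m ∉ A) (f : Finset X → ℂ) :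
    ct m f A = sgn m A * f (insert m A) := by
  rw [ct_apply, if_neg h]

lemma ct_congr {m : X} {A : Finset X} {f g : Finset X → ℂ}
    (h : m ∉ A → f (insert m A) = g (insert m A)) : ct m f A = ct m g A := by
  rw [ct_apply, ct_apply]
  split_ifs with hm
  · rfl
  · rw [h hm]

lemma ct_anti (m n : X) (f : Finset X → ℂ) (A : Finset X) :
    ct m (ct n f) A = - ct n (ct m f) A := by
  by_cases hmn : m = n
  · subst hmn
    have : ct m (ct m f) A = 0 := by
      by_cases h : m ∈ A
      · rw [ct_mem h]
      · rw [ct_notMem h, ct_mem (Finset.mem_insert_self _ _), mul_zero]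
    rw [this, neg_zero]
  by_cases hm : m ∈ A
  · rw [ct_mem hm]
    by_cases hn : n ∈ A
    · rw [ct_mem hn, neg_zero]
    · rw [ct_notMem hn, ct_mem (Finset.mem_insert_of_mem hm), mul_zero, neg_zero]
  by_cases hn : n ∈ A
  · rw [ct_mem hn, ct_notMem hm, ct_mem (Finset.mem_insert_of_mem hn), mul_zero, neg_zero]
  rw [ct_notMem hm, ct_notMem hn, ct_notMem (by simp [hn, Ne.symm hmn]),
    ct_notMem (by simp [hm, hmn]), ← mul_assoc, ← mul_assoc, sgn_anti hm hn hmn,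
    Finset.insert_comm]
  ring

open Classical in
/-- Koszul differential in the monomial model -/
def bd (V : Finset X) (α : X → Finset X → ℂ) (v : X) : Finset X → ℂ :=
  ∑ m ∈ V with m ≤ v, ct m (α (v - m))

open Classical in
lemma bd_apply (V : Finset X) (α : X → Finset X → ℂ) (v : X) (A : Finset X) :
    bd V α v A = ∑ m ∈ V with m ≤ v, ct m (α (v - m)) A := by
  rw [bd, Finset.sum_apply]

open Classical in
lemma bd_apply' (V : Finset X) (α : X → Finset X → ℂ) (v : X) (A : Finset X) :
    bd V α v A = ∑ m ∈ V, if m ≤ v then ct m (α (v - m)) A else 0 := by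
  rw [bd_apply, Finset.sum_filter]

open Classical in
lemma ct_bd (t : X) (V : Finset X) (α : X → Finset X → ℂ) (v : X) (A : Finset X) :
    ct t (bd V α v) A = ∑ m ∈ V, if m ≤ v then ct t (ct m (α (v - m))) A else 0 := by
  rw [bd, map_sum, Finset.sum_apply, Finset.sum_filter]

lemma bd_bd (V : Finset X) (α : X → Finset X → ℂ) (v : X) (A : Finset X) :
    bd V (bd V α) v A = 0 := by
  classical
  have key : bd V (bd V α) v A = ∑ m ∈ V, ∑ n ∈ V,
      if m + n ≤ v then ct m (ct n (α (v - (m + n)))) A else 0 := by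
    rw [bd_apply']
    refine Finset.sum_congr rfl fun m _ => ?_
    split_ifs with h
    · rw [ct_bd]
      refine Finset.sum_congr rfl fun n _ => ?_
      rw [tsub_tsub]
      have : n ≤ v - m ↔ m + n ≤ v := by
        rw [add_comm]; exact le_tsub_iff_right h
      simp only [this]
    · symm
      refine Finset.sum_eq_zero fun n _ => ?_
      rw [if_neg]
      intro h'
      exact h (le_trans le_self_add h')
  have key2 : bd V (bd V α) v A = - bd V (bd V α) v A := by
    conv_lhs => rw [key, Finset.sum_comm]
    rw [key, ← Finset.sum_neg_distrib]
    refine Finset.sum_congr rfl fun m _ => ?_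
    rw [← Finset.sum_neg_distrib]
    refine Finset.sum_congr rfl fun n _ => ?_
    rw [add_comm n m, ct_anti]
    split_ifs <;> simp
  exact self_eq_neg.mp key2

/-- Exactness of the (truncated) Koszul complex at `⋀^p V ⊗ T_e`. -/
def Ex (V : Finset X) (T : Set X) (d p e : ℕ) : Prop :=
  ∀ α : X → Finset X → ℂ,
    (∀ v ∈ T, v.degree = e + d → ∀ A ⊆ V, A.card + 1 = p → bd V α v A = 0) →
    ∃ β : X → Finset X → ℂ, ∀ u ∈ T, u.degree = e → ∀ A ⊆ V, A.card = p → α u A = bd V β u A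

section red
variable {V : Finset X} {T : Set X} {d : ℕ} {t : X}

/-- `α` with the `t`-part replaced -/
def glue (t : X) (β γ : X → Finset X → ℂ) (w : X) (A : Finset X) : ℂ :=
  if t ∈ A then sgn t (A.erase t) * γ w (A.erase t) else β w A

lemma glue_notMem {β γ : X → Finset X → ℂ} {w : X} {A : Finset X} (h : t ∉ A) :
    glue t β γ w A = β w A := by simp [glue, h]

lemma ct_glue {β γ : X → Finset X → ℂ} {w : X} {A : Finset X} (h : t ∉ A) :
    ct t (glue t β γ w) A = γ w A := by
  rw [ct_notMem h, glue, if_pos (Finset.mem_insert_self _ _), Finset.erase_insert h, ← mul_assoc,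
    sgn_sq, one_mul]

open Classical in
lemma bd_split (ht : t ∈ V) (α : X → Finset X → ℂ) (v : X) (A : Finset X) :
    bd V α v A = bd (V.erase t) α v A + if t ≤ v then ct t (α (v - t)) A else 0 := by
  rw [bd_apply', bd_apply', Finset.sum_erase_add _ _ ht]

lemma bd_erase_glue {β γ : X → Finset X → ℂ} {v : X} {A : Finset X} (h : t ∉ A) :
    bd (V.erase t) (glue t β γ) v A = bd (V.erase t) β v A := by
  classical
  rw [bd_apply', bd_apply']
  refine Finset.sum_congr rfl fun m hm => ?_
  split_ifs
  · refine ct_congr fun _ => glue_notMem ?_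
    have := (Finset.mem_erase.mp hm).1
    simp [h, Ne.symm this]
  · rfl

lemma ct_bd_glue (ht : t ∈ V) {β γ : X → Finset X → ℂ} {v : X} {A : Finset X} (h : t ∉ A) :
    ct t (bd V (glue t β γ) v) A = - bd (V.erase t) γ v A := by
  classical
  rw [ct_bd, bd_apply', ← Finset.sum_erase_add _ _ ht, ← Finset.sum_neg_distrib]
  have h0 : (if t ≤ v then ct t (ct t (glue t β γ (v - t))) A else 0) = 0 := by
    split_ifs
    · rw [ct_notMem h, ct_mem (Finset.mem_insert_self _ _), mul_zero]
    · rfl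
  rw [h0, add_zero]
  refine Finset.sum_congr rfl fun m hm => ?_
  split_ifs
  · rw [ct_anti]
    congr 1
    refine ct_congr fun _ => ct_glue ?_
    have := (Finset.mem_erase.mp hm).1
    simp [h, Ne.symm this]
  · simp

lemma ct_eq_zero {f : Finset X → ℂ} {A : Finset X} (h : t ∉ A) (h0 : ct t f A = 0) :
    f (insert t A) = 0 := by
  rw [ct_notMem h] at h0
  exact (mul_eq_zero.mp h0).resolve_left (sgn_ne _ _)

lemma ct_eq_iff {f g : Finset X → ℂ} {A : Finset X} (h : t ∉ A) (h0 : ct t f A = ct t g A) :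
    f (insert t A) = g (insert t A) := by
  rw [ct_notMem h, ct_notMem h] at h0
  exact mul_left_cancel₀ (sgn_ne _ _) h0

theorem red_mpr (ht : t ∈ V) (hV : ∀ m ∈ V, m.degree = d)
    (hlow : ∀ v ∈ T, ∀ m, m ≤ v → v - m ∈ T) (hup : ∀ v ∈ T, v + t ∈ T) {p e : ℕ}
    (H : Ex (V.erase t) {v ∈ T | ¬ t ≤ v} d p e) : Ex V T d p e := by
  classical
  intro α hα
  have htd := hV t ht
  obtain ⟨β, hβ⟩ := H α (by
    intro v hv hvd A hA hAc
    have := hα v hv.1 hvd A (hA.trans (Finset.erase_subset _ _)) hAc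
    rw [bd_split ht, if_neg hv.2, add_zero] at this
    exact this)
  set γ : X → Finset X → ℂ := fun w A => α (w + t) A - bd (V.erase t) β (w + t) A with hγ
  have hαβ : ∀ u ∈ T, u.degree = e → ∀ A ⊆ V.erase t, A.card = p →
      α u A = bd (V.erase t) β u A + if t ≤ u then γ (u - t) A else 0 := by
    intro u hu hud A hA hAc
    split_ifs with h
    · simp only [hγ, tsub_add_cancel_of_le h]; ring
    · rw [hβ u ⟨hu, h⟩ hud A hA hAc, add_zero]
  refine ⟨glue t β γ, ?_⟩
  intro u hu hud A hA hAc
  by_cases htA : t ∈ A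
  · obtain ⟨A', hA', rfl⟩ : ∃ A', t ∉ A' ∧ A = insert t A' :=
      ⟨A.erase t, Finset.notMem_erase _ _, (Finset.insert_erase htA).symm⟩
    have hA'V : A' ⊆ V.erase t := fun x hx => Finset.mem_erase.mpr
      ⟨fun h => hA' (h ▸ hx), hA (Finset.mem_insert_of_mem hx)⟩
    rw [Finset.card_insert_of_notMem hA'] at hAc
    refine ct_eq_iff hA' ?_
    rw [ct_bd_glue ht hA']
    have h1 := hα (u + t) (hup u hu) (by rw [map_add, hud, htd]) A'
      (hA'V.trans (Finset.erase_subset _ _)) hAc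
    rw [bd_split ht, if_pos le_add_self, add_tsub_cancel_right] at h1
    have h2 : bd (V.erase t) α (u + t) A' = bd (V.erase t) (bd (V.erase t) β) (u + t) A' +
        bd (V.erase t) γ u A' := by
      rw [bd_apply', bd_apply', bd_apply', ← Finset.sum_add_distrib]
      refine Finset.sum_congr rfl fun m hm => ?_
      have hm' := Finset.mem_erase.mp hm
      by_cases hmut : m ≤ u + t
      · rw [if_pos hmut, if_pos hmut]
        by_cases hmA : m ∈ A'
        · simp [ct_mem hmA]
        rw [ct_notMem hmA, ct_notMem hmA, hαβ (u + t - m) (hlow _ (hup u hu) _ hmut)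
          (by
            have := congrArg Finsupp.degree (tsub_add_cancel_of_le hmut)
            rw [map_add, map_add, hud, htd, hV m hm'.2] at this
            omega) (insert m A') (Finset.insert_subset hm hA'V)
          (by rw [Finset.card_insert_of_notMem hmA, hAc]), mul_add]
        congr 1
        have hiff : t ≤ u + t - m ↔ m ≤ u := by
          rw [le_tsub_iff_right hmut, add_comm]
          exact add_le_add_iff_right t
        by_cases hmu : m ≤ u
        · rw [if_pos hmu, if_pos (hiff.mpr hmu), ct_notMem hmA]
          congr 2
          rw [tsub_right_comm, add_tsub_cancel_right]
        · rw [if_neg hmu, if_neg (fun h => hmu (hiff.mp h)), mul_zero]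
      · rw [if_neg hmut, if_neg hmut, if_neg (fun h => hmut (le_trans h le_self_add)), add_zero]
    rw [h2, bd_bd, zero_add] at h1
    linear_combination h1
  · have hA'V : A ⊆ V.erase t := fun x hx => Finset.mem_erase.mpr ⟨fun h => htA (h ▸ hx), hA hx⟩
    rw [bd_split ht, bd_erase_glue htA, ct_glue htA]
    exact hαβ u hu hud A hA'V hAc

theorem red_mp (ht : t ∈ V) (hV : ∀ m ∈ V, m.degree = d)
    (hlow : ∀ v ∈ T, ∀ m, m ≤ v → v - m ∈ T) (hup : ∀ v ∈ T, v + t ∈ T) {p e : ℕ}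
    (H : Ex V T d p e) : Ex (V.erase t) {v ∈ T | ¬ t ≤ v} d p e := by
  classical
  intro α hα
  have htd := hV t ht
  set γ : X → Finset X → ℂ := fun w A => - bd (V.erase t) α (w + t) A with hγ
  obtain ⟨β, hβ⟩ := H (glue t α γ) (by
    intro v hv hvd A hA hAc
    by_cases htA : t ∈ A
    · obtain ⟨A', hA', rfl⟩ : ∃ A', t ∉ A' ∧ A = insert t A' :=
        ⟨A.erase t, Finset.notMem_erase _ _, (Finset.insert_erase htA).symm⟩
      have hA'V : A' ⊆ V.erase t := fun x hx => Finset.mem_erase.mpr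
        ⟨fun h => hA' (h ▸ hx), hA (Finset.mem_insert_of_mem hx)⟩
      rw [Finset.card_insert_of_notMem hA'] at hAc
      refine ct_eq_zero hA' ?_
      rw [ct_bd_glue ht hA', neg_eq_zero]
      have h2 : bd (V.erase t) γ v A' = - bd (V.erase t) (bd (V.erase t) α) (v + t) A' := by
        rw [bd_apply', bd_apply', ← Finset.sum_neg_distrib]
        refine Finset.sum_congr rfl fun m hm => ?_
        have hm' := Finset.mem_erase.mp hm
        by_cases hmv : m ≤ v
        · rw [if_pos hmv, if_pos (hmv.trans le_self_add)]
          by_cases hmA : m ∈ A'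
          · simp [ct_mem hmA]
          rw [ct_notMem hmA, ct_notMem hmA, hγ]
          simp only
          rw [tsub_add_eq_add_tsub hmv]
          ring
        · rw [if_neg hmv]
          split_ifs with hmvt
          · by_cases hmA : m ∈ A'
            · simp [ct_mem hmA]
            rw [ct_notMem hmA, hα (v + t - m) ⟨hlow _ (hup v hv) _ hmvt, ?_⟩ ?_ (insert m A')
              (Finset.insert_subset hm hA'V) (by rw [Finset.card_insert_of_notMem hmA, hAc])]
            · simp
            · intro h
              rw [le_tsub_iff_right hmvt, add_comm] at h
              exact hmv ((add_le_add_iff_right t).mp h)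
            · have := congrArg Finsupp.degree (tsub_add_cancel_of_le hmvt)
              rw [map_add, map_add, hvd, htd, hV m hm'.2] at this
              omega
          · simp
      rw [h2, bd_bd, neg_zero]
    · have hA'V : A ⊆ V.erase t := fun x hx => Finset.mem_erase.mpr ⟨fun h => htA (h ▸ hx), hA hx⟩
      rw [bd_split ht, bd_erase_glue htA, ct_glue htA]
      split_ifs with h
      · simp only [hγ, tsub_add_cancel_of_le h]; ring
      · rw [hα v ⟨hv, h⟩ hvd A hA'V hAc, add_zero])
  refine ⟨β, ?_⟩
  intro u hu hud A hA hAc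
  have htA : t ∉ A := fun h => (Finset.notMem_erase t V) (hA h)
  have := hβ u hu.1 hud A (hA.trans (Finset.erase_subset _ _)) hAc
  rw [glue_notMem htA, bd_split ht, if_neg hu.2, add_zero] at this
  exact this

end red
end VerK

end

noncomputable section
namespace VerK

lemma finite_deg (e : ℕ) : {u : X | u.degree = e}.Finite := by
  have : {u : X | u.degree = e} ⊆ ((Finset.univ : Finset (Fin 3)).finsuppAntidiag e : Set X) := by
    intro u hu
    simp only [Finset.mem_coe, Finset.mem_finsuppAntidiag, Finset.subset_univ, and_true]
    rw [← Finsupp.degree_eq_sum]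
    exact hu
  exact (Finset.finite_toSet _).subset this

/-- degree `e` exponents -/
def mon (e : ℕ) : Finset X := (finite_deg e).toFinset

@[simp] lemma mem_mon {e : ℕ} {u : X} : u ∈ mon e ↔ u.degree = e := by simp [mon]

open Classical in
/-- the transposed differential -/
def tb (T : Set X) (w : X → Finset X → ℂ) (u : X) (B : Finset X) : ℂ :=
  ∑ m ∈ B, if u + m ∈ T then sgn m (B.erase m) * w (u + m) (B.erase m) else 0

open Classical in
/-- index set -/
def idx (V : Finset X) (T : Set X) (p e : ℕ) : Finset (X × Finset X) :=
  ((mon e).filter (· ∈ T)) ×ˢ V.powersetCard p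

lemma mem_idx {V : Finset X} {T : Set X} {p e : ℕ} {x : X × Finset X} :
    x ∈ idx V T p e ↔ (x.1.degree = e ∧ x.1 ∈ T) ∧ x.2 ⊆ V ∧ x.2.card = p := by
  simp [idx, Finset.mem_powersetCard]

section
variable {V : Finset X} {T : Set X} {d : ℕ}

theorem adj (hV : ∀ m ∈ V, m.degree = d) (hlow : ∀ v ∈ T, ∀ m, m ≤ v → v - m ∈ T)
    (k e : ℕ) (z α : X → Finset X → ℂ) :
    ∑ x ∈ idx V T k (e + d), z x.1 x.2 * bd V α x.1 x.2 =
      ∑ y ∈ idx V T (k + 1) e, tb T z y.1 y.2 * α y.1 y.2 := by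
  classical
  have h1 : ∑ x ∈ idx V T k (e + d), z x.1 x.2 * bd V α x.1 x.2 =
      ∑ y ∈ (idx V T k (e + d) ×ˢ V).filter (fun y => y.2 ≤ y.1.1 ∧ y.2 ∉ y.1.2),
        z y.1.1 y.1.2 * (sgn y.2 y.1.2 * α (y.1.1 - y.2) (insert y.2 y.1.2)) := by
    rw [Finset.sum_filter, Finset.sum_product]
    refine Finset.sum_congr rfl fun x _ => ?_
    rw [bd_apply', Finset.mul_sum]
    refine Finset.sum_congr rfl fun m _ => ?_
    by_cases h : m ≤ x.1
    · by_cases h' : m ∈ x.2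
      · simp [h, h', ct_mem h']
      · simp [h, h', ct_notMem h']
    · simp [h]
  have h2 : ∑ y ∈ idx V T (k + 1) e, tb T z y.1 y.2 * α y.1 y.2 =
      ∑ y ∈ (idx V T (k + 1) e ×ˢ V).filter (fun y => y.2 ∈ y.1.2 ∧ y.1.1 + y.2 ∈ T),
        sgn y.2 (y.1.2.erase y.2) * z (y.1.1 + y.2) (y.1.2.erase y.2) * α y.1.1 y.1.2 := by
    rw [Finset.sum_filter, Finset.sum_product]
    refine Finset.sum_congr rfl fun x hx => ?_
    rw [tb, Finset.sum_mul]
    have hxV := (mem_idx.mp hx).2.1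
    rw [← Finset.sum_subset hxV]
    · refine Finset.sum_congr rfl fun m hm => ?_
      simp only [hm, true_and]
      split_ifs <;> simp
    · intro m _ hm
      simp [hm]
  rw [h1, h2]
  refine Finset.sum_nbij' (fun y => ((y.1.1 - y.2, insert y.2 y.1.2), y.2))
    (fun y => ((y.1.1 + y.2, y.1.2.erase y.2), y.2)) ?_ ?_ ?_ ?_ ?_
  · rintro ⟨⟨v, A⟩, m⟩ h
    simp only [Finset.mem_filter, Finset.mem_product, mem_idx] at h ⊢
    obtain ⟨⟨⟨⟨hd, hT⟩, hAV, hc⟩, hm⟩, hle, hmA⟩ := h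
    refine ⟨⟨⟨⟨?_, hlow _ hT _ hle⟩, Finset.insert_subset hm hAV, ?_⟩, hm⟩,
      Finset.mem_insert_self _ _, ?_⟩
    · have := congrArg Finsupp.degree (tsub_add_cancel_of_le hle)
      rw [map_add, hd, hV m hm] at this
      omega
    · rw [Finset.card_insert_of_notMem hmA, hc]
    · rw [tsub_add_cancel_of_le hle]; exact hT
  · rintro ⟨⟨v, A⟩, m⟩ h
    simp only [Finset.mem_filter, Finset.mem_product, mem_idx] at h ⊢
    obtain ⟨⟨⟨⟨hd, hT⟩, hAV, hc⟩, hm⟩, hmA, hle⟩ := h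
    refine ⟨⟨⟨⟨?_, hle⟩, (Finset.erase_subset _ _).trans hAV, ?_⟩, hm⟩,
      le_add_self, Finset.notMem_erase _ _⟩
    · rw [map_add, hd, hV m hm]
    · rw [Finset.card_erase_of_mem hmA, hc]; rfl
  · rintro ⟨⟨v, A⟩, m⟩ h
    simp only [Finset.mem_filter, Finset.mem_product, mem_idx] at h ⊢
    obtain ⟨⟨⟨⟨hd, hT⟩, hAV, hc⟩, hm⟩, hle, hmA⟩ := h
    rw [tsub_add_cancel_of_le hle, Finset.erase_insert hmA]
  · rintro ⟨⟨v, A⟩, m⟩ h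
    simp only [Finset.mem_filter, Finset.mem_product, mem_idx] at h ⊢
    obtain ⟨⟨⟨⟨hd, hT⟩, hAV, hc⟩, hm⟩, hmA, hle⟩ := h
    rw [add_tsub_cancel_right, Finset.insert_erase hmA]
  · rintro ⟨⟨v, A⟩, m⟩ h
    simp only [Finset.mem_filter, Finset.mem_product, mem_idx] at h ⊢
    obtain ⟨⟨⟨⟨hd, hT⟩, hAV, hc⟩, hm⟩, hle, hmA⟩ := h
    rw [tsub_add_cancel_of_le hle, Finset.erase_insert hmA]
    ring

lemma bd_add (V : Finset X) (α β : X → Finset X → ℂ) (v : X) :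
    bd V (α + β) v = bd V α v + bd V β v := by
  classical
  simp only [bd, Pi.add_apply, map_add, Finset.sum_add_distrib]

lemma bd_smul (V : Finset X) (c : ℂ) (α : X → Finset X → ℂ) (v : X) :
    bd V (c • α) v = c • bd V α v := by
  classical
  simp only [bd, Pi.smul_apply, map_smul, Finset.smul_sum]

theorem transp (hV : ∀ m ∈ V, m.degree = d) (hlow : ∀ v ∈ T, ∀ m, m ≤ v → v - m ∈ T)
    {p e : ℕ}
    (H : ∀ w : X → Finset X → ℂ,
      (∀ u ∈ T, u.degree + d = e → ∀ B ⊆ V, B.card = p + 1 → tb T w u B = 0) →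
      ∃ z : X → Finset X → ℂ, ∀ u ∈ T, u.degree = e → ∀ A ⊆ V, A.card = p →
        w u A = tb T z u A) : Ex V T d p e := by
  classical
  intro α hα
  let f : (X → Finset X → ℂ) →ₗ[ℂ] (idx V T p e → ℂ) :=
    { toFun := fun β i => bd V β i.1.1 i.1.2
      map_add' := fun a b => by ext i; simp [bd_add]
      map_smul' := fun c a => by ext i; simp [bd_smul] }
  by_cases hmem : (fun i : idx V T p e => α i.1.1 i.1.2) ∈ LinearMap.range f
  · obtain ⟨β, hβ⟩ := hmem
    refine ⟨β, fun u hu hud A hA hAc => ?_⟩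
    have := congrFun hβ ⟨(u, A), mem_idx.mpr ⟨⟨hud, hu⟩, hA, hAc⟩⟩
    exact this.symm
  exfalso
  obtain ⟨φ, hφ, hker⟩ := Submodule.exists_le_ker_of_notMem hmem
  let w : X → Finset X → ℂ := fun u A =>
    if h : (u, A) ∈ idx V T p e then φ (Pi.single ⟨(u, A), h⟩ 1) else 0
  have hw : ∀ g : X → Finset X → ℂ, φ (fun i : idx V T p e => g i.1.1 i.1.2) =
      ∑ x ∈ idx V T p e, w x.1 x.2 * g x.1 x.2 := by
    intro g
    rw [← Finset.sum_coe_sort]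
    have : (fun i : idx V T p e => g i.1.1 i.1.2) =
        ∑ i : idx V T p e, (g i.1.1 i.1.2) • (Pi.single i (1 : ℂ)) := by
      ext j
      simp [Finset.sum_apply, Pi.single_apply]
    rw [this, map_sum]
    refine Finset.sum_congr rfl fun i _ => ?_
    rw [map_smul, smul_eq_mul, mul_comm]
    congr 1
    simp only [w]
    rw [dif_pos i.2]
  obtain ⟨z, hz⟩ := H w (by
    intro u hu hud B hB hBc
    have h1 : φ (f (Pi.single u (Pi.single B 1))) = 0 :=
      hker (LinearMap.mem_range_self f _)
    have h2 := hw (bd V (Pi.single u (Pi.single B 1)))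
    rw [show (fun i : idx V T p e => bd V (Pi.single u (Pi.single B 1)) i.1.1 i.1.2) =
      f (Pi.single u (Pi.single B 1)) from rfl, h1, ← hud, adj hV hlow,
      Finset.sum_eq_single (u, B)] at h2
    · simpa using h2.symm
    · rintro ⟨u', B'⟩ _ hne
      by_cases h : u' = u
      · subst h
        have : B' ≠ B := fun h => hne (by rw [h])
        simp [this]
      · simp [h]
    · intro h
      refine absurd ?_ h
      rw [mem_idx]
      exact ⟨⟨rfl, hu⟩, hB, hBc⟩)
  apply hφ
  rw [hw α]
  have h3 : ∑ x ∈ idx V T p e, w x.1 x.2 * α x.1 x.2 =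
      ∑ x ∈ idx V T p e, tb T z x.1 x.2 * α x.1 x.2 := by
    refine Finset.sum_congr rfl fun x hx => ?_
    have hx' := mem_idx.mp hx
    rw [hz x.1 hx'.1.2 hx'.1.1 x.2 hx'.2.1 hx'.2.2]
  rw [h3]
  cases p with
  | zero =>
    refine Finset.sum_eq_zero fun x hx => ?_
    have hx' := mem_idx.mp hx
    have : x.2 = ∅ := Finset.card_eq_zero.mp hx'.2.2
    rw [this]
    simp [tb]
  | succ k =>
    rw [← adj hV hlow]
    refine Finset.sum_eq_zero fun x hx => ?_
    have hx' := mem_idx.mp hx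
    rw [hα x.1 hx'.1.2 hx'.1.1 x.2 hx'.2.1 (by rw [hx'.2.2]), mul_zero]

/-- sign of `m` in `V` -/
def eps (V A : Finset X) : ℂ := ∏ a ∈ A, sgn a V

lemma eps_sq (V A : Finset X) : eps V A * eps V A = 1 := by
  rw [eps, ← Finset.prod_mul_distrib]
  exact Finset.prod_eq_one fun a _ => sgn_sq _ _

lemma sgn_compl {m : X} {A : Finset X} (hA : A ⊆ V) :
    sgn m (V \ insert m A) = sgn m V * sgn m A := by
  classical
  unfold sgn
  have h1 : (V.filter (fun a => toLex a < toLex m)).card =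
      ((V \ insert m A).filter (fun a => toLex a < toLex m)).card +
      (A.filter (fun a => toLex a < toLex m)).card := by
    rw [← Finset.card_union_of_disjoint]
    · congr 1
      ext x
      simp only [Finset.mem_filter, Finset.mem_union, Finset.mem_sdiff, Finset.mem_insert]
      constructor
      · rintro ⟨hx, hlt⟩
        by_cases hxA : x ∈ A
        · exact Or.inr ⟨hxA, hlt⟩
        · refine Or.inl ⟨⟨hx, ?_⟩, hlt⟩
          rintro (rfl | h)
          · exact lt_irrefl _ hlt
          · exact hxA h
      · rintro (⟨⟨hx, _⟩, hlt⟩ | ⟨hx, hlt⟩)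
        · exact ⟨hx, hlt⟩
        · exact ⟨hA hx, hlt⟩
    · rw [Finset.disjoint_left]
      intro x hx hx'
      simp only [Finset.mem_filter, Finset.mem_sdiff, Finset.mem_insert] at hx hx'
      exact hx.1.2 (Or.inr hx'.1)
  rw [h1, pow_add, mul_assoc, ← pow_add, ← two_mul, pow_mul]
  simp

/-- complement -/
def cpl (V : Finset X) (τ : X) (z : X → Finset X → ℂ) (u : X) (A : Finset X) : ℂ :=
  eps V A * z (τ - u) (V \ A)

lemma bd_cpl {τ : X} (z : X → Finset X → ℂ) {v : X} {A : Finset X} (hv : v ≤ τ) (hA : A ⊆ V) :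
    bd V (cpl V τ z) v A = eps V A * tb (Set.Iic τ) z (τ - v) (V \ A) := by
  classical
  rw [bd_apply', tb, Finset.mul_sum, ← Finset.sum_subset (Finset.sdiff_subset : V \ A ⊆ V)]
  · refine Finset.sum_congr rfl fun m hm => ?_
    obtain ⟨hmV, hmA⟩ := Finset.mem_sdiff.mp hm
    have hiff : τ - v + m ∈ Set.Iic τ ↔ m ≤ v := by
      rw [Set.mem_Iic]
      constructor
      · intro h i
        have h1 := h i
        have h2 := hv i
        simp only [Finsupp.add_apply, Finsupp.tsub_apply] at h1
        omega
      · intro h i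
        have h1 := h i
        have h2 := hv i
        simp only [Finsupp.add_apply, Finsupp.tsub_apply]
        omega
    by_cases hmv : m ≤ v
    · rw [if_pos hmv, if_pos (hiff.mpr hmv), ct_notMem hmA, cpl]
      have e1 : τ - (v - m) = τ - v + m := by
        ext i
        have h1 := hmv i
        have h2 := hv i
        simp only [Finsupp.add_apply, Finsupp.tsub_apply]
        omega
      have e2 : (V \ A).erase m = V \ insert m A := by
        ext x; simp; tauto
      rw [e1, e2, sgn_compl hA, eps, Finset.prod_insert hmA, ← eps]
      ring
    · rw [if_neg hmv, if_neg (fun h => hmv (hiff.mp h)), mul_zero]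
  · intro m hm hm'
    have : m ∈ A := by
      by_contra h
      exact hm' (Finset.mem_sdiff.mpr ⟨hm, h⟩)
    simp [ct_mem this]

theorem dual (hV : ∀ m ∈ V, m.degree = d) {τ : X} {p e p' e' : ℕ} (hp : p + p' = V.card)
    (he : e + e' = τ.degree) (H : Ex V (Set.Iic τ) d p' e') : Ex V (Set.Iic τ) d p e := by
  classical
  have hdeg : ∀ v ≤ τ, (τ - v).degree + v.degree = e + e' := by
    intro v hv
    rw [he, ← map_add, tsub_add_cancel_of_le hv]
  refine transp hV (fun v hv m _ => Set.mem_Iic.mpr (tsub_le_self.trans (Set.mem_Iic.mp hv))) fun w hw => ?_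
  obtain ⟨β, hβ⟩ := H (cpl V τ w) (by
    intro v hv hvd A hA hAc
    rw [bd_cpl w hv hA, hw (τ - v) (Set.mem_Iic.mpr tsub_le_self) ?_ (V \ A) Finset.sdiff_subset ?_, mul_zero]
    · have := hdeg v hv
      omega
    · rw [Finset.card_sdiff_of_subset hA]; omega)
  refine ⟨fun v A => eps V (V \ A) * β (τ - v) (V \ A), ?_⟩
  intro u hu hud A hA hAc
  have hu' : τ - (τ - u) = u := tsub_tsub_cancel_of_le hu
  have hA' : V \ (V \ A) = A := Finset.sdiff_sdiff_eq_self hA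
  have h1 := hβ (τ - u) (Set.mem_Iic.mpr tsub_le_self) (by have := hdeg u hu; omega) (V \ A) Finset.sdiff_subset
    (by rw [Finset.card_sdiff_of_subset hA]; omega)
  have h2 : bd V β (τ - u) (V \ A) =
      bd V (cpl V τ (fun v A => eps V (V \ A) * β (τ - v) (V \ A))) (τ - u) (V \ A) := by
    rw [bd_apply', bd_apply']
    refine Finset.sum_congr rfl fun m hm => ?_
    split_ifs with h
    · refine ct_congr fun _ => ?_
      have h3 : insert m (V \ A) ⊆ V := Finset.insert_subset hm Finset.sdiff_subset
      simp only [cpl]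
      rw [Finset.sdiff_sdiff_eq_self h3, tsub_tsub_cancel_of_le (tsub_le_self.trans tsub_le_self),
        ← mul_assoc, eps_sq, one_mul]
    · rfl
  rw [h2, bd_cpl _ tsub_le_self Finset.sdiff_subset, hu', hA', cpl, hu', hA'] at h1
  have h4 : eps V (V \ A) ≠ 0 := by
    intro h
    have := eps_sq V (V \ A)
    simp [h] at this
  exact mul_left_cancel₀ h4 h1

end
end VerK

end

noncomputable section
namespace VerK

/-- full exactness -/
def Full (d p e : ℕ) : Prop := Ex (mon d) Set.univ d p e

/-- pure powers -/
def tt (d : ℕ) (i : Fin 3) : X := Finsupp.single i d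

lemma tt_le {d : ℕ} {i : Fin 3} {v : X} : tt d i ≤ v ↔ d ≤ v i := by
  rw [tt, Finsupp.single_le_iff]

lemma deg_tt (d : ℕ) (i : Fin 3) : (tt d i).degree = d := by simp [tt]

lemma tt_ne {d : ℕ} (hd : 1 ≤ d) {i j : Fin 3} (h : i ≠ j) : tt d i ≠ tt d j := by
  intro h'
  have := DFunLike.congr_fun h' i
  simp [tt, h.symm] at this
  omega

/-- reduced variables -/
def VR (d : ℕ) : Finset X := (((mon d).erase (tt d 0)).erase (tt d 1)).erase (tt d 2)

/-- top exponent -/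
def tau (d : ℕ) : X := Finsupp.equivFunOnFinite.symm (fun _ => d - 1)

lemma deg_tau (d : ℕ) : (tau d).degree = 3 * (d - 1) := by
  rw [Finsupp.degree_eq_sum]
  simp [tau]

lemma TR_eq {d : ℕ} (hd : 1 ≤ d) :
    {v ∈ {v ∈ {v ∈ (Set.univ : Set X) | ¬ tt d 0 ≤ v} | ¬ tt d 1 ≤ v} | ¬ tt d 2 ≤ v}
      = Set.Iic (tau d) := by
  ext v
  have h1 : v ≤ tau d ↔ v 0 ≤ d - 1 ∧ v 1 ≤ d - 1 ∧ v 2 ≤ d - 1 := by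
    rw [Finsupp.le_def, Fin.forall_fin_succ, Fin.forall_fin_succ, Fin.forall_fin_succ]
    simp [tau]
  simp only [Set.mem_ofPred_eq, Set.mem_univ, true_and, tt_le, Set.mem_Iic, h1]
  omega

lemma VR_deg {d : ℕ} : ∀ m ∈ VR d, m.degree = d := by
  intro m hm
  simp only [VR, Finset.mem_erase, mem_mon] at hm
  exact hm.2.2.2

theorem full_iff {d : ℕ} (hd : 1 ≤ d) (p e : ℕ) :
    Full d p e ↔ Ex (VR d) (Set.Iic (tau d)) d p e := by
  have A0 : tt d 0 ∈ mon d := by simp [deg_tt]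
  have A1 : tt d 1 ∈ (mon d).erase (tt d 0) := by
    simp [deg_tt, tt_ne hd (show (1 : Fin 3) ≠ 0 by decide)]
  have A2 : tt d 2 ∈ ((mon d).erase (tt d 0)).erase (tt d 1) := by
    simp [deg_tt, tt_ne hd (show (2 : Fin 3) ≠ 0 by decide),
      tt_ne hd (show (2 : Fin 3) ≠ 1 by decide)]
  have B0 : ∀ m ∈ mon d, m.degree = d := fun m hm => mem_mon.mp hm
  have B1 : ∀ m ∈ (mon d).erase (tt d 0), m.degree = d := fun m hm =>
    B0 m (Finset.mem_of_mem_erase hm)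
  have B2 : ∀ m ∈ ((mon d).erase (tt d 0)).erase (tt d 1), m.degree = d := fun m hm =>
    B1 m (Finset.mem_of_mem_erase hm)
  have C : ∀ (T : Set X) (i : Fin 3), (∀ v ∈ T, ∀ m, m ≤ v → v - m ∈ T) →
      ∀ v ∈ {v ∈ T | ¬ tt d i ≤ v}, ∀ m, m ≤ v → v - m ∈ {v ∈ T | ¬ tt d i ≤ v} := by
    intro T i hT v hv m hm
    exact ⟨hT v hv.1 m hm, fun h => hv.2 (h.trans tsub_le_self)⟩
  have C0 : ∀ v ∈ (Set.univ : Set X), ∀ m, m ≤ v → v - m ∈ (Set.univ : Set X) := by simp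
  have C1 := C _ 0 C0
  have C2 := C _ 1 C1
  have D0 : ∀ v ∈ (Set.univ : Set X), v + tt d 0 ∈ (Set.univ : Set X) := by simp
  have D1 : ∀ v ∈ {v ∈ (Set.univ : Set X) | ¬ tt d 0 ≤ v},
      v + tt d 1 ∈ {v ∈ (Set.univ : Set X) | ¬ tt d 0 ≤ v} := by
    intro v hv
    simp only [Set.mem_ofPred_eq, Set.mem_univ, true_and, tt_le] at hv ⊢
    simpa [tt] using hv
  have D2 : ∀ v ∈ {v ∈ {v ∈ (Set.univ : Set X) | ¬ tt d 0 ≤ v} | ¬ tt d 1 ≤ v},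
      v + tt d 2 ∈ {v ∈ {v ∈ (Set.univ : Set X) | ¬ tt d 0 ≤ v} | ¬ tt d 1 ≤ v} := by
    intro v hv
    simp only [Set.mem_ofPred_eq, Set.mem_univ, true_and, tt_le] at hv ⊢
    simpa [tt] using hv
  rw [← TR_eq hd]
  constructor
  · intro h
    exact red_mp A2 B2 C2 D2 (red_mp A1 B1 C1 D1 (red_mp A0 B0 C0 D0 h))
  · intro h
    exact red_mpr A0 B0 C0 D0 (red_mpr A1 B1 C1 D1 (red_mpr A2 B2 C2 D2 h))

theorem full_dual {d : ℕ} (hd : 1 ≤ d) {p e p' e' : ℕ} (hp : p + p' = (VR d).card)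
    (he : e + e' = 3 * (d - 1)) (H : Full d p' e') : Full d p e := by
  rw [full_iff hd] at H ⊢
  exact dual VR_deg hp (by rw [he, deg_tau]) H

theorem full_big_p {d : ℕ} (hd : 1 ≤ d) {p e : ℕ} (hp : (VR d).card < p) : Full d p e := by
  rw [full_iff hd]
  intro α _
  refine ⟨0, fun u _ _ A hA hAc => ?_⟩
  have := Finset.card_le_card hA
  omega

theorem full_big_e {d : ℕ} (hd : 1 ≤ d) {p e : ℕ} (he : 3 * (d - 1) < e) : Full d p e := by
  rw [full_iff hd]
  intro α _
  refine ⟨0, fun u hu hud A hA hAc => ?_⟩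
  have := Finsupp.degree_mono (Set.mem_Iic.mp hu)
  rw [deg_tau] at this
  omega

theorem full_e0 {d : ℕ} (p : ℕ) : Full d (p + 1) 0 := by
  classical
  intro α hα
  refine ⟨0, fun u hu hud A hA hAc => ?_⟩
  have hu0 : u = 0 := (Finsupp.degree_eq_zero_iff u).mp hud
  subst hu0
  have h0 : bd (mon d) 0 0 A = 0 := by
    rw [bd_apply]
    exact Finset.sum_eq_zero fun m _ => by simp
  rw [h0]
  obtain ⟨a, ha⟩ : A.Nonempty := Finset.card_pos.mp (by omega)
  have had : a.degree = d := mem_mon.mp (hA ha)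
  have h1 := hα a (Set.mem_univ _) (by rw [had, zero_add]) (A.erase a)
    ((Finset.erase_subset _ _).trans hA) (by rw [Finset.card_erase_of_mem ha, hAc]; rfl)
  rw [bd_apply, Finset.sum_eq_single a] at h1
  · rw [tsub_self] at h1
    have := ct_eq_zero (Finset.notMem_erase _ _) h1
    rwa [Finset.insert_erase ha] at this
  · intro m hm hma
    simp only [Finset.mem_filter, mem_mon] at hm
    exfalso
    apply hma
    have h2 := congrArg Finsupp.degree (tsub_add_cancel_of_le hm.2)
    rw [map_add, hm.1, had] at h2
    have h3 : a - m = 0 := (Finsupp.degree_eq_zero_iff _).mp (by omega)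
    exact le_antisymm hm.2 (tsub_eq_zero_iff_le.mp h3)
  · intro h
    exfalso
    apply h
    simp [had]

lemma exists_pos {u : X} (h : u.degree ≠ 0) : ∃ i, 1 ≤ u i := by
  by_contra hc
  push Not at hc
  apply h
  rw [Finsupp.degree_eq_zero_iff]
  ext i
  have := hc i
  simp; omega

lemma exists_sub (u : X) (k : ℕ) (h : k ≤ u.degree) : ∃ m ≤ u, m.degree = k := by
  induction k with
  | zero => exact ⟨0, zero_le, by simp⟩
  | succ k ih =>
    obtain ⟨m, hm, hmk⟩ := ih (by omega)
    have h1 := congrArg Finsupp.degree (tsub_add_cancel_of_le hm)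
    rw [map_add] at h1
    obtain ⟨i, hi⟩ := exists_pos (u := u - m) (by omega)
    refine ⟨m + Finsupp.single i 1, ?_, by rw [map_add, hmk]; simp⟩
    have h2 : Finsupp.single i 1 ≤ u - m := by rw [Finsupp.single_le_iff]; exact hi
    rw [add_comm]
    exact (le_tsub_iff_right hm).mp h2

theorem full_01 {d : ℕ} : Full d 0 (d + 1) := by
  classical
  refine transp (fun m hm => mem_mon.mp hm) (by simp) fun w hw => ⟨0, fun u _ hud A hA hAc => ?_⟩
  have hA0 : A = ∅ := Finset.card_eq_zero.mp hAc
  subst hA0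
  obtain ⟨m, hm, hmd⟩ := exists_sub u d (by omega)
  have h1 := congrArg Finsupp.degree (tsub_add_cancel_of_le hm)
  rw [map_add] at h1
  have := hw (u - m) (Set.mem_univ _) (by omega) {m} (by simp [hmd]) (by simp)
  simp only [tb, Set.mem_univ, if_true, Finset.sum_singleton, tsub_add_cancel_of_le hm] at this
  have h3 : ({m} : Finset X).erase m = ∅ := by simp
  rw [h3] at this
  rw [(mul_eq_zero.mp this).resolve_left (sgn_ne _ _)]
  simp [tb]

lemma conn {d : ℕ} {x : X} (hx : x.degree = 2 * d + 1) (h : X → ℂ)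
    (hh : ∀ m n, m.degree = d → n.degree = d → m + n ≤ x → h m = h n) :
    ∀ (k : ℕ) (m m' : X), (m' - m).degree = k → m.degree = d → m'.degree = d → m ≤ x → m' ≤ x →
      h m = h m' := by
  intro k
  induction k using Nat.strong_induction_on with
  | _ k ih =>
    intro m m' hk hm hm' hmx hmx'
    by_cases hle : m' ≤ m
    · have h2 := congrArg Finsupp.degree (tsub_add_cancel_of_le hle)
      rw [map_add] at h2
      have h3 : m - m' = 0 := (Finsupp.degree_eq_zero_iff _).mp (by omega)
      rw [le_antisymm (tsub_eq_zero_iff_le.mp h3) hle]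
    have hle' : ¬ m ≤ m' := by
      intro hle'
      have h2 := congrArg Finsupp.degree (tsub_add_cancel_of_le hle')
      rw [map_add] at h2
      have h3 : m' - m = 0 := (Finsupp.degree_eq_zero_iff _).mp (by omega)
      exact hle (tsub_eq_zero_iff_le.mp h3)
    rw [Finsupp.le_def] at hle hle'
    push Not at hle hle'
    obtain ⟨i, hi⟩ := hle
    obtain ⟨j, hj⟩ := hle'
    have hij : i ≠ j := by rintro rfl; omega
    have hjm : Finsupp.single j 1 ≤ m := by rw [Finsupp.single_le_iff]; omega
    have him : Finsupp.single i 1 ≤ m' - m := by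
      rw [Finsupp.single_le_iff, Finsupp.tsub_apply]; omega
    set n : X := m - Finsupp.single j 1 + Finsupp.single i 1 with hn
    have hnd : n.degree = d := by
      have h2 := congrArg Finsupp.degree (tsub_add_cancel_of_le hjm)
      rw [map_add, Finsupp.degree_single] at h2
      rw [hn, map_add, Finsupp.degree_single]; omega
    have hmi : m + Finsupp.single i 1 ≤ x := by
      intro l
      have h1 := hmx l
      have h2 := hmx' l
      by_cases hl : i = l
      · subst hl; simp; omega
      · simp [Finsupp.single_apply, hl]; omega
    have hnx : n ≤ x := by
      refine le_trans ?_ hmi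
      rw [hn]
      exact add_le_add_left tsub_le_self _
    have hnm : m' - n + Finsupp.single i 1 = m' - m := by
      ext l
      by_cases hl : i = l
      · subst hl
        simp [hn, hij.symm]; omega
      · by_cases hl' : j = l
        · subst hl'
          simp [hn, hij]; omega
        · simp [hn, hl, hl']
    have h5 := congrArg Finsupp.degree hnm
    rw [map_add, Finsupp.degree_single, hk] at h5
    rw [← ih (m' - n).degree (by omega) n m' rfl hnd hm' hnx hmx']
    have h6 := congrArg Finsupp.degree (tsub_add_cancel_of_le hmi)
    rw [map_add, map_add, Finsupp.degree_single] at h6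
    have hkd : (x - (m + Finsupp.single i 1)).degree = d := by omega
    rw [hh m (x - (m + Finsupp.single i 1)) hm hkd, hh n (x - (m + Finsupp.single i 1)) hnd hkd]
    · intro l
      have h1 := hmi l
      have h2 := hjm l
      simp only [hn, Finsupp.add_apply, Finsupp.tsub_apply] at h1 h2 ⊢
      omega
    · intro l
      have h1 := hmi l
      simp only [Finsupp.add_apply, Finsupp.tsub_apply] at h1 ⊢
      omega

theorem full_11 {d : ℕ} : Full d 1 (d + 1) := by
  classical
  refine transp (fun m hm => mem_mon.mp hm) (by simp) fun w hw => ?_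
  have key : ∀ x : X, x.degree = 2 * d + 1 → ∀ m m' : X, m.degree = d → m'.degree = d →
      m ≤ x → m' ≤ x → w (x - m) {m} = w (x - m') {m'} := by
    intro x hx m m' hm hm' hmx hmx'
    refine conn hx (fun m => w (x - m) {m}) ?_ _ m m' rfl hm hm' hmx hmx'
    intro m n hm hn hmn
    by_cases hne : m = n
    · rw [hne]
    have h1 := congrArg Finsupp.degree (tsub_add_cancel_of_le hmn)
    rw [map_add, map_add] at h1
    have h2 := hw (x - (m + n)) (Set.mem_univ _) (by omega) {m, n}
      (by intro y hy; simp at hy; rcases hy with rfl | rfl <;> simp [hm, hn])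
      (Finset.card_pair hne)
    simp only [tb, Set.mem_univ, if_true] at h2
    rw [Finset.sum_pair hne] at h2
    have e1 : ({m, n} : Finset X).erase m = {n} := by
      ext y; simp; rintro rfl; exact fun h => by simp_all
    have e2 : ({m, n} : Finset X).erase n = {m} := by
      ext y; simp; constructor
      · tauto
      · rintro rfl; exact ⟨hne, Or.inl rfl⟩
    have e3 : x - (m + n) + m = x - n := by
      ext l
      have := hmn l
      simp only [Finsupp.add_apply, Finsupp.tsub_apply] at this ⊢
      omega
    have e4 : x - (m + n) + n = x - m := by
      ext l
      have := hmn l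
      simp only [Finsupp.add_apply, Finsupp.tsub_apply] at this ⊢
      omega
    rw [e1, e2, e3, e4] at h2
    have h3 := sgn_anti (A := ∅) (m := m) (n := n) (by simp) (by simp) hne
    have h4 : ∀ y, sgn y ∅ = 1 := by intro y; simp [sgn]
    simp only [h4, one_mul] at h3
    have e5 : (insert m ∅ : Finset X) = {m} := rfl
    have e6 : (insert n ∅ : Finset X) = {n} := rfl
    rw [e5, e6] at h3
    rw [h3] at h2
    refine mul_left_cancel₀ (sgn_ne m {n}) ?_
    show sgn m {n} * w (x - m) {m} = sgn m {n} * w (x - n) {n}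
    linear_combination -h2
  let ch : X → X := fun x => if h : d ≤ x.degree then (exists_sub x d h).choose else 0
  refine ⟨fun x _ => w (x - ch x) {ch x}, fun u _ hud A hA hAc => ?_⟩
  obtain ⟨m, rfl⟩ := Finset.card_eq_one.mp hAc
  have hm : m.degree = d := mem_mon.mp (hA (Finset.mem_singleton_self m))
  simp only [tb, Set.mem_univ, if_true, Finset.sum_singleton]
  have h3 : ({m} : Finset X).erase m = ∅ := by simp
  have h4 : sgn m ∅ = 1 := by simp [sgn]
  rw [h3, h4, one_mul]
  have hdeg : (u + m).degree = 2 * d + 1 := by rw [map_add, hud, hm]; ring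
  have hch : ch (u + m) ≤ u + m ∧ (ch (u + m)).degree = d := by
    have h : d ≤ (u + m).degree := by omega
    simp only [ch]
    rw [dif_pos h]
    exact (exists_sub (u + m) d h).choose_spec
  have := key (u + m) hdeg m (ch (u + m)) hm hch.2 le_add_self hch.1
  rw [← this, add_tsub_cancel_right]
end VerK

end

noncomputable section
namespace VerK

lemma deg_one {u : X} (h : u.degree = 1) : ∃ j, u = Finsupp.single j 1 := by
  have hne : u ≠ 0 := by
    rintro rfl
    simp at h
  obtain ⟨j, hj⟩ := Finsupp.ne_iff.mp hne
  refine ⟨j, ?_⟩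
  have hle : Finsupp.single j 1 ≤ u := by
    rw [Finsupp.single_le_iff]
    exact Nat.one_le_iff_ne_zero.mpr hj
  have h3 := congrArg Finsupp.degree (tsub_add_cancel_of_le hle)
  rw [map_add, Finsupp.degree_single, h] at h3
  have h4 : (u - Finsupp.single j 1).degree = 0 := by omega
  have h5 := (Finsupp.degree_eq_zero_iff _).mp h4
  rw [← tsub_add_cancel_of_le hle, h5, zero_add]

/-- row of an exponent matrix -/
def row (w : (Fin 3 × Fin 3) →₀ ℕ) (r : Fin 3) : X :=
  Finsupp.equivFunOnFinite.symm (fun j => w (r, j))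

lemma row_apply (w : (Fin 3 × Fin 3) →₀ ℕ) (r j : Fin 3) : row w r j = w (r, j) := rfl

lemma row_inj {w w' : (Fin 3 × Fin 3) →₀ ℕ} (h : ∀ r, row w r = row w' r) : w = w' := by
  ext ⟨r, j⟩
  have := DFunLike.congr_fun (h r) j
  exact this

lemma row_sub_same (w : (Fin 3 × Fin 3) →₀ ℕ) (r j : Fin 3) :
    row (w - Finsupp.single (r, j) 1) r = row w r - Finsupp.single j 1 := by
  ext l
  simp [row_apply, Finsupp.single_apply]

lemma row_sub_ne (w : (Fin 3 × Fin 3) →₀ ℕ) {r s : Fin 3} (j : Fin 3) (h : r ≠ s) :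
    row (w - Finsupp.single (r, j) 1) s = row w s := by
  ext l
  simp [row_apply, Finsupp.single_apply, h]

/-- triple contraction -/
def c3 (α : X → Finset X → ℂ) (A : Finset X) (j : Fin 3) (a b c : X) : ℂ :=
  ct c (ct b (ct a (α (Finsupp.single j 1)))) A

lemma c3_swap01 (α : X → Finset X → ℂ) (A : Finset X) (j : Fin 3) (a b c : X) :
    c3 α A j a b c = - c3 α A j b a c := by
  unfold c3
  have : ct b (ct a (α (Finsupp.single j 1))) = - ct a (ct b (α (Finsupp.single j 1))) := by
    ext B; rw [ct_anti]; rfl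
  rw [this, map_neg]; rfl

lemma c3_swap12 (α : X → Finset X → ℂ) (A : Finset X) (j : Fin 3) (a b c : X) :
    c3 α A j a b c = - c3 α A j a c b := ct_anti _ _ _ _

open Classical in
/-- coefficient function -/
def gco (d : ℕ) (α : X → Finset X → ℂ) (A : Finset X) (j : Fin 3)
    (w : (Fin 3 × Fin 3) →₀ ℕ) : ℂ :=
  if ∀ r, (row w r).degree = d then c3 α A j (row w 0) (row w 1) (row w 2) else 0

lemma fin_w (d : ℕ) : {w : (Fin 3 × Fin 3) →₀ ℕ | ∀ r, (row w r).degree = d}.Finite := by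
  have h : (Set.pi Set.univ (fun _ : Fin 3 => {u : X | u.degree = d})).Finite :=
    Set.Finite.pi' (fun _ => finite_deg d) |>.subset (by intro f hf i; exact hf i (Set.mem_univ _))
  refine Set.Finite.of_finite_image (f := row) (h.subset ?_) ?_
  · rintro _ ⟨w, hw, rfl⟩ r _
    exact hw r
  · intro w _ w' _ h
    exact row_inj (congrFun h)

lemma exists_poly (d : ℕ) (α : X → Finset X → ℂ) (A : Finset X) (j : Fin 3) :
    ∃ F : MvPolynomial (Fin 3 × Fin 3) ℂ, ∀ w, F.coeff w = gco d α A j w := by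
  classical
  refine ⟨∑ w ∈ (fin_w d).toFinset, MvPolynomial.monomial w (gco d α A j w), fun w => ?_⟩
  rw [MvPolynomial.coeff_sum]
  simp only [MvPolynomial.coeff_monomial]
  rw [Finset.sum_ite_eq']
  split_ifs with h
  · rfl
  · rw [gco, if_neg]
    intro h'
    exact h (by simpa using h')

theorem c3_sum {d p : ℕ} {α : X → Finset X → ℂ}
    (hα : ∀ v ∈ (Set.univ : Set X), v.degree = 1 + d → ∀ A ⊆ mon d, A.card + 1 = p →
      bd (mon d) α v A = 0) {A : Finset X} (hA : A ⊆ mon d) (hAc : A.card + 3 = p)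
    {v b c : X} (hv : v.degree = 1 + d) (hb : b.degree = d) (hc : c.degree = d) :
    ∑ j : Fin 3, (if v j ≠ 0 then c3 α A j (v - Finsupp.single j 1) b c else 0) = 0 := by
  classical
  have h1 : ∑ j : Fin 3, (if v j ≠ 0 then c3 α A j (v - Finsupp.single j 1) b c else 0) =
      ct c (ct b (bd (mon d) α v)) A := by
    have h2 : bd (mon d) α v = ∑ j : Fin 3 with v j ≠ 0,
        ct (v - Finsupp.single j 1) (α (Finsupp.single j 1)) := by
      rw [bd]
      symm
      refine Finset.sum_bij (fun j _ => v - Finsupp.single j 1) ?_ ?_ ?_ ?_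
      · intro j hj
        have hj' : v j ≠ 0 := (Finset.mem_filter.mp hj).2
        have hle : Finsupp.single j 1 ≤ v := by rw [Finsupp.single_le_iff]; omega
        have h3 := congrArg Finsupp.degree (tsub_add_cancel_of_le hle)
        rw [map_add, Finsupp.degree_single] at h3
        simp only [Finset.mem_filter, mem_mon]
        exact ⟨by omega, tsub_le_self⟩
      · intro j hj k hk hjk
        have hj' : v j ≠ 0 := (Finset.mem_filter.mp hj).2
        by_contra hne
        have := DFunLike.congr_fun hjk j
        simp [hne] at this
        omega
      · intro m hm
        simp only [Finset.mem_filter, mem_mon] at hm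
        have h3 := congrArg Finsupp.degree (tsub_add_cancel_of_le hm.2)
        rw [map_add, hm.1, hv] at h3
        have h4 : (v - m).degree = 1 := by omega
        obtain ⟨j, hj⟩ := deg_one h4
        refine ⟨j, ?_, ?_⟩
        · have := DFunLike.congr_fun hj j
          simp at this
          simp; omega
        · rw [← hj]
          exact tsub_tsub_cancel_of_le hm.2
      · intro j hj
        have hj' : v j ≠ 0 := (Finset.mem_filter.mp hj).2
        have hle : Finsupp.single j 1 ≤ v := by rw [Finsupp.single_le_iff]; omega
        rw [tsub_tsub_cancel_of_le hle]
    rw [h2, map_sum, map_sum, Finset.sum_apply, Finset.sum_filter]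
    rfl
  rw [h1]
  by_cases hcA : c ∈ A
  · rw [ct_mem hcA]
  by_cases hbA : b ∈ insert c A
  · rw [ct_notMem hcA, ct_mem hbA, mul_zero]
  rw [ct_notMem hcA, ct_notMem hbA, hα v (Set.mem_univ _) hv]
  · simp
  · intro x hx
    simp only [Finset.mem_insert] at hx
    rcases hx with rfl | rfl | hx
    · simpa using hb
    · simpa using hc
    · exact hA hx
  · rw [Finset.card_insert_of_notMem hbA, Finset.card_insert_of_notMem hcA, hAc]

theorem full_green {d p : ℕ} (hp : 3 ≤ p) : Full d p 1 := by
  classical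
  intro α hα
  refine ⟨0, fun u _ hud A hA hAc => ?_⟩
  have h0 : bd (mon d) 0 u A = 0 := by
    rw [bd_apply]
    exact Finset.sum_eq_zero fun m _ => by simp
  rw [h0]
  obtain ⟨B, hBA, hBc⟩ := Finset.exists_subset_card_eq (s := A) (n := 3) (by omega)
  obtain ⟨a, b, c, hab, hac, hbc, rfl⟩ := Finset.card_eq_three.mp hBc
  have haA : a ∈ A := hBA (by simp)
  have hbA : b ∈ A := hBA (by simp)
  have hcA : c ∈ A := hBA (by simp)
  set A' := A \ {a, b, c} with hA'
  have hA'V : A' ⊆ mon d := Finset.sdiff_subset.trans hA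
  have hA'c : A'.card + 3 = p := by
    rw [hA', Finset.card_sdiff_of_subset hBA, hBc]; omega
  choose F hF using exists_poly d α A'
  have hmat : (Matrix.mvPolynomialX (Fin 3) (Fin 3) ℂ).mulVec F = 0 := by
    ext r w
    rw [Matrix.mulVec, dotProduct, MvPolynomial.coeff_sum]
    simp only [Matrix.mvPolynomialX_apply, MvPolynomial.coeff_X_mul', hF, Pi.zero_apply,
      MvPolynomial.coeff_zero]
    by_cases hw : (row w r).degree = 1 + d ∧ ∀ s, s ≠ r → (row w s).degree = d
    · have hcond : ∀ j, w (r, j) ≠ 0 →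
          ∀ s, (row (w - Finsupp.single (r, j) 1) s).degree = d := by
        intro j hj s
        by_cases hs : s = r
        · subst hs
          rw [row_sub_same]
          have hle : Finsupp.single j 1 ≤ row w s := by
            rw [Finsupp.single_le_iff, row_apply]; omega
          have h3 := congrArg Finsupp.degree (tsub_add_cancel_of_le hle)
          rw [map_add, Finsupp.degree_single] at h3
          omega
        · rw [row_sub_ne _ _ (Ne.symm hs)]
          exact hw.2 s hs
      have hgen : ∀ j, (if (r, j) ∈ w.support then gco d α A' j (w - Finsupp.single (r, j) 1)
          else 0) = if row w r j ≠ 0 then c3 α A' j (row (w - Finsupp.single (r, j) 1) 0)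
            (row (w - Finsupp.single (r, j) 1) 1) (row (w - Finsupp.single (r, j) 1) 2) else 0 := by
        intro j
        rw [row_apply]
        by_cases hj : w (r, j) = 0
        · simp [hj]
        · rw [if_pos (by simpa using hj), if_pos hj, gco, if_pos (hcond j hj)]
      rw [Finset.sum_congr rfl fun j _ => hgen j]
      obtain ⟨hw1, hw2⟩ := hw
      fin_cases r
      · simp only [Fin.zero_eta, row_sub_same, row_sub_ne _ _ (show (0 : Fin 3) ≠ 1 by decide),
          row_sub_ne _ _ (show (0 : Fin 3) ≠ 2 by decide)] at *
        exact c3_sum hα hA'V hA'c hw1 (hw2 1 (by decide)) (hw2 2 (by decide))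
      · simp only [Fin.mk_one, row_sub_same, row_sub_ne _ _ (show (1 : Fin 3) ≠ 0 by decide),
          row_sub_ne _ _ (show (1 : Fin 3) ≠ 2 by decide)] at *
        have := c3_sum hα hA'V hA'c hw1 (hw2 0 (by decide)) (hw2 2 (by decide))
        refine Eq.trans ?_ (neg_eq_zero.mpr this)
        rw [← Finset.sum_neg_distrib]
        refine Finset.sum_congr rfl fun j _ => ?_
        rw [c3_swap01]
        split_ifs <;> simp
      · simp only [Fin.reduceFinMk, row_sub_same, row_sub_ne _ _ (show (2 : Fin 3) ≠ 0 by decide),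
          row_sub_ne _ _ (show (2 : Fin 3) ≠ 1 by decide)] at *
        have := c3_sum hα hA'V hA'c hw1 (hw2 0 (by decide)) (hw2 1 (by decide))
        refine Eq.trans ?_ this
        refine Finset.sum_congr rfl fun j _ => ?_
        rw [c3_swap12, c3_swap01]
        split_ifs <;> simp
    · refine Finset.sum_eq_zero fun j _ => ?_
      split_ifs with hj
      · rw [gco, if_neg]
        intro h
        apply hw
        have hj' : w (r, j) ≠ 0 := by simpa using hj
        refine ⟨?_, fun s hs => ?_⟩
        · have hr := h r
          rw [row_sub_same] at hr
          have hle : Finsupp.single j 1 ≤ row w r := by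
            rw [Finsupp.single_le_iff, row_apply]; omega
          have h3 := congrArg Finsupp.degree (tsub_add_cancel_of_le hle)
          rw [map_add, Finsupp.degree_single] at h3
          omega
        · have hr := h s
          rwa [row_sub_ne _ _ (Ne.symm hs)] at hr
      · rfl
  have hF0 := Matrix.eq_zero_of_mulVec_eq_zero (Matrix.det_mvPolynomialX_ne_zero (Fin 3) ℂ) hmat
  obtain ⟨j, rfl⟩ := deg_one hud
  let w : (Fin 3 × Fin 3) →₀ ℕ :=
    Finsupp.equivFunOnFinite.symm (fun x => (![a, b, c] x.1) x.2)
  have hw : ∀ r, row w r = ![a, b, c] r := by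
    intro r; ext l; rfl
  have h1 := hF j w
  rw [hF0, gco, if_pos, hw, hw, hw] at h1
  · simp only [Pi.zero_apply, MvPolynomial.coeff_zero, Matrix.cons_val] at h1
    have hc' : c ∉ A' := by simp [hA']
    have hb' : b ∉ insert c A' := by simp [hA', hbc]
    have ha' : a ∉ insert b (insert c A') := by simp [hA', hab, hac]
    have h2 := ct_eq_zero ha' (ct_eq_zero hb' (ct_eq_zero hc' h1.symm))
    convert h2 using 2
    ext x
    simp only [hA', Finset.mem_insert, Finset.mem_sdiff, Finset.mem_singleton]
    constructor
    · intro hx; tauto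
    · rintro (rfl | rfl | rfl | h)
      · exact haA
      · exact hbA
      · exact hcA
      · exact h.1
  · intro r
    rw [hw]
    have ha1 := mem_mon.mp (hA haA)
    have hb1 := mem_mon.mp (hA hbA)
    have hc1 := mem_mon.mp (hA hcA)
    fin_cases r
    · exact ha1
    · exact hb1
    · exact hc1

theorem low_pair {d p e : ℕ} (he : e = d ∨ e = d + 1) :
    Full d p e ∨ Full d (p + 1) (e - d) := by
  rcases he with rfl | rfl
  · right
    rw [Nat.sub_self]
    exact full_e0 p
  · rcases p with _ | _ | p
    · exact Or.inl full_01
    · exact Or.inl full_11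
    · right
      rw [Nat.add_sub_cancel_left]
      exact full_green (by omega)

theorem all_pair {d p e : ℕ} (hd : 1 ≤ d) (hde : d ≤ e)
    (he : e = d ∨ e = d + 1 ∨ e + 4 = 3 * d ∨ 3 * d ≤ e + 3) :
    Full d p e ∨ Full d (p + 1) (e - d) := by
  by_cases h1 : e = d ∨ e = d + 1
  · exact low_pair h1
  by_cases h2 : 3 * (d - 1) < e
  · exact Or.inl (full_big_e hd h2)
  by_cases hp : (VR d).card < p + 1
  · exact Or.inr (full_big_p hd hp)
  obtain ⟨p', hp'⟩ : ∃ p', p' + p + 1 = (VR d).card := ⟨(VR d).card - p - 1, by omega⟩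
  rcases low_pair (d := d) (p := p') (e := 4 * d - 3 - e) (by omega) with h | h
  · right
    exact full_dual hd (p' := p') (e' := 4 * d - 3 - e) (by omega) (by omega) h
  · left
    exact full_dual hd (p' := p' + 1) (e' := 4 * d - 3 - e - d) (by omega) (by omega) h
end VerK

end

noncomputable section
namespace VerK

/-- index set of monomials, with its lexicographic order -/
abbrev I (k : ℕ) : Type := {m : Lex X // (ofLex m).degree = k}

instance (k : ℕ) : Finite (I k) := by
  have := (finite_deg k).to_subtype
  exact Finite.of_injective
    (fun i : I k => (⟨ofLex i.1, i.2⟩ : {u : X | u.degree = k}))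
    (by intro i j h; simpa [Subtype.ext_iff] using h)

lemma Sdeg_eq {z : ℤ} {k : ℕ} (h : z = k) :
    Sdeg 3 z = MvPolynomial.homogeneousSubmodule (Fin 3) ℂ k := by
  subst h; simp [Sdeg]

lemma monoC_mem {z : ℤ} {k : ℕ} (h : z = k) (i : I k) : monoC 3 (ofLex i.1) ∈ Sdeg 3 z := by
  rw [Sdeg_eq h, MvPolynomial.mem_homogeneousSubmodule]
  exact MvPolynomial.isHomogeneous_monomial _ i.2

/-- monomial basis -/
def sb {z : ℤ} {k : ℕ} (h : z = k) : Module.Basis (I k) ℂ (Sdeg 3 z) :=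
  Module.Basis.mk (v := fun i => (⟨monoC 3 (ofLex i.1), monoC_mem h i⟩ : Sdeg 3 z))
    (by
      refine LinearIndependent.of_comp (Sdeg 3 z).subtype ?_
      have := (MvPolynomial.basisMonomials (Fin 3) ℂ).linearIndependent.comp
        (fun i : I k => ofLex i.1) (by intro i j hij; exact Subtype.ext hij)
      have e : ((Sdeg 3 z).subtype ∘ fun i : I k =>
          (⟨monoC 3 (ofLex i.1), monoC_mem h i⟩ : Sdeg 3 z)) =
          (MvPolynomial.basisMonomials (Fin 3) ℂ) ∘ fun i : I k => ofLex i.1 := by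
        funext i
        simp [monoC]
      rw [e]
      exact this)
    (by
      rintro ⟨x, hx⟩ -
      have hx' := hx
      rw [Sdeg_eq h, MvPolynomial.mem_homogeneousSubmodule] at hx'
      have key : ∀ σ ∈ x.support, σ.degree = k := by
        intro σ hσ
        by_contra hne
        exact (MvPolynomial.mem_support_iff.mp hσ) (hx'.coeff_eq_zero hne)
      have : (⟨x, hx⟩ : Sdeg 3 z) = ∑ σ : x.support, x.coeff σ.1 •
          (⟨monoC 3 σ.1, monoC_mem h ⟨toLex σ.1, key σ.1 σ.2⟩⟩ : Sdeg 3 z) := by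
        apply Subtype.ext
        rw [Submodule.coe_sum]
        simp only [Submodule.coe_smul, monoC, MvPolynomial.smul_monomial, smul_eq_mul, mul_one]
        conv_lhs => rw [x.as_sum]
        exact (Finset.sum_coe_sort x.support
          (fun σ => MvPolynomial.monomial σ (x.coeff σ))).symm
      rw [this]
      refine Submodule.sum_mem _ fun σ _ => Submodule.smul_mem _ _ (Submodule.subset_span ?_)
      exact ⟨⟨toLex σ.1, key σ.1 σ.2⟩, rfl⟩)

lemma sb_apply {z : ℤ} {k : ℕ} (h : z = k) (i : I k) :
    ((sb h i : Sdeg 3 z) : PolyC 3) = monoC 3 (ofLex i.1) := by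
  rw [sb, Module.Basis.mk_apply]

/-- basis of exterior powers indexed by increasing sequences -/
def eb (d p : ℕ) : Module.Basis (Fin p ↪o I d) ℂ (⋀[ℂ]^p (Sdeg 3 (d : ℤ))) :=
  ((sb (z := (d : ℤ)) rfl).exteriorPower p).reindex Set.powersetCard.ofFinEmbEquiv.symm

lemma eb_apply (d p : ℕ) (f : Fin p ↪o I d) :
    eb d p f = wedgeE ℂ (Sdeg 3 (d : ℤ)) p (fun i => sb (z := (d : ℤ)) rfl (f i)) := by
  rw [eb, Module.Basis.reindex_apply, exteriorPower.basis_apply, Equiv.symm_symm]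
  simp only [exteriorPower.ιMulti_family, Equiv.symm_apply_apply]
  rfl

/-- tensor basis -/
def kb (d p : ℕ) {z : ℤ} {k : ℕ} (h : z = k) :
    Module.Basis ((Fin p ↪o I d) × I k) ℂ (KosModule 3 (d : ℤ) p z) :=
  (eb d p).tensorProduct (sb h)

lemma kb_apply (d p : ℕ) {z : ℤ} {k : ℕ} (h : z = k) (f : Fin p ↪o I d) (u : I k) :
    kb d p h (f, u) = wedgeE ℂ (Sdeg 3 (d : ℤ)) p (fun i => sb (z := (d : ℤ)) rfl (f i)) ⊗ₜ[ℂ]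
      sb h u := by
  rw [kb, Module.Basis.tensorProduct_apply, eb_apply]

/-- underlying set -/
def st {d p : ℕ} (f : Fin p ↪o I d) : Finset X := Finset.univ.image (fun i => ofLex (f i).1)

lemma mem_st {d p : ℕ} {f : Fin p ↪o I d} {m : X} : m ∈ st f ↔ ∃ i, ofLex (f i).1 = m := by
  simp [st]

lemma in_inj {d p : ℕ} (f : Fin p ↪o I d) : Function.Injective (fun i => ofLex (f i).1) := by
  intro i j hij
  exact f.injective (Subtype.ext hij)

lemma st_card {d p : ℕ} (f : Fin p ↪o I d) : (st f).card = p := by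
  rw [st, Finset.card_image_of_injective _ (in_inj f)]; simp

lemma st_sub {d p : ℕ} (f : Fin p ↪o I d) : st f ⊆ mon d := by
  intro m hm
  obtain ⟨i, rfl⟩ := mem_st.mp hm
  exact mem_mon.mpr (f i).2

lemma st_inj {d p : ℕ} : Function.Injective (st : (Fin p ↪o I d) → Finset X) := by
  intro f g h
  apply DFunLike.coe_injective
  apply (StrictMono.range_inj f.strictMono g.strictMono).mp
  ext i
  have h1 : ∀ (f : Fin p ↪o I d), i ∈ Set.range f ↔ ofLex i.1 ∈ st f := by
    intro f
    rw [mem_st]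
    exact exists_congr fun j => ⟨fun h => by rw [h], fun h => Subtype.ext h⟩
  rw [h1, h1, h]

lemma st_surj {d p : ℕ} {A : Finset X} (hA : A ⊆ mon d) (hc : A.card = p) :
    ∃ f : Fin p ↪o I d, st f = A := by
  classical
  let s : Finset (I d) := A.attach.image (fun a => ⟨toLex a.1, mem_mon.mp (hA a.2)⟩)
  have hs : s.card = p := by
    rw [Finset.card_image_of_injective, Finset.card_attach, hc]
    intro a b h
    exact Subtype.ext (congrArg (fun i : I d => ofLex i.1) h)
  refine ⟨s.orderEmbOfFin hs, ?_⟩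
  ext m
  rw [mem_st]
  constructor
  · rintro ⟨i, rfl⟩
    have := s.orderEmbOfFin_mem hs i
    obtain ⟨a, -, ha⟩ := Finset.mem_image.mp this
    rw [← ha]
    exact a.2
  · intro hm
    have h1 : (⟨toLex m, mem_mon.mp (hA hm)⟩ : I d) ∈ s :=
      Finset.mem_image.mpr ⟨⟨m, hm⟩, Finset.mem_attach _ _, rfl⟩
    have h2 : (⟨toLex m, mem_mon.mp (hA hm)⟩ : I d) ∈ Set.range (s.orderEmbOfFin hs) := by
      rw [Finset.range_orderEmbOfFin]; exact h1
    obtain ⟨i, hi⟩ := h2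
    exact ⟨i, by rw [hi]; rfl⟩

open Classical in
/-- coefficient chains -/
def C (d p : ℕ) {z : ℤ} {k : ℕ} (h : z = k) :
    KosModule 3 (d : ℤ) p z →ₗ[ℂ] (X → Finset X → ℂ) :=
  (kb d p h).constr ℂ (fun fu v A => if ofLex fu.2.1 = v ∧ st fu.1 = A then 1 else 0)

open Classical in
lemma C_kb (d p : ℕ) {z : ℤ} {k : ℕ} (h : z = k) (f : Fin p ↪o I d) (u : I k) (v : X)
    (A : Finset X) :
    C d p h (kb d p h (f, u)) v A = if ofLex u.1 = v ∧ st f = A then 1 else 0 := by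
  rw [C, Module.Basis.constr_basis]

lemma C_repr (d p : ℕ) {z : ℤ} {k : ℕ} (h : z = k) (x : KosModule 3 (d : ℤ) p z)
    (f : Fin p ↪o I d) (u : I k) :
    C d p h x (ofLex u.1) (st f) = (kb d p h).repr x (f, u) := by
  classical
  have : (LinearMap.proj (st f) ∘ₗ LinearMap.proj (φ := fun _ : X => Finset X → ℂ) (ofLex u.1))
      ∘ₗ C d p h = (kb d p h).coord (f, u) := by
    refine (kb d p h).ext ?_
    rintro ⟨g, w⟩
    simp only [LinearMap.comp_apply, LinearMap.proj_apply, C_kb, Module.Basis.coord_apply,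
      Module.Basis.repr_self, Finsupp.single_apply, Prod.mk.injEq]
    refine if_congr ?_ rfl rfl
    rw [and_comm, st_inj.eq_iff, ofLex_inj, Subtype.ext_iff]
  exact LinearMap.congr_fun this x

lemma sgn_pos {d p : ℕ} (f : Fin (p + 1) ↪o I d) (k : Fin (p + 1)) :
    sgn (ofLex (f k).1) (st ((Fin.succAboveOrderEmb k).trans f)) = (-1) ^ (k : ℕ) := by
  classical
  unfold sgn
  congr 1
  have : (st ((Fin.succAboveOrderEmb k).trans f)).filter
      (fun a => toLex a < toLex (ofLex (f k).1)) =
      (Finset.Iio k).image (fun i => ofLex (f i).1) := by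
    ext m
    simp only [Finset.mem_filter, mem_st, Finset.mem_image, Finset.mem_Iio]
    constructor
    · rintro ⟨⟨i, rfl⟩, h⟩
      refine ⟨k.succAbove i, ?_, rfl⟩
      exact f.lt_iff_lt.mp h
    · rintro ⟨i, hi, rfl⟩
      obtain ⟨j, rfl⟩ := Fin.exists_succAbove_eq hi.ne
      exact ⟨⟨j, rfl⟩, f.lt_iff_lt.mpr hi⟩
  rw [this, Finset.card_image_of_injective _ (in_inj f), Fin.card_Iio]

lemma st_succ {d p : ℕ} (f : Fin (p + 1) ↪o I d) (k : Fin (p + 1)) :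
    st ((Fin.succAboveOrderEmb k).trans f) = (st f).erase (ofLex (f k).1) := by
  classical
  ext m
  rw [mem_st, Finset.mem_erase, mem_st]
  constructor
  · rintro ⟨i, rfl⟩
    exact ⟨fun h => Fin.succAbove_ne k i (in_inj f h), _, rfl⟩
  · rintro ⟨hne, i, rfl⟩
    obtain ⟨j, rfl⟩ := Fin.exists_succAbove_eq (x := i) (y := k) (by rintro rfl; exact hne rfl)
    exact ⟨j, rfl⟩

/-- sum of exponents -/
def addI {k l n : ℕ} (h : n = k + l) (i : I k) (j : I l) : I n :=
  ⟨toLex (ofLex i.1 + ofLex j.1), by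
    have := i.2
    have := j.2
    simp only [ofLex_toLex, map_add]; omega⟩

lemma addI_val {k l n : ℕ} (h : n = k + l) (i : I k) (j : I l) :
    ofLex (addI h i j).1 = ofLex i.1 + ofLex j.1 := rfl

lemma D_kb {d p k k' : ℕ} {z z' : ℤ} (h : z = k) (h' : z' = k') (hk : k' = d + k)
    {D : KosModule 3 (d : ℤ) (p + 1) z →ₗ[ℂ] KosModule 3 (d : ℤ) p z'}
    (hD : IsKoszulDiff 3 d z z' p D) (f : Fin (p + 1) ↪o I d) (u : I k) :
    D (kb d (p + 1) h (f, u)) = ∑ i : Fin (p + 1), ((-1 : ℂ) ^ ((i : ℕ) + 1)) •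
      kb d p h' ((Fin.succAboveOrderEmb i).trans f, addI hk (f i) u) := by
  have inj : Function.Injective (TensorProduct.map
      (LinearMap.id (R := ℂ) (M := ↥(⋀[ℂ]^p ↥(Sdeg 3 (d : ℤ))))) (Sdeg 3 z').subtype) :=
    Module.Flat.lTensor_preserves_injective_linearMap (Sdeg 3 z').subtype
      (Submodule.subtype_injective _)
  apply inj
  rw [kb_apply, hD, map_sum]
  refine Finset.sum_congr rfl fun i _ => ?_
  rw [map_smul, kb_apply, TensorProduct.map_tmul]
  congr 2
  simp only [Submodule.subtype_apply, sb_apply, monoC, MvPolynomial.monomial_mul, mul_one]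
  rfl

lemma C_D {d p k k' : ℕ} {z z' : ℤ} (h : z = k) (h' : z' = k') (hk : k' = d + k)
    {D : KosModule 3 (d : ℤ) (p + 1) z →ₗ[ℂ] KosModule 3 (d : ℤ) p z'}
    (hD : IsKoszulDiff 3 d z z' p D) (x : KosModule 3 (d : ℤ) (p + 1) z) (v : X) (A : Finset X) :
    C d p h' (D x) v A = - bd (mon d) (C d (p + 1) h x) v A := by
  classical
  let L1 : KosModule 3 (d : ℤ) (p + 1) z →ₗ[ℂ] ℂ :=
    { toFun := fun x => C d p h' (D x) v A
      map_add' := by intro x y; simp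
      map_smul' := by intro c x; simp }
  let L2 : KosModule 3 (d : ℤ) (p + 1) z →ₗ[ℂ] ℂ :=
    { toFun := fun x => - bd (mon d) (C d (p + 1) h x) v A
      map_add' := by
        intro x y
        simp only [bd_apply, map_add, Pi.add_apply, Finset.sum_add_distrib]
        ring
      map_smul' := by
        intro c x
        simp only [bd_apply, map_smul, Pi.smul_apply, smul_eq_mul, ← Finset.mul_sum,
          RingHom.id_apply]
        ring }
  suffices L1 = L2 from LinearMap.congr_fun this x
  refine (kb d (p + 1) h).ext ?_
  rintro ⟨f, u⟩
  change C d p h' (D _) v A = - bd (mon d) (C d (p + 1) h _) v A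
  rw [D_kb h h' hk hD, bd_apply', map_sum, Finset.sum_apply, Finset.sum_apply]
  have e1 : ∀ m ∈ mon d, (if m ≤ v then ct m (C d (p + 1) h (kb d (p + 1) h (f, u)) (v - m)) A
      else 0) = if m ∈ st f then
        (if m + ofLex u.1 = v ∧ (st f).erase m = A then sgn m A else 0) else 0 := by
    intro m _
    by_cases hmA : m ∈ A
    · rw [ct_mem hmA, ite_self]
      split_ifs with h1 h2
      · rw [← h2.2] at hmA
        simp at hmA
      · rfl
      · rfl
    · rw [ct_notMem hmA, C_kb]
      by_cases hmf : m ∈ st f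
      · rw [if_pos hmf]
        have a1 : st f = insert m A ↔ (st f).erase m = A := by
          constructor
          · intro h1; rw [h1, Finset.erase_insert hmA]
          · rintro rfl; rw [Finset.insert_erase hmf]
        by_cases hle : m ≤ v
        · have a2 : ofLex u.1 = v - m ↔ m + ofLex u.1 = v := by
            constructor
            · intro h1; rw [h1, add_tsub_cancel_of_le hle]
            · rintro rfl; rw [add_tsub_cancel_left]
          rw [if_pos hle, mul_ite, mul_one, mul_zero]
          exact if_congr (and_congr a2 a1) rfl rfl
        · rw [if_neg hle, if_neg]
          rintro ⟨rfl, -⟩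
          exact hle le_self_add
      · rw [if_neg hmf, if_neg (c := _ ∧ _), mul_zero, ite_self]
        rintro ⟨-, h2⟩
        exact hmf (by rw [h2]; simp)
  rw [Finset.sum_congr rfl e1, ← Finset.sum_filter,
    Finset.filter_mem_eq_inter, Finset.inter_eq_right.mpr (st_sub f)]
  rw [st, Finset.sum_image (fun i _ j _ hij => in_inj f hij), ← Finset.sum_neg_distrib]
  refine Finset.sum_congr rfl fun i _ => ?_
  rw [map_smul, Pi.smul_apply, Pi.smul_apply, C_kb, st_succ]
  rw [addI_val]
  have e0 : (if ofLex (f i).1 + ofLex u.1 = v ∧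
      (Finset.univ.image (fun i => ofLex (f i).1)).erase (ofLex (f i).1) = A then
      sgn (ofLex (f i).1) A else 0) = if ofLex (f i).1 + ofLex u.1 = v ∧
      (st f).erase (ofLex (f i).1) = A then sgn (ofLex (f i).1) A else 0 := rfl
  refine Eq.trans ?_ (congrArg Neg.neg e0.symm)
  by_cases h1 : ofLex (f i).1 + ofLex u.1 = v ∧ (st f).erase (ofLex (f i).1) = A
  · have e2 : sgn (ofLex (f i).1) A = (-1) ^ (i : ℕ) := by rw [← h1.2, ← st_succ, sgn_pos]
    rw [if_pos h1, if_pos h1, e2, pow_succ, smul_eq_mul]; ring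
  · rw [if_neg h1, if_neg h1, smul_zero, neg_zero]

theorem ker_sub {d k : ℕ} {z0 z : ℤ} (p : ℕ) (h : z = k) (hz0 : z = z0 + d) 
    (hF : Full d p k)
    {D0 : KosModule 3 (d : ℤ) (p + 1) z0 →ₗ[ℂ] KosModule 3 (d : ℤ) p z}
    (hD0 : IsKoszulDiff 3 d z0 z p D0) (x : KosModule 3 (d : ℤ) p z)
    (hx : ∀ v A, A.card + 1 = p → bd (mon d) (C d p h x) v A = 0) :
    x ∈ LinearMap.range D0 := by
  classical
  obtain ⟨β, hβ⟩ := hF (C d p h x) (fun v _ _ A _ hA => hx v A hA)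
  by_cases hk : d ≤ k
  · have h0 : z0 = ((k - d : ℕ) : ℤ) := by omega
    have : Finite (Fin (p + 1) ↪o I d) :=
      Finite.of_injective (fun f => (f : Fin (p + 1) → I d)) DFunLike.coe_injective
    have := Fintype.ofFinite ((Fin (p + 1) ↪o I d) × I (k - d))
    let y : KosModule 3 (d : ℤ) (p + 1) z0 := (kb d (p + 1) h0).equivFun.symm
      (fun fu => β (ofLex fu.2.1) (st fu.1))
    have hy : ∀ (f : Fin (p + 1) ↪o I d) (u : I (k - d)), C d (p + 1) h0 y (ofLex u.1) (st f) = β (ofLex u.1) (st f) := by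
      intro f u
      rw [C_repr]
      have := (kb d (p + 1) h0).equivFun.apply_symm_apply
        (fun fu => β (ofLex fu.2.1) (st fu.1))
      exact congrFun this (f, u)
    refine ⟨(-1 : ℂ) • y, ?_⟩
    refine (kb d p h).repr.injective (Finsupp.ext ?_)
    rintro ⟨f, u⟩
    rw [map_smul, map_smul, Finsupp.smul_apply, ← C_repr, ← C_repr,
      C_D h0 h (by omega) hD0, smul_eq_mul, neg_mul_neg, one_mul,
      hβ _ (Set.mem_univ _) u.2 _ (st_sub f) (st_card f), bd_apply, bd_apply]
    refine Finset.sum_congr rfl fun m hm => ct_congr fun hmA => ?_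
    simp only [Finset.mem_filter, mem_mon] at hm
    obtain ⟨g, hg⟩ := st_surj (d := d) (p := p + 1) (A := insert m (st f))
      (Finset.insert_subset (mem_mon.mpr hm.1) (st_sub f))
      (by rw [Finset.card_insert_of_notMem hmA, st_card])
    rw [← hg]
    have h3 := congrArg Finsupp.degree (tsub_add_cancel_of_le hm.2)
    rw [map_add, hm.1, u.2] at h3
    exact hy g ⟨toLex (ofLex u.1 - m), by rw [ofLex_toLex]; omega⟩
  · suffices x = 0 by rw [this]; exact zero_mem _
    refine (kb d p h).repr.injective (Finsupp.ext ?_)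
    rintro ⟨f, u⟩
    rw [← C_repr, hβ _ (Set.mem_univ _) u.2 _ (st_sub f) (st_card f), bd_apply]
    rw [map_zero, Finsupp.zero_apply]
    refine Finset.sum_eq_zero fun m hm => ?_
    simp only [Finset.mem_filter, mem_mon] at hm
    have h3 := congrArg Finsupp.degree (tsub_add_cancel_of_le hm.2)
    rw [map_add, hm.1, u.2] at h3
    omega

theorem Kdim_zero {d p k : ℕ} {b q : ℤ} {D : KFam 3 d} (hD : IsKoszulFam 3 d D)
    (h : b + q * d = k) (hF : Full d p k) : Kdim 3 d D b p q = 0 := by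
  have h1 : b + q * d = (b + (q - 1) * d) + d := by ring
  have h2 : b + (q + 1) * d = (b + q * d) + d := by ring
  cases p with
  | zero =>
    have : LinearMap.range (D 0 (b + (q - 1) * d) (b + q * d)) = ⊤ := by
      rw [eq_top_iff]
      intro x _
      exact ker_sub 0 h h1 hF (hD _ _ _ h1) x (fun v A hA => by omega)
    rw [Kdim, this, cdim, cdim, rank_top, Nat.sub_self]
  | succ p =>
    have : LinearMap.ker (D p (b + q * d) (b + (q + 1) * d)) ≤
        LinearMap.range (D (p + 1) (b + (q - 1) * d) (b + q * d)) := by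
      intro x hx
      refine ker_sub (p + 1) h h1 hF (hD _ _ _ h1) x (fun v A _ => ?_)
      have h3 : b + (q + 1) * d = ((d + k : ℕ) : ℤ) := by push_cast; rw [h2, h]; ring
      have := C_D h h3 rfl (hD _ _ _ h2) x v A
      rw [LinearMap.mem_ker.mp hx, map_zero] at this
      rw [← neg_eq_zero, ← this]; rfl
    rw [Kdim, inf_eq_right.mpr this, Nat.sub_self]

theorem Kdim_neg {d p : ℕ} {b q : ℤ} {D : KFam 3 d}
    (h : b + q * d < 0) : Kdim 3 d D b (p + 1) q = 0 := by
  have h0 : Sdeg 3 (b + q * d) = ⊥ := by rw [Sdeg, if_neg (by omega)]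
  have : Subsingleton (Sdeg 3 (b + q * d)) := by rw [h0]; infer_instance
  have : Subsingleton (KosModule 3 (d : ℤ) (p + 1) (b + q * d)) := inferInstance
  have h3 : cdim (LinearMap.ker (D p (b + q * d) (b + (q + 1) * d))) = 0 := by
    rw [cdim, rank_subsingleton']; simp
  rw [Kdim, h3, Nat.zero_sub]

end VerK
end

/-- Empty relevant range in small cases: for `1 ≤ d ≤ 3`, `0 ≤ b ≤ d`, and for
`(d,b) ∈ {(4,0),(4,1)}`, there is no pair `(p,q)` with both `K_{p,q}(ℙ²,b;d) ≠ 0`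
and `K_{p+1,q-1}(ℙ²,b;d) ≠ 0`. -/
theorem veronese_empty_relevant_range_small_cases
    (d : ℕ) (b : ℤ)
    (h : (1 ≤ d ∧ d ≤ 3 ∧ 0 ≤ b ∧ b ≤ (d : ℤ)) ∨ (d = 4 ∧ (b = 0 ∨ b = 1)))
    (D : KFam 3 d) (hD : IsKoszulFam 3 d D) :
    ¬ ∃ (p : ℕ) (q : ℤ), Kdim 3 d D b p q ≠ 0 ∧ Kdim 3 d D b (p + 1) (q - 1) ≠ 0 := by
  rintro ⟨p, q, h1, h2⟩
  have h0 : b + (q - 1) * d = b + q * d - d := by ring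
  by_cases hneg : b + (q - 1) * d < 0
  · exact h2 (VerK.Kdim_neg hneg)
  obtain ⟨e, he⟩ : ∃ e : ℕ, b + q * d = e := ⟨(b + q * d).toNat, by omega⟩
  have hde : d ≤ e := by omega
  have hd : 1 ≤ d := by omega
  have key : e = d ∨ e = d + 1 ∨ e + 4 = 3 * d ∨ 3 * d ≤ e + 3 := by
    rcases h with ⟨_, hd3, _, _⟩ | ⟨rfl, hb⟩
    · omega
    · push_cast at he
      omega
  rcases VerK.all_pair (p := p) hd hde key with hF | hF
  · exact h1 (VerK.Kdim_zero hD he hF)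
  · exact h2 (VerK.Kdim_zero hD (by rw [h0, he]; omega) hF)
end
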